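/- arXiv:1112.2554 — 2 statements merged into one kernel-verified Lean document; each statement's English description precedes it below -/
import Mathlib

section
/- For any integer l ≥ 5, one has ((l+1)(l²−l+6)/48) ζ(l) = Σ_{l₁≥2, l₂,l₃,l₄≥1, l₁+l₂+l₃+l₄=l} 2^{l₁−1} ζ(l₁,l₂,l₃,l₄) + (1/2) Σ_{l₁≥2, l₂,l₃≥1, l₁+l₂+l₃=l} (l−l₁−2) 2^{l₁−1} ζ(l₁,l₂,l₃) + (1/8) Σ_{l₁≥2, l₂≥1, l₁+l₂=l} (l−l₁−1)(l−l₁−2) 2^{l₁−1} ζ(l₁,l₂). -/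
open scoped BigOperators

/-- The multiple zeta value `ζ(l₁, …, lₙ)`, as a sum over strictly decreasing
tuples of positive integers. -/
noncomputable def mzv {n : ℕ} (l : Fin n → ℕ) : ℝ :=
  ∑' m : {m : Fin n → ℕ // StrictAnti m ∧ ∀ i, 0 < m i},
    ∏ i, ((m.1 i : ℝ) ^ (l i))⁻¹

/-- The Riemann zeta value `ζ(k)`. -/
noncomputable def rz (k : ℕ) : ℝ := ∑' m : ℕ+, ((m : ℝ) ^ k)⁻¹

open Finset Filter Topology

/-- The shifted reciprocal `1 / (k + 1 + s)`. -/
noncomputable def shiftRecip (s : ℝ) (k : ℕ) : ℝ := ((k : ℝ) + 1 + s)⁻¹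

/-- The power sum of degree `j` of the first `m` shifted reciprocals. -/
noncomputable def recipPsum (j : ℕ) (s : ℝ) (m : ℕ) : ℝ := ∑ k ∈ range m, shiftRecip s k ^ j

/-- The second elementary symmetric function of the first `m` shifted reciprocals. -/
noncomputable def recipEsum (s : ℝ) (m : ℕ) : ℝ :=
  ∑ k ∈ range m, shiftRecip s k * recipPsum 1 s k

/-- The difference `1 / (m + 1) - 1 / (m + 1 + s)`. -/
noncomputable def recipGap (s : ℝ) (m : ℕ) : ℝ := ((m : ℝ) + 1)⁻¹ - shiftRecip s m

/-- One plus the `m`-th harmonic number. -/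
noncomputable def harmonicBound (m : ℕ) : ℝ := 1 + recipPsum 1 0 m

/-- A summable sequence dominating the terms of the series studied below. -/
noncomputable def majorant (m : ℕ) : ℝ := harmonicBound m ^ 3 * (((m : ℝ) + 1) ^ 2)⁻¹

lemma shiftRecip_pos {s : ℝ} (hs : 0 ≤ s) (k : ℕ) : 0 < shiftRecip s k := by
  unfold shiftRecip; positivity

lemma shiftRecip_le {s : ℝ} (hs : 0 ≤ s) (k : ℕ) : shiftRecip s k ≤ ((k : ℝ) + 1)⁻¹ := by
  exact inv_anti₀ (by positivity) (by linarith)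

lemma shiftRecip_le_one {s : ℝ} (hs : 0 ≤ s) (k : ℕ) : shiftRecip s k ≤ 1 := by
  refine (shiftRecip_le hs k).trans (inv_le_one_of_one_le₀ ?_)
  linarith [k.cast_nonneg (α := ℝ)]

lemma shiftRecip_shift (s : ℝ) (k : ℕ) : shiftRecip (s + 1) k = shiftRecip s (k + 1) := by
  unfold shiftRecip; push_cast; congr 1; ring

lemma recipPsum_succ (j : ℕ) (s : ℝ) (m : ℕ) :
    recipPsum j s (m + 1) = recipPsum j s m + shiftRecip s m ^ j := by
  simp [recipPsum, sum_range_succ]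

lemma recipEsum_succ (s : ℝ) (m : ℕ) :
    recipEsum s (m + 1) = recipEsum s m + shiftRecip s m * recipPsum 1 s m := by
  simp [recipEsum, sum_range_succ]

lemma recipPsum_shift (j : ℕ) (s : ℝ) (m : ℕ) :
    recipPsum j (s + 1) m = recipPsum j s m + shiftRecip s m ^ j - shiftRecip s 0 ^ j := by
  induction m with
  | zero => simp [recipPsum]
  | succ m ih => rw [recipPsum_succ, ih, recipPsum_succ, shiftRecip_shift]; ring

lemma recipEsum_shift (s : ℝ) (m : ℕ) :
    recipEsum (s + 1) m =
      recipEsum s (m + 1) - shiftRecip s 0 * (recipPsum 1 s (m + 1) - shiftRecip s 0) := by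
  induction m with
  | zero => simp [recipEsum, recipPsum]
  | succ m ih =>
    rw [recipEsum_succ, ih, recipEsum_succ s (m + 1), shiftRecip_shift, recipPsum_shift,
      recipPsum_succ 1 s (m + 1), recipPsum_succ 1 s m]
    ring

lemma two_mul_recipEsum (s : ℝ) (m : ℕ) :
    2 * recipEsum s m + recipPsum 2 s m = recipPsum 1 s m ^ 2 := by
  induction m with
  | zero => simp [recipEsum, recipPsum]
  | succ m ih => rw [recipEsum_succ, recipPsum_succ, recipPsum_succ, add_sq, ← ih]; ring

lemma recipPsum_nonneg {s : ℝ} (hs : 0 ≤ s) (j m : ℕ) : 0 ≤ recipPsum j s m :=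
  sum_nonneg fun k _ => pow_nonneg (shiftRecip_pos hs k).le j

lemma recipEsum_nonneg {s : ℝ} (hs : 0 ≤ s) (m : ℕ) : 0 ≤ recipEsum s m :=
  sum_nonneg fun k _ => mul_nonneg (shiftRecip_pos hs k).le (recipPsum_nonneg hs 1 k)

lemma one_le_harmonicBound (m : ℕ) : 1 ≤ harmonicBound m :=
  le_add_of_nonneg_right (recipPsum_nonneg le_rfl 1 m)

lemma recipPsum_le {s : ℝ} (hs : 0 ≤ s) {j : ℕ} (hj : 1 ≤ j) (m : ℕ) :
    recipPsum j s m ≤ harmonicBound m := by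
  refine le_trans (sum_le_sum fun k _ => ?_) (le_add_of_nonneg_left zero_le_one)
  calc shiftRecip s k ^ j ≤ shiftRecip s k ^ 1 :=
        pow_le_pow_of_le_one (shiftRecip_pos hs k).le (shiftRecip_le_one hs k) hj
    _ ≤ shiftRecip 0 k ^ 1 := by
        have := shiftRecip_le hs k
        simpa [shiftRecip] using this

lemma recipEsum_le {s : ℝ} (hs : 0 ≤ s) (m : ℕ) : recipEsum s m ≤ harmonicBound m ^ 2 := by
  have h1 := two_mul_recipEsum s m
  have h2 := recipPsum_nonneg hs 2 m
  have h3 := recipEsum_nonneg hs m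
  have h4 : recipPsum 1 s m ^ 2 ≤ harmonicBound m ^ 2 :=
    pow_le_pow_left₀ (recipPsum_nonneg hs 1 m) (recipPsum_le hs le_rfl m) 2
  linarith

lemma recipGap_eq {s : ℝ} (hs : 0 ≤ s) (m : ℕ) :
    recipGap s m = s * (shiftRecip s m * ((m : ℝ) + 1)⁻¹) := by
  have h1 : (m : ℝ) + 1 ≠ 0 := by positivity
  have h2 : (m : ℝ) + 1 + s ≠ 0 := by positivity
  unfold recipGap shiftRecip
  field_simp
  ring

lemma recipGap_nonneg {s : ℝ} (hs : 0 ≤ s) (m : ℕ) : 0 ≤ recipGap s m :=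
  sub_nonneg.2 (shiftRecip_le hs m)

lemma recipGap_le {s : ℝ} (hs : 0 ≤ s) (m : ℕ) : recipGap s m ≤ s * (((m : ℝ) + 1) ^ 2)⁻¹ := by
  rw [recipGap_eq hs, sq, mul_inv]
  gcongr
  exact shiftRecip_le hs m

lemma harmonicBound_le (m : ℕ) : harmonicBound m ≤ 10 * ((m : ℝ) + 1) ^ (1 / 8 : ℝ) := by
  have h1 : recipPsum 1 0 m ≤ 1 + Real.log (m + 1) := by
    have h2 := harmonic_le_one_add_log m
    have h3 : recipPsum 1 0 m = (harmonic m : ℝ) := by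
      simp [recipPsum, harmonic, shiftRecip]
    rw [h3]
    refine h2.trans ?_
    rcases Nat.eq_zero_or_pos m with rfl | hm
    · simp
    · have : (0 : ℝ) < m := by exact_mod_cast hm
      gcongr
      linarith
  have h4 : Real.log (m + 1) ≤ ((m : ℝ) + 1) ^ (1 / 8 : ℝ) / (1 / 8) :=
    Real.log_le_rpow_div (by positivity) (by norm_num)
  have h5 : (1 : ℝ) ≤ ((m : ℝ) + 1) ^ (1 / 8 : ℝ) :=
    Real.one_le_rpow (by linarith [m.cast_nonneg (α := ℝ)]) (by norm_num)
  unfold harmonicBound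
  linarith

lemma harmonicBound_cube_le (m : ℕ) :
    harmonicBound m ^ 3 ≤ 1000 * ((m : ℝ) + 1) ^ (3 / 8 : ℝ) := by
  have h0 : (0 : ℝ) ≤ (m : ℝ) + 1 := by positivity
  calc harmonicBound m ^ 3 ≤ (10 * ((m : ℝ) + 1) ^ (1 / 8 : ℝ)) ^ 3 :=
        pow_le_pow_left₀ (zero_le_one.trans (one_le_harmonicBound m)) (harmonicBound_le m) 3
    _ = 1000 * ((m : ℝ) + 1) ^ (3 / 8 : ℝ) := by
        rw [mul_pow, ← Real.rpow_natCast (((m : ℝ) + 1) ^ (1 / 8 : ℝ)) 3, ← Real.rpow_mul h0]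
        norm_num

lemma majorant_nonneg (m : ℕ) : 0 ≤ majorant m :=
  mul_nonneg (pow_nonneg (zero_le_one.trans (one_le_harmonicBound m)) 3) (by positivity)

lemma summable_majorant : Summable majorant := by
  have h1 : Summable fun m : ℕ => (1000 : ℝ) * ((m : ℝ) + 1) ^ (-(13 / 8) : ℝ) := by
    have h2 : Summable fun m : ℕ => (m : ℝ) ^ (-(13 / 8) : ℝ) :=
      Real.summable_nat_rpow.2 (by norm_num)
    have h3 := (summable_nat_add_iff 1).2 h2
    simpa using h3.mul_left 1000
  refine Summable.of_nonneg_of_le majorant_nonneg (fun m => ?_) h1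
  have h0 : (0 : ℝ) < (m : ℝ) + 1 := by positivity
  calc majorant m ≤ 1000 * ((m : ℝ) + 1) ^ (3 / 8 : ℝ) * (((m : ℝ) + 1) ^ 2)⁻¹ := by
        unfold majorant
        gcongr
        exact harmonicBound_cube_le m
    _ = 1000 * ((m : ℝ) + 1) ^ (-(13 / 8) : ℝ) := by
        rw [← Real.rpow_natCast, ← Real.rpow_neg h0.le, mul_assoc, ← Real.rpow_add h0]
        norm_num

lemma tendsto_harmonicBound_cube_div :
    Tendsto (fun m : ℕ => harmonicBound m ^ 3 * ((m : ℝ) + 1)⁻¹) atTop (𝓝 0) := by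
  have h1 : Tendsto (fun m : ℕ => (1000 : ℝ) * ((m : ℝ) + 1) ^ (-(5 / 8) : ℝ)) atTop (𝓝 0) := by
    have h2 : Tendsto (fun m : ℕ => ((m : ℝ) + 1) ^ (-(5 / 8) : ℝ)) atTop (𝓝 0) :=
      (tendsto_rpow_neg_atTop (by norm_num : (0 : ℝ) < 5 / 8)).comp
        (tendsto_atTop_add_const_right _ _ tendsto_natCast_atTop_atTop)
    simpa using h2.const_mul 1000
  refine squeeze_zero (fun m => ?_) (fun m => ?_) h1
  · exact mul_nonneg (pow_nonneg (zero_le_one.trans (one_le_harmonicBound m)) 3) (by positivity)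
  · have h0 : (0 : ℝ) < (m : ℝ) + 1 := by positivity
    calc harmonicBound m ^ 3 * ((m : ℝ) + 1)⁻¹
        ≤ 1000 * ((m : ℝ) + 1) ^ (3 / 8 : ℝ) * ((m : ℝ) + 1)⁻¹ := by
          gcongr
          exact harmonicBound_cube_le m
      _ = 1000 * ((m : ℝ) + 1) ^ (-(5 / 8) : ℝ) := by
          rw [← Real.rpow_neg_one, mul_assoc, ← Real.rpow_add h0]
          norm_num

/-- The series `∑ 1 / (m + 1 + s) ^ j`. -/
noncomputable def hurwitzSum (j : ℕ) (s : ℝ) : ℝ := ∑' m, shiftRecip s m ^ j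

/-- The series `∑ (1 / (m + 1) - 1 / (m + 1 + s)) / (m + 1) ^ j`. -/
noncomputable def gapSum (j : ℕ) (s : ℝ) : ℝ := ∑' m, recipGap s m * (((m : ℝ) + 1)⁻¹) ^ j

/-- The depth two sum formula series. -/
noncomputable def gapSumPsum (s : ℝ) : ℝ := ∑' m, recipGap s m * recipPsum 1 s m

/-- The depth three sum formula series. -/
noncomputable def gapSumEsum (s : ℝ) : ℝ := ∑' m, recipGap s m * recipEsum s m

/-- The derivative of the depth two sum formula series. -/
noncomputable def gapSumDeriv (s : ℝ) : ℝ :=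
  ∑' m, (recipPsum 1 s m * shiftRecip s m ^ 2 - recipGap s m * recipPsum 2 s m)

/-- The symmetric function weighting the outermost summation variable. -/
noncomputable def symWeight (s : ℝ) (m : ℕ) : ℝ :=
  recipPsum 1 s m ^ 3 / 6 + recipPsum 3 s m / 12

/-- The generating function of the weighted sums of depth at most four. -/
noncomputable def weightedSum (s : ℝ) : ℝ := ∑' m, recipGap (2 * s) m * symWeight s m

lemma summable_of_le_majorant {f : ℕ → ℝ} (C : ℝ) (h0 : ∀ m, 0 ≤ f m)
    (h : ∀ m, f m ≤ C * majorant m) : Summable f :=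
  Summable.of_nonneg_of_le h0 h (summable_majorant.mul_left C)

lemma pow_mul_le_majorant {m j : ℕ} (hj : j ≤ 3) {g : ℝ} (hg : g ≤ harmonicBound m ^ j) :
    (((m : ℝ) + 1) ^ 2)⁻¹ * g ≤ majorant m := by
  rw [majorant, mul_comm]
  gcongr
  exact hg.trans (pow_le_pow_right₀ (one_le_harmonicBound m) hj)

lemma recipGap_mul_le {s : ℝ} (hs : 0 ≤ s) {m j : ℕ} (hj : j ≤ 3) {g : ℝ} (hg0 : 0 ≤ g)
    (hg : g ≤ harmonicBound m ^ j) : recipGap s m * g ≤ s * majorant m :=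
  calc recipGap s m * g ≤ s * (((m : ℝ) + 1) ^ 2)⁻¹ * g := by
        gcongr
        exact recipGap_le hs m
    _ ≤ s * majorant m := by
        rw [mul_assoc]
        exact mul_le_mul_of_nonneg_left (pow_mul_le_majorant hj hg) hs

lemma inv_sq_le_majorant (m : ℕ) : (((m : ℝ) + 1) ^ 2)⁻¹ ≤ majorant m := by
  simpa using pow_mul_le_majorant (m := m) (j := 0) (by norm_num) (g := 1) (by simp)

lemma inv_succ_pow_le_one (m j : ℕ) : ((m : ℝ) + 1)⁻¹ ^ j ≤ 1 :=
  pow_le_one₀ (by positivity) (inv_le_one_of_one_le₀ (by linarith [m.cast_nonneg (α := ℝ)]))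

lemma symWeight_nonneg {s : ℝ} (hs : 0 ≤ s) (m : ℕ) : 0 ≤ symWeight s m := by
  have h1 := recipPsum_nonneg hs 1 m
  have h2 := recipPsum_nonneg hs 3 m
  unfold symWeight
  positivity

lemma symWeight_le {s : ℝ} (hs : 0 ≤ s) (m : ℕ) : symWeight s m ≤ harmonicBound m ^ 3 := by
  have h1 : recipPsum 1 s m ^ 3 ≤ harmonicBound m ^ 3 :=
    pow_le_pow_left₀ (recipPsum_nonneg hs 1 m) (recipPsum_le hs le_rfl m) 3
  have h2 := recipPsum_le hs (j := 3) (by norm_num) m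
  have h3 := le_self_pow₀ (one_le_harmonicBound m) (by norm_num : 3 ≠ 0)
  have h4 := pow_nonneg (zero_le_one.trans (one_le_harmonicBound m)) 3
  unfold symWeight
  linarith

lemma shiftRecip_sq_le {s : ℝ} (hs : 0 ≤ s) (m : ℕ) :
    shiftRecip s m ^ 2 ≤ (((m : ℝ) + 1) ^ 2)⁻¹ := by
  rw [← inv_pow]
  exact pow_le_pow_left₀ (shiftRecip_pos hs m).le (shiftRecip_le hs m) 2

lemma shiftRecip_pow_le_majorant {s : ℝ} (hs : 0 ≤ s) {j : ℕ} (hj : 2 ≤ j) (m : ℕ) :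
    shiftRecip s m ^ j ≤ majorant m :=
  ((pow_le_pow_of_le_one (shiftRecip_pos hs m).le (shiftRecip_le_one hs m) hj).trans
    (shiftRecip_sq_le hs m)).trans (inv_sq_le_majorant m)

lemma summable_shiftRecip_pow {s : ℝ} (hs : 0 ≤ s) {j : ℕ} (hj : 2 ≤ j) :
    Summable fun m => shiftRecip s m ^ j :=
  summable_of_le_majorant 1 (fun m => pow_nonneg (shiftRecip_pos hs m).le j) fun m => by
    simpa using shiftRecip_pow_le_majorant hs hj m

lemma recipGap_mul_inv_pow_le {s : ℝ} (hs : 0 ≤ s) (j m : ℕ) :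
    recipGap s m * ((m : ℝ) + 1)⁻¹ ^ j ≤ s * majorant m :=
  recipGap_mul_le hs (j := 0) (by norm_num) (by positivity)
    (by simpa using inv_succ_pow_le_one m j)

lemma summable_gapSum {s : ℝ} (hs : 0 ≤ s) (j : ℕ) :
    Summable fun m => recipGap s m * (((m : ℝ) + 1)⁻¹) ^ j :=
  summable_of_le_majorant s (fun m => mul_nonneg (recipGap_nonneg hs m) (by positivity))
    (recipGap_mul_inv_pow_le hs j)

lemma recipGap_mul_recipPsum_le {s : ℝ} (hs : 0 ≤ s) (m : ℕ) :
    recipGap s m * recipPsum 1 s m ≤ s * majorant m :=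
  recipGap_mul_le hs (j := 1) (by norm_num) (recipPsum_nonneg hs 1 m)
    (by simpa using recipPsum_le hs le_rfl m)

lemma summable_gapSumPsum {s : ℝ} (hs : 0 ≤ s) :
    Summable fun m => recipGap s m * recipPsum 1 s m :=
  summable_of_le_majorant s
    (fun m => mul_nonneg (recipGap_nonneg hs m) (recipPsum_nonneg hs 1 m))
    (recipGap_mul_recipPsum_le hs)

lemma recipGap_mul_recipEsum_le {s : ℝ} (hs : 0 ≤ s) (m : ℕ) :
    recipGap s m * recipEsum s m ≤ s * majorant m :=
  recipGap_mul_le hs (j := 2) (by norm_num) (recipEsum_nonneg hs m) (recipEsum_le hs m)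

lemma summable_gapSumEsum {s : ℝ} (hs : 0 ≤ s) :
    Summable fun m => recipGap s m * recipEsum s m :=
  summable_of_le_majorant s
    (fun m => mul_nonneg (recipGap_nonneg hs m) (recipEsum_nonneg hs m))
    (recipGap_mul_recipEsum_le hs)

lemma summable_weightedSum {s : ℝ} (hs : 0 ≤ s) :
    Summable fun m => recipGap (2 * s) m * symWeight s m :=
  summable_of_le_majorant (2 * s)
    (fun m => mul_nonneg (recipGap_nonneg (by positivity) m) (symWeight_nonneg hs m))
    (fun m => recipGap_mul_le (by positivity) le_rfl (symWeight_nonneg hs m) (symWeight_le hs m))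

lemma recipPsum_mul_sq_le {s : ℝ} (hs : 0 ≤ s) (m : ℕ) :
    recipPsum 1 s m * shiftRecip s m ^ 2 ≤ majorant m :=
  calc recipPsum 1 s m * shiftRecip s m ^ 2
      ≤ recipPsum 1 s m * (((m : ℝ) + 1) ^ 2)⁻¹ := by
        have := recipPsum_nonneg hs 1 m
        gcongr
        exact shiftRecip_sq_le hs m
    _ ≤ majorant m := by
        rw [mul_comm]
        exact pow_mul_le_majorant (j := 1) (by norm_num) (by simpa using recipPsum_le hs le_rfl m)

lemma mul_recipPsum_two_le {s : ℝ} (hs : 0 ≤ s) (m : ℕ) :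
    s * recipPsum 2 s m ≤ recipPsum 1 s m := by
  unfold recipPsum
  rw [mul_sum]
  refine sum_le_sum fun k _ => ?_
  have h1 : s * shiftRecip s k ≤ 1 := by
    unfold shiftRecip
    rw [← div_eq_mul_inv, div_le_one (by positivity)]
    linarith [k.cast_nonneg (α := ℝ)]
  have h2 := shiftRecip_pos hs k
  calc s * shiftRecip s k ^ 2 = s * shiftRecip s k * shiftRecip s k := by ring
    _ ≤ 1 * shiftRecip s k := by gcongr
    _ = shiftRecip s k ^ 1 := by ring

lemma recipGap_mul_recipPsum_two_le {s : ℝ} (hs : 0 ≤ s) (m : ℕ) :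
    recipGap s m * recipPsum 2 s m ≤ majorant m := by
  have h := recipPsum_nonneg hs 2 m
  calc recipGap s m * recipPsum 2 s m
      ≤ s * (((m : ℝ) + 1) ^ 2)⁻¹ * recipPsum 2 s m := by
        gcongr
        exact recipGap_le hs m
    _ = (((m : ℝ) + 1) ^ 2)⁻¹ * (s * recipPsum 2 s m) := by ring
    _ ≤ majorant m := pow_mul_le_majorant (j := 1) (by norm_num)
        (by simpa using (mul_recipPsum_two_le hs m).trans (recipPsum_le hs le_rfl m))

lemma summable_recipPsum_mul_sq {s : ℝ} (hs : 0 ≤ s) :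
    Summable fun m => recipPsum 1 s m * shiftRecip s m ^ 2 :=
  summable_of_le_majorant 1
    (fun m => mul_nonneg (recipPsum_nonneg hs 1 m) (pow_nonneg (shiftRecip_pos hs m).le 2))
    fun m => by simpa using recipPsum_mul_sq_le hs m

lemma summable_recipGap_mul_recipPsum_two {s : ℝ} (hs : 0 ≤ s) :
    Summable fun m => recipGap s m * recipPsum 2 s m :=
  summable_of_le_majorant 1
    (fun m => mul_nonneg (recipGap_nonneg hs m) (recipPsum_nonneg hs 2 m))
    fun m => by simpa using recipGap_mul_recipPsum_two_le hs m

lemma summable_gapSumDeriv {s : ℝ} (hs : 0 ≤ s) :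
    Summable fun m => recipPsum 1 s m * shiftRecip s m ^ 2 - recipGap s m * recipPsum 2 s m :=
  (summable_recipPsum_mul_sq hs).sub (summable_recipGap_mul_recipPsum_two hs)

lemma tsum_sub_tsum_of_telescoping {f f' g h : ℕ → ℝ} (hf : Summable f) (hf' : Summable f')
    (hg : Summable g) (hh : Tendsto h atTop (𝓝 0))
    (H : ∀ m, f m - f' m = h (m + 1) - h m + g m) :
    ∑' m, f m - ∑' m, f' m = ∑' m, g m - h 0 := by
  have h1 : Summable fun m => h (m + 1) - h m :=
    ((hf.sub hf').sub hg).congr fun m => by rw [H]; ring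
  have h2 : HasSum (fun m => h (m + 1) - h m) (0 - h 0) := by
    rw [h1.hasSum_iff_tendsto_nat]
    simp_rw [sum_range_sub]
    exact hh.sub_const _
  have h3 := (h2.add hg.hasSum).unique
    (((hf.hasSum.sub hf'.hasSum)).congr_fun fun m => (H m).symm)
  linarith

lemma tendsto_zero_of_le_harmonicBound {h : ℕ → ℝ} (C : ℝ)
    (H : ∀ m, |h m| ≤ C * (harmonicBound m ^ 3 * ((m : ℝ) + 1)⁻¹)) :
    Tendsto h atTop (𝓝 0) :=
  squeeze_zero_norm H (by simpa using tendsto_harmonicBound_cube_div.const_mul C)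

lemma tendsto_shiftRecip_mul {s : ℝ} (hs : 0 ≤ s) {j : ℕ} (hj : j ≤ 3) {g : ℕ → ℝ}
    (hg0 : ∀ m, 0 ≤ g m) (hg : ∀ m, g m ≤ harmonicBound m ^ j) :
    Tendsto (fun m => shiftRecip s m * g m) atTop (𝓝 0) :=
  tendsto_zero_of_le_harmonicBound 1 fun m => by
    rw [abs_of_nonneg (mul_nonneg (shiftRecip_pos hs m).le (hg0 m)), one_mul, mul_comm]
    have h1 := (hg m).trans (pow_le_pow_right₀ (one_le_harmonicBound m) hj)
    have h2 := pow_nonneg (zero_le_one.trans (one_le_harmonicBound m)) 3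
    have h3 := (shiftRecip_pos hs m).le
    gcongr
    exact shiftRecip_le hs m

lemma gapSum_div {s : ℝ} (hs : 0 < s) (j : ℕ) :
    gapSum j s / s = ∑' m : ℕ, shiftRecip s m * ((m : ℝ) + 1)⁻¹ ^ (j + 1) := by
  rw [gapSum, ← tsum_div_const]
  refine tsum_congr fun m => ?_
  rw [recipGap_eq hs.le, div_eq_iff hs.ne']
  ring

lemma summable_shiftRecip_mul_inv_pow {s : ℝ} (hs : 0 ≤ s) (j : ℕ) :
    Summable fun m : ℕ => shiftRecip s m * ((m : ℝ) + 1)⁻¹ ^ (j + 1) := by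
  refine summable_of_le_majorant 1
    (fun m => mul_nonneg (shiftRecip_pos hs m).le (by positivity)) fun m => ?_
  calc shiftRecip s m * ((m : ℝ) + 1)⁻¹ ^ (j + 1)
      ≤ ((m : ℝ) + 1)⁻¹ * ((m : ℝ) + 1)⁻¹ ^ (j + 1) := by
        gcongr
        exact shiftRecip_le hs m
    _ = (((m : ℝ) + 1) ^ 2)⁻¹ * ((m : ℝ) + 1)⁻¹ ^ j := by rw [← inv_pow]; ring
    _ ≤ majorant m := pow_mul_le_majorant (j := 0) (by norm_num)
        (by simpa using inv_succ_pow_le_one m j)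
    _ = 1 * majorant m := (one_mul _).symm

lemma gapSum_succ_sub {s : ℝ} (hs : 0 < s) (j : ℕ) :
    gapSum (j + 1) s - gapSum (j + 1) (s + 1) = gapSum j (s + 1) / (s + 1) - gapSum j s / s := by
  have hs' : 0 < s + 1 := by positivity
  rw [gapSum_div hs, gapSum_div hs', gapSum, gapSum,
    ← (summable_gapSum hs.le _).tsum_sub (summable_gapSum hs'.le _),
    ← (summable_shiftRecip_mul_inv_pow hs'.le j).tsum_sub
      (summable_shiftRecip_mul_inv_pow hs.le j)]
  refine tsum_congr fun m => ?_
  unfold recipGap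
  ring

lemma summable_shiftRecip_mul_inv_mul_recipPsum {s : ℝ} (hs : 0 < s) :
    Summable fun m : ℕ => shiftRecip s m * ((m : ℝ) + 1)⁻¹ * recipPsum 1 s m :=
  ((summable_gapSumPsum hs.le).div_const s).congr fun m => by
    rw [recipGap_eq hs.le]; field_simp

lemma gapSumPsum_div {s : ℝ} (hs : 0 < s) :
    gapSumPsum s / s = ∑' m : ℕ, shiftRecip s m * ((m : ℝ) + 1)⁻¹ * recipPsum 1 s m := by
  rw [gapSumPsum, ← tsum_div_const]
  refine tsum_congr fun m => ?_
  rw [recipGap_eq hs.le]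
  field_simp

lemma gapSumPsum_sub {s : ℝ} (hs : 0 < s) :
    gapSumPsum s - gapSumPsum (s + 1) = gapSum 0 (s + 1) / (s + 1) - gapSum 0 s / s := by
  have hs' : 0 < s + 1 := by positivity
  rw [gapSum_div hs, gapSum_div hs', ← (summable_shiftRecip_mul_inv_pow hs'.le 0).tsum_sub
      (summable_shiftRecip_mul_inv_pow hs.le 0), gapSumPsum, gapSumPsum,
    tsum_sub_tsum_of_telescoping (h := fun m => shiftRecip s m * recipPsum 1 s m)
      (summable_gapSumPsum hs.le) (summable_gapSumPsum hs'.le)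
      ((summable_shiftRecip_mul_inv_pow hs'.le 0).sub (summable_shiftRecip_mul_inv_pow hs.le 0))
      (tendsto_shiftRecip_mul hs.le (j := 1) (by norm_num) (recipPsum_nonneg hs.le 1)
        fun m => by simpa using recipPsum_le hs.le le_rfl m)]
  · simp [recipPsum]
  · intro m
    rw [recipPsum_shift, recipPsum_succ]
    unfold recipGap shiftRecip
    generalize recipPsum 1 s m = H
    push_cast
    field_simp
    ring

lemma gapSumEsum_sub {s : ℝ} (hs : 0 < s) :
    gapSumEsum s - gapSumEsum (s + 1) = gapSumPsum (s + 1) / (s + 1) - gapSumPsum s / s := by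
  have hs' : 0 < s + 1 := by positivity
  rw [gapSumPsum_div hs, gapSumPsum_div hs',
    ← (summable_shiftRecip_mul_inv_mul_recipPsum hs').tsum_sub
      (summable_shiftRecip_mul_inv_mul_recipPsum hs), gapSumEsum, gapSumEsum,
    tsum_sub_tsum_of_telescoping (h := fun m => shiftRecip s m * recipEsum s m)
      (summable_gapSumEsum hs.le) (summable_gapSumEsum hs'.le)
      ((summable_shiftRecip_mul_inv_mul_recipPsum hs').sub
        (summable_shiftRecip_mul_inv_mul_recipPsum hs))
      (tendsto_shiftRecip_mul hs.le (j := 2) (by norm_num) (recipEsum_nonneg hs.le)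
        (recipEsum_le hs.le))]
  · simp [recipEsum]
  · intro m
    rw [recipEsum_shift, recipPsum_shift, recipPsum_succ, recipEsum_succ]
    unfold recipGap shiftRecip
    generalize recipPsum 1 s m = H
    generalize recipEsum s m = K
    push_cast
    field_simp
    ring

/-- The series `∑ 1 / ((m + 1) (m + 1 + s) ^ 2)`. -/
noncomputable def mixedSum (s : ℝ) : ℝ := ∑' m : ℕ, shiftRecip s m ^ 2 * ((m : ℝ) + 1)⁻¹

lemma shiftRecip_sq_mul_inv_le {s : ℝ} (hs : 0 ≤ s) (m : ℕ) :
    shiftRecip s m ^ 2 * ((m : ℝ) + 1)⁻¹ ≤ majorant m := by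
  refine (mul_le_of_le_one_right (sq_nonneg _) ?_).trans (shiftRecip_pow_le_majorant hs le_rfl m)
  simpa using inv_succ_pow_le_one m 1

lemma summable_mixedSum {s : ℝ} (hs : 0 ≤ s) :
    Summable fun m : ℕ => shiftRecip s m ^ 2 * ((m : ℝ) + 1)⁻¹ :=
  summable_of_le_majorant 1 (fun m => by positivity)
    fun m => by simpa using shiftRecip_sq_mul_inv_le hs m

lemma gapSumDeriv_sub {s : ℝ} (hs : 0 ≤ s) :
    gapSumDeriv s - gapSumDeriv (s + 1) = mixedSum s - mixedSum (s + 1) := by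
  have hs' : 0 < s + 1 := by positivity
  rw [mixedSum, mixedSum, ← (summable_mixedSum hs).tsum_sub (summable_mixedSum hs'.le),
    gapSumDeriv, gapSumDeriv,
    tsum_sub_tsum_of_telescoping
      (h := fun m => -(shiftRecip s m * (shiftRecip s m * recipPsum 1 s m))
        - shiftRecip s m * recipPsum 2 s m)
      (summable_gapSumDeriv hs) (summable_gapSumDeriv hs'.le)
      ((summable_mixedSum hs).sub (summable_mixedSum hs'.le))]
  · simp [recipPsum]
  · have h1 := tendsto_shiftRecip_mul hs (j := 1) (by norm_num)
      (g := fun m => shiftRecip s m * recipPsum 1 s m)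
      (fun m => mul_nonneg (shiftRecip_pos hs m).le (recipPsum_nonneg hs 1 m))
      (fun m => by
        simpa using (mul_le_of_le_one_left (recipPsum_nonneg hs 1 m)
          (shiftRecip_le_one hs m)).trans (recipPsum_le hs le_rfl m))
    have h2 := tendsto_shiftRecip_mul hs (j := 1) (by norm_num) (recipPsum_nonneg hs 2)
      (fun m => by simpa using recipPsum_le hs one_le_two m)
    simpa using h1.neg.sub h2
  · intro m
    rw [recipPsum_shift, recipPsum_shift, recipPsum_succ, recipPsum_succ]
    unfold recipGap shiftRecip
    generalize recipPsum 1 s m = H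
    generalize recipPsum 2 s m = K
    push_cast
    field_simp
    ring

/-- Nonnegative functions on `[0, ∞)` that decrease, but not faster than `(1 + s) ^ (-a)`. -/
def PowerDecay (a : ℕ) (g : ℝ → ℝ) : Prop :=
  ∀ s t, 0 ≤ s → s ≤ t → 0 ≤ g t ∧ g t ≤ g s ∧ (1 + s) ^ a * g s ≤ (1 + t) ^ a * g t

namespace PowerDecay

variable {a b : ℕ} {f g : ℝ → ℝ}

lemma nonneg (hg : PowerDecay a g) {s : ℝ} (hs : 0 ≤ s) : 0 ≤ g s := (hg s s hs le_rfl).1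

lemma add (hf : PowerDecay a f) (hg : PowerDecay a g) : PowerDecay a fun s => f s + g s := by
  intro s t hs hst
  obtain ⟨h1, h2, h3⟩ := hf s t hs hst
  obtain ⟨k1, k2, k3⟩ := hg s t hs hst
  exact ⟨by positivity, by linarith, by linarith⟩

lemma mul (hf : PowerDecay a f) (hg : PowerDecay b g) :
    PowerDecay (a + b) fun s => f s * g s := by
  intro s t hs hst
  obtain ⟨h1, h2, h3⟩ := hf s t hs hst
  obtain ⟨k1, k2, k3⟩ := hg s t hs hst
  have h4 := hf.nonneg hs
  have k4 := hg.nonneg hs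
  refine ⟨by positivity, mul_le_mul h2 k2 k1 h4, ?_⟩
  have ht : 0 ≤ t := hs.trans hst
  calc (1 + s) ^ (a + b) * (f s * g s) = (1 + s) ^ a * f s * ((1 + s) ^ b * g s) := by ring
    _ ≤ (1 + t) ^ a * f t * ((1 + t) ^ b * g t) := by gcongr
    _ = (1 + t) ^ (a + b) * (f t * g t) := by ring

lemma const {c : ℝ} (hc : 0 ≤ c) : PowerDecay 0 fun _ => c :=
  fun _ _ _ _ => ⟨hc, le_rfl, by simp⟩

lemma mono (hab : a ≤ b) (hg : PowerDecay a g) : PowerDecay b g := by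
  intro s t hs hst
  obtain ⟨k1, k2, k3⟩ := hg s t hs hst
  have k4 := hg.nonneg hs
  have ht : 0 ≤ t := hs.trans hst
  obtain ⟨c, rfl⟩ := Nat.exists_eq_add_of_le hab
  refine ⟨k1, k2, ?_⟩
  calc (1 + s) ^ (a + c) * g s = (1 + s) ^ c * ((1 + s) ^ a * g s) := by ring
    _ ≤ (1 + t) ^ c * ((1 + t) ^ a * g t) := by gcongr
    _ = (1 + t) ^ (a + c) * g t := by ring

lemma pow (hg : PowerDecay a g) (j : ℕ) : PowerDecay (a * j) fun s => g s ^ j := by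
  induction j with
  | zero => simpa using const zero_le_one
  | succ j ih => simpa [pow_succ, Nat.mul_succ] using ih.mul hg

lemma sum {g : ℕ → ℝ → ℝ} (hg : ∀ k, PowerDecay a (g k)) (m : ℕ) :
    PowerDecay a fun s => ∑ k ∈ range m, g k s := by
  induction m with
  | zero => simpa using (const le_rfl).mono (Nat.zero_le a)
  | succ m ih => simpa [sum_range_succ] using ih.add (hg m)

end PowerDecay

lemma powerDecay_shiftRecip (k : ℕ) : PowerDecay 1 fun s => shiftRecip s k := by
  intro s t hs hst
  have ht : 0 ≤ t := hs.trans hst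
  refine ⟨(shiftRecip_pos ht k).le, inv_anti₀ (by positivity) (by linarith), ?_⟩
  simp only [pow_one, shiftRecip, ← div_eq_mul_inv]
  rw [div_le_div_iff₀ (by positivity) (by positivity)]
  nlinarith [mul_le_mul_of_nonneg_right hst (k.cast_nonneg (α := ℝ))]

lemma powerDecay_recipPsum (j m : ℕ) : PowerDecay j fun s => recipPsum j s m :=
  .sum (fun k => by simpa using (powerDecay_shiftRecip k).pow j) m

lemma powerDecay_recipEsum (m : ℕ) : PowerDecay 2 fun s => recipEsum s m :=
  .sum (fun k => (powerDecay_shiftRecip k).mul (powerDecay_recipPsum 1 k)) m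

lemma powerDecay_symWeight (m : ℕ) : PowerDecay 3 fun s => symWeight s m :=
  .add (((powerDecay_recipPsum 1 m).pow 3).mul (.const (by norm_num)))
    ((powerDecay_recipPsum 3 m).mul (.const (by norm_num)))

lemma recipGap_mono {s t : ℝ} (hs : 0 ≤ s) (hst : s ≤ t) (m : ℕ) :
    recipGap s m ≤ recipGap t m :=
  sub_le_sub_left (powerDecay_shiftRecip m s t hs hst).2.1 _

lemma mul_recipGap_le {s t : ℝ} (hs : 0 ≤ s) (hst : s ≤ t) (m : ℕ) :
    s * recipGap t m ≤ t * recipGap s m := by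
  have ht : 0 ≤ t := hs.trans hst
  have h := (powerDecay_shiftRecip m s t hs hst).2.1
  rw [recipGap_eq hs, recipGap_eq ht]
  calc s * (t * (shiftRecip t m * ((m : ℝ) + 1)⁻¹))
      = s * t * ((m : ℝ) + 1)⁻¹ * shiftRecip t m := by ring
    _ ≤ s * t * ((m : ℝ) + 1)⁻¹ * shiftRecip s m := by gcongr
    _ = t * (s * (shiftRecip s m * ((m : ℝ) + 1)⁻¹)) := by ring

/-- Slow variation: `F s / s` decreases and `(1 + s) ^ 3 * F s` increases on `(0, ∞)`. -/
def SlowlyVarying (F : ℝ → ℝ) : Prop :=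
  ∀ s t, 0 < s → s ≤ t → s * F t ≤ t * F s ∧ (1 + s) ^ 3 * F s ≤ (1 + t) ^ 3 * F t

lemma slowlyVarying_tsum {c : ℝ} (hc : 0 < c) {g : ℝ → ℕ → ℝ}
    (hg : ∀ m, PowerDecay 3 fun s => g s m)
    (hsum : ∀ s, 0 ≤ s → Summable fun m => recipGap (c * s) m * g s m) :
    SlowlyVarying fun s => ∑' m, recipGap (c * s) m * g s m := by
  intro s t hs hst
  have ht : 0 < t := hs.trans_le hst
  have hct : c * s ≤ c * t := by gcongr
  simp only [← tsum_mul_left]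
  constructor
  · refine Summable.tsum_le_tsum (fun m => ?_) ((hsum t ht.le).mul_left s)
      ((hsum s hs.le).mul_left t)
    have h1 := mul_recipGap_le (by positivity : 0 ≤ c * s) hct m
    have h2 : s * recipGap (c * t) m ≤ t * recipGap (c * s) m := by
      rw [mul_assoc, mul_assoc] at h1
      exact le_of_mul_le_mul_left h1 hc
    have h3 := recipGap_nonneg (by positivity : 0 ≤ c * s) m
    obtain ⟨k1, k2, -⟩ := hg m s t hs.le hst
    calc s * (recipGap (c * t) m * g t m) = s * recipGap (c * t) m * g t m := by ring
      _ ≤ t * recipGap (c * s) m * g s m := by gcongr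
      _ = t * (recipGap (c * s) m * g s m) := by ring
  · refine Summable.tsum_le_tsum (fun m => ?_) ((hsum s hs.le).mul_left _)
      ((hsum t ht.le).mul_left _)
    have h1 := recipGap_mono (by positivity : 0 ≤ c * s) hct m
    have h3 := recipGap_nonneg (by positivity : 0 ≤ c * s) m
    have k4 := (hg m).nonneg hs.le
    obtain ⟨k1, -, k3⟩ := hg m s t hs.le hst
    calc (1 + s) ^ 3 * (recipGap (c * s) m * g s m)
        = recipGap (c * s) m * ((1 + s) ^ 3 * g s m) := by ring
      _ ≤ recipGap (c * t) m * ((1 + t) ^ 3 * g t m) := by gcongr; exact h3.trans h1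
      _ = (1 + t) ^ 3 * (recipGap (c * t) m * g t m) := by ring

lemma sub_natCast_eq_of_recurrence {F G : ℝ → ℝ}
    (hrec : ∀ s, 0 < s → F s - F (s + 1) = G s - G (s + 1)) {s : ℝ} (hs : 0 < s) (n : ℕ) :
    F (s + n) - G (s + n) = F s - G s := by
  induction n with
  | zero => simp
  | succ n ih =>
    have h := hrec (s + n) (by positivity)
    rw [show s + ((n + 1 : ℕ) : ℝ) = s + n + 1 by push_cast; ring]
    linarith

/-- A slowly varying function is determined up to a constant by its differences. -/
lemma SlowlyVarying.sub_eq_sub {F G : ℝ → ℝ} {γ : ℝ} (hF : SlowlyVarying F)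
    (hrec : ∀ s, 0 < s → F s - F (s + 1) = G s - G (s + 1)) (hG : Tendsto G atTop (𝓝 γ))
    {s t : ℝ} (hs : 0 < s) (hst : s ≤ t) : F s - G s = F t - G t := by
  have ht : 0 < t := hs.trans_le hst
  have hlim : ∀ r : ℝ, 0 < r →
      Tendsto (fun n : ℕ => F (r + n)) atTop (𝓝 (γ + (F r - G r))) := by
    intro r hr
    have h1 : Tendsto (fun n : ℕ => G (r + n) + (F r - G r)) atTop (𝓝 (γ + (F r - G r))) :=
      (hG.comp (tendsto_atTop_add_const_left _ r tendsto_natCast_atTop_atTop)).add_const _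
    refine h1.congr fun n => ?_
    have := sub_natCast_eq_of_recurrence hrec hr n
    linarith
  have hratio : ∀ r : ℝ, 0 < r →
      Tendsto (fun n : ℕ => 1 + (t - s) / (r + n)) atTop (𝓝 1) := by
    intro r hr
    have h1 : Tendsto (fun n : ℕ => (t - s) / (r + n)) atTop (𝓝 0) :=
      (tendsto_atTop_add_const_left _ r tendsto_natCast_atTop_atTop).const_div_atTop _
    simpa using h1.const_add 1
  have hle : γ + (F t - G t) ≤ 1 * (γ + (F s - G s)) := by
    refine le_of_tendsto_of_tendsto' (hlim t ht) ((hratio s hs).mul (hlim s hs)) fun n => ?_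
    have h1 := (hF (s + n) (t + n) (by positivity) (by linarith)).1
    have h2 : 0 < s + n := by positivity
    have h3 : 1 + (t - s) / (s + n) = (t + n) / (s + n) := by field_simp; ring
    rw [h3, div_mul_eq_mul_div, le_div_iff₀ h2]
    linarith
  have hge : γ + (F s - G s) ≤ 1 ^ 3 * (γ + (F t - G t)) := by
    refine le_of_tendsto_of_tendsto' (hlim s hs)
      (((hratio (1 + s) (by positivity)).pow 3).mul (hlim t ht)) fun n => ?_
    have h1 := (hF (s + n) (t + n) (by positivity) (by linarith)).2
    have h2 : 0 < (1 + (s + n)) ^ 3 := by positivity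
    have h3 : 1 + (t - s) / (1 + s + n) = (1 + (t + n)) / (1 + (s + n)) := by
      field_simp; ring
    rw [h3, div_pow, div_mul_eq_mul_div, le_div_iff₀ h2]
    linarith
  linarith

/-- A slowly varying function vanishing linearly at the origin is determined by its
differences. -/
lemma SlowlyVarying.eq_of_le_mul {F G : ℝ → ℝ} {γ C : ℝ} (hF : SlowlyVarying F)
    (hrec : ∀ s, 0 < s → F s - F (s + 1) = G s - G (s + 1)) (hG : Tendsto G atTop (𝓝 γ))
    (hF0 : ∀ s, 0 < s → |F s| ≤ s * C) (hG0 : ∀ s, 0 < s → |G s| ≤ s * C)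
    {s : ℝ} (hs : 0 < s) : F s = G s := by
  have h1 : ∀ n : ℕ, |F s - G s| ≤ 2 * C * s * (1 / ((n : ℝ) + 1)) := by
    intro n
    have hp : 0 < s * (1 / ((n : ℝ) + 1)) := by positivity
    have hle : s * (1 / ((n : ℝ) + 1)) ≤ s := by
      refine mul_le_of_le_one_right hs.le ?_
      rw [div_le_one (by positivity)]
      linarith [n.cast_nonneg (α := ℝ)]
    rw [← hF.sub_eq_sub hrec hG hp hle]
    refine (abs_sub _ _).trans ?_
    linarith [hF0 _ hp, hG0 _ hp]
  have h2 := ge_of_tendsto' (tendsto_one_div_add_atTop_nhds_zero_nat.const_mul (2 * C * s)) h1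
  rw [mul_zero] at h2
  exact sub_eq_zero.1 (abs_eq_zero.1 (le_antisymm h2 (abs_nonneg _)))

lemma tendsto_shiftRecip (m : ℕ) : Tendsto (fun s => shiftRecip s m) atTop (𝓝 0) :=
  tendsto_inv_atTop_zero.comp (tendsto_atTop_add_const_left _ _ tendsto_id)

lemma tendsto_recipGap (m : ℕ) :
    Tendsto (fun s => recipGap s m) atTop (𝓝 ((m : ℝ) + 1)⁻¹) := by
  simpa [recipGap] using (tendsto_shiftRecip m).const_sub ((m : ℝ) + 1)⁻¹

lemma tendsto_recipPsum {j : ℕ} (hj : j ≠ 0) (m : ℕ) :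
    Tendsto (fun s => recipPsum j s m) atTop (𝓝 0) := by
  have := tendsto_finsetSum (range m) fun k _ => (tendsto_shiftRecip k).pow j
  simpa [hj, recipPsum] using this

lemma tendsto_gapSum (j : ℕ) :
    Tendsto (gapSum (j + 1)) atTop
      (𝓝 (∑' m : ℕ, ((m : ℝ) + 1)⁻¹ * ((m : ℝ) + 1)⁻¹ ^ (j + 1))) := by
  refine tendsto_tsum_of_dominated_convergence summable_majorant
    (fun m => (tendsto_recipGap m).mul_const _) ?_
  filter_upwards [eventually_ge_atTop 0] with s hs m
  have h := recipGap_nonneg hs m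
  rw [Real.norm_of_nonneg (by positivity)]
  calc recipGap s m * ((m : ℝ) + 1)⁻¹ ^ (j + 1)
      ≤ ((m : ℝ) + 1)⁻¹ * ((m : ℝ) + 1)⁻¹ ^ (j + 1) := by
        gcongr
        exact sub_le_self _ (shiftRecip_pos hs m).le
    _ = (((m : ℝ) + 1) ^ 2)⁻¹ * ((m : ℝ) + 1)⁻¹ ^ j := by rw [← inv_pow]; ring
    _ ≤ majorant m := pow_mul_le_majorant (j := 0) (by norm_num)
        (by simpa using inv_succ_pow_le_one m j)

lemma abs_tsum_le_mul {f : ℕ → ℝ} {s : ℝ} (h0 : ∀ m, 0 ≤ f m)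
    (h : ∀ m, f m ≤ s * majorant m) : |∑' m, f m| ≤ s * ∑' m, majorant m := by
  rw [abs_of_nonneg (tsum_nonneg h0), ← tsum_mul_left]
  exact (summable_of_le_majorant s h0 h).tsum_le_tsum h (summable_majorant.mul_left s)

lemma abs_gapSum_le {s : ℝ} (hs : 0 < s) (j : ℕ) : |gapSum j s| ≤ s * ∑' m, majorant m :=
  abs_tsum_le_mul (fun m => mul_nonneg (recipGap_nonneg hs.le m) (by positivity))
    (recipGap_mul_inv_pow_le hs.le j)

/-- The sum formula in depth two. -/
lemma gapSumPsum_eq {s : ℝ} (hs : 0 < s) : gapSumPsum s = gapSum 1 s := by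
  have hF : SlowlyVarying gapSumPsum := by
    have := slowlyVarying_tsum one_pos (g := fun s m => recipPsum 1 s m)
      (fun m => (powerDecay_recipPsum 1 m).mono (by norm_num))
      (fun s hs => by simpa using summable_gapSumPsum hs)
    simp only [one_mul] at this
    exact this
  refine hF.eq_of_le_mul (C := ∑' m, majorant m) (fun s hs => ?_) (tendsto_gapSum 0)
    (fun s hs => ?_) (fun s hs => abs_gapSum_le hs 1) hs
  · rw [gapSumPsum_sub hs, gapSum_succ_sub hs]
  · exact abs_tsum_le_mul
      (fun m => mul_nonneg (recipGap_nonneg hs.le m) (recipPsum_nonneg hs.le 1 m))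
      (recipGap_mul_recipPsum_le hs.le)

/-- The sum formula in depth three. -/
lemma gapSumEsum_eq {s : ℝ} (hs : 0 < s) : gapSumEsum s = gapSum 2 s := by
  have hF : SlowlyVarying gapSumEsum := by
    have := slowlyVarying_tsum one_pos (g := fun s m => recipEsum s m)
      (fun m => (powerDecay_recipEsum m).mono (by norm_num))
      (fun s hs => by simpa using summable_gapSumEsum hs)
    simp only [one_mul] at this
    exact this
  refine hF.eq_of_le_mul (C := ∑' m, majorant m) (fun s hs => ?_) (tendsto_gapSum 1)
    (fun s hs => ?_) (fun s hs => abs_gapSum_le hs 2) hs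
  · rw [gapSumEsum_sub hs, gapSum_succ_sub hs, gapSumPsum_eq hs, gapSumPsum_eq (by positivity)]
  · exact abs_tsum_le_mul
      (fun m => mul_nonneg (recipGap_nonneg hs.le m) (recipEsum_nonneg hs.le m))
      (recipGap_mul_recipEsum_le hs.le)

lemma tendsto_gapSumDeriv : Tendsto gapSumDeriv atTop (𝓝 0) := by
  have h : Tendsto gapSumDeriv atTop (𝓝 (∑' _ : ℕ, (0 : ℝ))) := by
    refine tendsto_tsum_of_dominated_convergence (summable_majorant.mul_left 2) (fun m => ?_) ?_
    · have h1 := (tendsto_recipPsum one_ne_zero m).mul ((tendsto_shiftRecip m).pow 2)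
      have h2 := (tendsto_recipGap m).mul (tendsto_recipPsum two_ne_zero m)
      simpa using h1.sub h2
    · filter_upwards [eventually_ge_atTop 0] with s hs m
      have h1 := mul_nonneg (recipPsum_nonneg hs 1 m) (sq_nonneg (shiftRecip s m))
      have h2 := mul_nonneg (recipGap_nonneg hs m) (recipPsum_nonneg hs 2 m)
      have h3 := recipPsum_mul_sq_le hs m
      have h4 := recipGap_mul_recipPsum_two_le hs m
      rw [Real.norm_eq_abs, abs_le]
      constructor <;> linarith
  simpa using h

lemma tendsto_mixedSum : Tendsto mixedSum atTop (𝓝 0) := by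
  have h : Tendsto mixedSum atTop (𝓝 (∑' _ : ℕ, (0 : ℝ))) := by
    refine tendsto_tsum_of_dominated_convergence summable_majorant (fun m => ?_) ?_
    · simpa using ((tendsto_shiftRecip m).pow 2).mul_const ((m : ℝ) + 1)⁻¹
    · filter_upwards [eventually_ge_atTop 0] with s hs m
      rw [Real.norm_of_nonneg (by positivity)]
      exact shiftRecip_sq_mul_inv_le hs m
  simpa using h

lemma gapSumDeriv_eq {s : ℝ} (hs : 0 < s) : gapSumDeriv s = mixedSum s := by
  have h1 : Tendsto (fun n : ℕ => s + n) atTop atTop :=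
    tendsto_atTop_add_const_left _ s tendsto_natCast_atTop_atTop
  have h2 : Tendsto (fun n : ℕ => gapSumDeriv (s + n) - mixedSum (s + n)) atTop (𝓝 (0 - 0)) :=
    (tendsto_gapSumDeriv.comp h1).sub (tendsto_mixedSum.comp h1)
  have h3 : ∀ n : ℕ, gapSumDeriv (s + n) - mixedSum (s + n) = gapSumDeriv s - mixedSum s :=
    sub_natCast_eq_of_recurrence (F := gapSumDeriv) (G := mixedSum)
      (fun s hs => gapSumDeriv_sub hs.le) hs
  simp only [h3] at h2
  linarith [tendsto_nhds_unique h2 tendsto_const_nhds]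

lemma hurwitzSum_shift {s : ℝ} (hs : 0 ≤ s) {j : ℕ} (hj : 2 ≤ j) :
    hurwitzSum j (s + 1) = hurwitzSum j s - shiftRecip s 0 ^ j := by
  unfold hurwitzSum
  rw [(summable_shiftRecip_pow hs hj).tsum_eq_zero_add]
  simp [shiftRecip_shift]

lemma gapSum_zero_shift {s : ℝ} (hs : 0 ≤ s) :
    gapSum 0 (s + 1) = gapSum 0 s + shiftRecip s 0 := by
  have ht : Tendsto (fun m => shiftRecip s m) atTop (𝓝 0) := by
    have h1 := tendsto_shiftRecip_mul hs (j := 0) (by norm_num) (g := fun _ => 1)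
      (by simp) (by simp)
    simpa using h1
  have h := tsum_sub_tsum_of_telescoping (g := fun _ => 0) (h := fun m => shiftRecip s m)
    (summable_gapSum hs 0) (summable_gapSum (by positivity : 0 ≤ s + 1) 0) summable_zero ht
    (fun m => by unfold recipGap; rw [shiftRecip_shift]; ring)
  rw [gapSum, gapSum]
  simp only [tsum_zero] at h
  linarith

lemma summable_inv_pow {j : ℕ} (hj : 2 ≤ j) : Summable fun m : ℕ => ((m : ℝ) + 1)⁻¹ ^ j :=
  (summable_shiftRecip_pow le_rfl hj).congr fun m => by simp [shiftRecip]

lemma hurwitzSum_zero_eq (j : ℕ) : hurwitzSum j 0 = ∑' m : ℕ, ((m : ℝ) + 1)⁻¹ ^ j := by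
  simp [hurwitzSum, shiftRecip]

lemma gapSum_succ_eq {s : ℝ} (hs : 0 < s) (j : ℕ) :
    gapSum (j + 1) s = hurwitzSum (j + 2) 0 - gapSum j s / s := by
  rw [gapSum_div hs, hurwitzSum_zero_eq, gapSum,
    ← (summable_inv_pow (by omega)).tsum_sub (summable_shiftRecip_mul_inv_pow hs.le j)]
  refine tsum_congr fun m => ?_
  unfold recipGap
  ring

lemma shiftRecip_pow_mul_inv_eq {s : ℝ} (hs : 0 < s) (j m : ℕ) :
    shiftRecip s m ^ (j + 1) * ((m : ℝ) + 1)⁻¹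
      = (shiftRecip s m ^ j * ((m : ℝ) + 1)⁻¹ - shiftRecip s m ^ (j + 1)) / s := by
  unfold shiftRecip
  rw [pow_succ]
  generalize ((m : ℝ) + 1 + s)⁻¹ ^ j = c
  field_simp
  ring

/-- The closed form of `weightedSum`, up to an additive constant. -/
noncomputable def weightedSumForm (s : ℝ) : ℝ :=
  -hurwitzSum 4 s / 8 + hurwitzSum 3 s / (4 * s) - hurwitzSum 2 s / (4 * s ^ 2)
    - gapSum 0 s / (4 * s ^ 3) + hurwitzSum 2 0 / (2 * s ^ 2) - hurwitzSum 3 0 / s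

/-- The non-telescoping part of the difference of consecutive terms of `weightedSum`. -/
noncomputable def differenceTerm (s : ℝ) (m : ℕ) : ℝ :=
  -((shiftRecip s 0 - s⁻¹) / 2) *
      (-(2 * (recipGap s m * recipEsum s m)) +
        (recipPsum 1 s m * shiftRecip s m ^ 2 - recipGap s m * recipPsum 2 s m))
    - (shiftRecip s 0 - s⁻¹) ^ 2 / 2 * (recipGap s m * recipPsum 1 s m)
    - 1 / 4 * (shiftRecip s 0 * shiftRecip s m ^ 3 - shiftRecip s 0 ^ 2 * shiftRecip s m ^ 2
        - shiftRecip s 0 ^ 3 * (recipGap s m * ((m : ℝ) + 1)⁻¹ ^ 0)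
        + (shiftRecip s m ^ 3 * ((m : ℝ) + 1)⁻¹
          - 2 * shiftRecip s 0 * (shiftRecip s m ^ 2 * ((m : ℝ) + 1)⁻¹)
          + 2 * shiftRecip s 0 ^ 2 * (shiftRecip s m ^ 1 * ((m : ℝ) + 1)⁻¹)))

/-- The telescoping part of the difference of consecutive terms of `weightedSum`. -/
noncomputable def differencePrimitive (s : ℝ) (m : ℕ) : ℝ :=
  (shiftRecip (2 * s) m + shiftRecip (2 * s) (m + 1)) * symWeight s m
    - shiftRecip s 0 / 2 * (shiftRecip (2 * s) (m + 1) * recipPsum 1 s m ^ 2)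
    + shiftRecip s 0 ^ 2 / 2 * (shiftRecip (2 * s) (m + 1) * recipPsum 1 s m)
    - shiftRecip s 0 ^ 3 / 4 * shiftRecip (2 * s) (m + 1)

lemma hasSum_differenceTerm {s : ℝ} (hs : 0 < s) :
    HasSum (differenceTerm s)
      (-((shiftRecip s 0 - s⁻¹) / 2) * (-(2 * gapSum 2 s) + mixedSum s)
        - (shiftRecip s 0 - s⁻¹) ^ 2 / 2 * gapSum 1 s
        - 1 / 4 * (shiftRecip s 0 * hurwitzSum 3 s - shiftRecip s 0 ^ 2 * hurwitzSum 2 s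
          - shiftRecip s 0 ^ 3 * gapSum 0 s
          + ((mixedSum s - hurwitzSum 3 s) / s - 2 * shiftRecip s 0 * mixedSum s
            + 2 * shiftRecip s 0 ^ 2 * (gapSum 0 s / s)))) := by
  have hE2 : HasSum (fun m => recipGap s m * recipEsum s m) (gapSum 2 s) := by
    rw [← gapSumEsum_eq hs]; exact (summable_gapSumEsum hs.le).hasSum
  have hE1 : HasSum (fun m => recipGap s m * recipPsum 1 s m) (gapSum 1 s) := by
    rw [← gapSumPsum_eq hs]; exact (summable_gapSumPsum hs.le).hasSum
  have hW : HasSum (fun m => recipPsum 1 s m * shiftRecip s m ^ 2 - recipGap s m * recipPsum 2 s m)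
      (mixedSum s) := by
    rw [← gapSumDeriv_eq hs]; exact (summable_gapSumDeriv hs.le).hasSum
  have hY3 : HasSum (fun m => shiftRecip s m ^ 3) (hurwitzSum 3 s) :=
    (summable_shiftRecip_pow hs.le (by norm_num)).hasSum
  have hY2 : HasSum (fun m => shiftRecip s m ^ 2) (hurwitzSum 2 s) :=
    (summable_shiftRecip_pow hs.le (by norm_num)).hasSum
  have hG : HasSum (fun m : ℕ => recipGap s m * ((m : ℝ) + 1)⁻¹ ^ 0) (gapSum 0 s) :=
    (summable_gapSum hs.le 0).hasSum
  have hT : HasSum (fun m : ℕ => shiftRecip s m ^ 2 * ((m : ℝ) + 1)⁻¹) (mixedSum s) :=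
    (summable_mixedSum hs.le).hasSum
  have hT3 : HasSum (fun m : ℕ => shiftRecip s m ^ 3 * ((m : ℝ) + 1)⁻¹)
      ((mixedSum s - hurwitzSum 3 s) / s) :=
    ((hT.sub hY3).div_const s).congr_fun fun m => shiftRecip_pow_mul_inv_eq hs 2 m
  have hT1 : HasSum (fun m : ℕ => shiftRecip s m ^ 1 * ((m : ℝ) + 1)⁻¹) (gapSum 0 s / s) := by
    rw [gapSum_div hs]
    simpa using (summable_shiftRecip_mul_inv_pow hs.le 0).hasSum
  exact ((((hE2.mul_left 2).neg.add hW).mul_left _).sub (hE1.mul_left _)).sub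
    (((((hY3.mul_left _).sub (hY2.mul_left _)).sub (hG.mul_left _)).add
      ((hT3.sub (hT.mul_left _)).add (hT1.mul_left _))).mul_left _)

lemma tendsto_differencePrimitive {s : ℝ} (hs : 0 ≤ s) :
    Tendsto (differencePrimitive s) atTop (𝓝 0) := by
  have key : ∀ (j : ℕ), j ≤ 3 → ∀ g : ℕ → ℝ, (∀ m, 0 ≤ g m) →
      (∀ m, g m ≤ harmonicBound m ^ j) →
      Tendsto (fun m => shiftRecip (2 * s) m * g m) atTop (𝓝 0) ∧
      Tendsto (fun m => shiftRecip (2 * s) (m + 1) * g m) atTop (𝓝 0) := by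
    intro j hj g h0 h1
    have h2 := tendsto_shiftRecip_mul (by positivity : 0 ≤ 2 * s) hj h0 h1
    refine ⟨h2, squeeze_zero (fun m => ?_) (fun m => ?_) h2⟩
    · exact mul_nonneg (shiftRecip_pos (by positivity) _).le (h0 m)
    · refine mul_le_mul_of_nonneg_right (inv_anti₀ (by positivity) ?_) (h0 m)
      push_cast
      linarith
  obtain ⟨h1, h2⟩ := key 3 le_rfl _ (symWeight_nonneg hs) (symWeight_le hs)
  obtain ⟨-, h3⟩ := key 2 (by norm_num) (fun m => recipPsum 1 s m ^ 2) (fun m => by positivity)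
    (fun m => pow_le_pow_left₀ (recipPsum_nonneg hs 1 m) (recipPsum_le hs le_rfl m) 2)
  obtain ⟨-, h4⟩ := key 1 (by norm_num) (recipPsum 1 s) (recipPsum_nonneg hs 1)
    (fun m => by simpa using recipPsum_le hs le_rfl m)
  obtain ⟨-, h5⟩ := key 0 (by norm_num) (fun _ => 1) (by simp) (by simp)
  have h := ((((h1.add h2).sub (h3.const_mul (shiftRecip s 0 / 2))).add
    (h4.const_mul (shiftRecip s 0 ^ 2 / 2))).sub (h5.const_mul (shiftRecip s 0 ^ 3 / 4)))
  simp only [add_zero, mul_zero, sub_zero] at h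
  refine h.congr fun m => ?_
  unfold differencePrimitive
  ring

lemma weightedSum_term_sub {s : ℝ} (hs : 0 < s) (m : ℕ) :
    recipGap (2 * s) m * symWeight s m - recipGap (2 * (s + 1)) m * symWeight (s + 1) m
      = differencePrimitive s (m + 1) - differencePrimitive s m + differenceTerm s m := by
  have hp : recipPsum 2 s m = recipPsum 1 s m ^ 2 - 2 * recipEsum s m := by
    rw [← two_mul_recipEsum]; ring
  unfold differencePrimitive differenceTerm symWeight
  rw [recipPsum_shift, recipPsum_shift, recipPsum_succ, recipPsum_succ, hp]
  unfold recipGap shiftRecip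
  generalize recipPsum 1 s m = H
  generalize recipPsum 3 s m = K
  generalize recipEsum s m = e
  push_cast
  field_simp
  ring

lemma weightedSum_sub {s : ℝ} (hs : 0 < s) :
    weightedSum s - weightedSum (s + 1) = weightedSumForm s - weightedSumForm (s + 1) := by
  have hs' : 0 < s + 1 := by positivity
  have h2 : gapSum 2 s = hurwitzSum 3 0 - gapSum 1 s / s := gapSum_succ_eq hs 1
  have h1 : gapSum 1 s = hurwitzSum 2 0 - gapSum 0 s / s := gapSum_succ_eq hs 0
  have hT : mixedSum s = (gapSum 0 s / s - hurwitzSum 2 s) / s := by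
    have hG : HasSum (fun m : ℕ => shiftRecip s m ^ 1 * ((m : ℝ) + 1)⁻¹) (gapSum 0 s / s) := by
      rw [gapSum_div hs]
      simpa using (summable_shiftRecip_mul_inv_pow hs.le 0).hasSum
    have hY2 : HasSum (fun m => shiftRecip s m ^ 2) (hurwitzSum 2 s) :=
      (summable_shiftRecip_pow hs.le (by norm_num)).hasSum
    exact (((hG.sub hY2).div_const s).congr_fun fun m =>
      shiftRecip_pow_mul_inv_eq hs 1 m).tsum_eq
  have hd := hasSum_differenceTerm hs
  rw [weightedSum, weightedSum, tsum_sub_tsum_of_telescoping (summable_weightedSum hs.le)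
    (summable_weightedSum hs'.le) hd.summable (tendsto_differencePrimitive hs.le)
    (weightedSum_term_sub hs), hd.tsum_eq]
  unfold weightedSumForm
  rw [hurwitzSum_shift hs.le (by norm_num), hurwitzSum_shift hs.le (by norm_num),
    hurwitzSum_shift hs.le (by norm_num), gapSum_zero_shift hs.le, hT, h2, h1]
  have h0 : differencePrimitive s 0 = -(shiftRecip s 0 ^ 4 / 8) := by
    simp only [differencePrimitive, symWeight, recipPsum, shiftRecip, range_zero, sum_empty]
    push_cast
    field_simp
    ring
  rw [h0]
  unfold shiftRecip
  generalize hurwitzSum 4 s = a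
  generalize hurwitzSum 3 s = b
  generalize hurwitzSum 2 s = c
  generalize gapSum 0 s = d
  generalize hurwitzSum 2 0 = e
  generalize hurwitzSum 3 0 = f
  push_cast
  field_simp
  ring

lemma tendsto_weightedSumForm : Tendsto weightedSumForm atTop (𝓝 0) := by
  have hY : ∀ j, 2 ≤ j → Tendsto (hurwitzSum j) atTop (𝓝 0) := by
    intro j hj
    have h : Tendsto (hurwitzSum j) atTop (𝓝 (∑' _ : ℕ, (0 : ℝ))) := by
      refine tendsto_tsum_of_dominated_convergence summable_majorant (fun m => ?_) ?_
      · have h := (tendsto_shiftRecip m).pow j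
        rwa [zero_pow (by omega)] at h
      · filter_upwards [eventually_ge_atTop 0] with s hs m
        rw [Real.norm_of_nonneg (pow_nonneg (shiftRecip_pos hs m).le j)]
        exact shiftRecip_pow_le_majorant hs hj m
    simpa using h
  have hi : Tendsto (fun s : ℝ => s⁻¹) atTop (𝓝 0) := tendsto_inv_atTop_zero
  have hG : Tendsto (fun s : ℝ => gapSum 0 s * s⁻¹ ^ 3) atTop (𝓝 0) := by
    have h := (hi.pow 2).const_mul (∑' m, majorant m)
    simp only [ne_eq, OfNat.ofNat_ne_zero, not_false_eq_true, zero_pow, mul_zero] at h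
    refine squeeze_zero_norm' ?_ h
    filter_upwards [eventually_gt_atTop 0] with s hs
    rw [norm_mul, Real.norm_eq_abs, Real.norm_of_nonneg (by positivity : 0 ≤ s⁻¹ ^ 3)]
    calc |gapSum 0 s| * s⁻¹ ^ 3 ≤ s * (∑' m, majorant m) * s⁻¹ ^ 3 := by
          gcongr
          exact abs_gapSum_le hs 0
      _ = (∑' m, majorant m) * s⁻¹ ^ 2 := by field_simp
  have h := (((((hY 4 (by norm_num)).neg.div_const 8).add
    (((hY 3 (by norm_num)).mul hi).div_const 4)).sub
    (((hY 2 le_rfl).mul (hi.pow 2)).div_const 4)).sub (hG.div_const 4)).add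
    ((hi.pow 2).const_mul (hurwitzSum 2 0 / 2)) |>.sub (hi.const_mul (hurwitzSum 3 0))
  norm_num at h
  refine h.congr fun s => ?_
  unfold weightedSumForm
  rcases eq_or_ne s 0 with rfl | hs
  · simp
  · field_simp

/-- The generating function identity behind the weighted sum formula. -/
lemma exists_weightedSum_eq :
    ∃ K : ℝ, ∀ s, 0 < s → s ≤ 1 → weightedSum s = weightedSumForm s + K := by
  refine ⟨weightedSum 1 - weightedSumForm 1, fun s hs hs1 => ?_⟩
  have hF : SlowlyVarying weightedSum :=
    slowlyVarying_tsum two_pos powerDecay_symWeight fun s hs => summable_weightedSum hs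
  have := hF.sub_eq_sub (fun s hs => weightedSum_sub hs) tendsto_weightedSumForm hs hs1
  linarith

/-- The strictly decreasing `n`-tuples of positive integers. -/
abbrev DecTuple (n : ℕ) : Type := {m : Fin n → ℕ // StrictAnti m ∧ ∀ i, 0 < m i}

/-- The multiple harmonic sum: the multiple zeta value restricted to tuples bounded by `m`. -/
noncomputable def multHarmonic : (n : ℕ) → (Fin n → ℕ) → ℕ → ℝ
  | 0, _, _ => 1
  | n + 1, c, m =>
    ∑ k ∈ range m, (((k : ℝ) + 1) ^ c 0)⁻¹ * multHarmonic n (Fin.tail c) k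

lemma multHarmonic_nonneg (n : ℕ) (c : Fin n → ℕ) (m : ℕ) : 0 ≤ multHarmonic n c m := by
  induction n generalizing m with
  | zero => simp [multHarmonic]
  | succ n ih => exact sum_nonneg fun k _ => mul_nonneg (by positivity) (ih _ k)

lemma harmonicBound_mono : Monotone harmonicBound := by
  refine monotone_nat_of_le_succ fun m => ?_
  unfold harmonicBound
  rw [recipPsum_succ]
  have := shiftRecip_pos le_rfl m
  linarith [pow_nonneg this.le 1]

lemma multHarmonic_le (n : ℕ) (c : Fin n → ℕ) (hc : ∀ i, 1 ≤ c i) (m : ℕ) :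
    multHarmonic n c m ≤ harmonicBound m ^ n := by
  induction n generalizing m with
  | zero => simp [multHarmonic]
  | succ n ih =>
    have h0 := zero_le_one.trans (one_le_harmonicBound m)
    calc multHarmonic (n + 1) c m
        ≤ ∑ k ∈ range m, shiftRecip 0 k ^ 1 * harmonicBound m ^ n := by
          refine sum_le_sum fun k hk => ?_
          gcongr
          · exact multHarmonic_nonneg _ _ _
          · exact pow_nonneg (shiftRecip_pos le_rfl k).le 1
          · have h1 : (1 : ℝ) ≤ (k : ℝ) + 1 := by linarith [k.cast_nonneg (α := ℝ)]
            rw [shiftRecip, add_zero, pow_one]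
            exact inv_anti₀ (by positivity) (le_self_pow₀ h1 (by have := hc 0; omega))
          · refine (ih _ (fun i => hc i.succ) k).trans ?_
            exact pow_le_pow_left₀ (zero_le_one.trans (one_le_harmonicBound k))
              (harmonicBound_mono (mem_range.1 hk).le) n
      _ = recipPsum 1 0 m * harmonicBound m ^ n := by rw [recipPsum, sum_mul]
      _ ≤ harmonicBound m ^ (n + 1) := by
          rw [pow_succ']
          gcongr
          exact recipPsum_le le_rfl le_rfl m

/-- A decreasing tuple is given by its first entry and a bounded decreasing tuple. -/
def decTupleEquiv (n : ℕ) :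
    (Σ k : ℕ, {m : DecTuple n // ∀ i, m.1 i ≤ k}) ≃ DecTuple (n + 1) where
  toFun x := ⟨Fin.cons (x.1 + 1) x.2.1.1, by
    constructor
    · intro i j hij
      induction j using Fin.cases with
      | zero => simp at hij
      | succ j =>
        induction i using Fin.cases with
        | zero => simpa using Nat.lt_succ_of_le (x.2.2 j)
        | succ i => simpa using x.2.1.2.1 (Fin.succ_lt_succ_iff.1 hij)
    · intro i
      induction i using Fin.cases with
      | zero => simp
      | succ i => simpa using x.2.1.2.2 i⟩
  invFun m := ⟨m.1 0 - 1, ⟨⟨Fin.tail m.1, fun i j hij => m.2.1 (Fin.succ_lt_succ_iff.2 hij),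
    fun i => m.2.2 i.succ⟩, fun i => Nat.le_sub_one_of_lt (m.2.1 (Fin.succ_pos i))⟩⟩
  left_inv x := by
    obtain ⟨k, ⟨⟨m, hm⟩, hk⟩⟩ := x
    exact Sigma.subtype_ext (by simp) (Subtype.ext (by simp))
  right_inv m := by
    obtain ⟨m, hm⟩ := m
    have h := hm.2 0
    ext i
    induction i using Fin.cases with
    | zero => simp; omega
    | succ i => simp [Fin.tail]

lemma hasSum_decTuple_succ {n : ℕ} {c : Fin n → ℕ} {g : ℕ → ℝ} (hg : ∀ k, 0 ≤ g k)
    (hs : Summable fun k => g k * multHarmonic n c k)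
    (h : ∀ N, HasSum (fun m : {m : DecTuple n // ∀ i, m.1 i ≤ N} =>
      ∏ i, ((m.1.1 i : ℝ) ^ c i)⁻¹) (multHarmonic n c N)) :
    HasSum (fun m : DecTuple (n + 1) =>
      g (m.1 0 - 1) * ∏ i : Fin n, ((m.1 i.succ : ℝ) ^ c i)⁻¹)
      (∑' k, g k * multHarmonic n c k) := by
  rw [← (decTupleEquiv n).hasSum_iff]
  have h1 : ∀ k, HasSum (fun m : {m : DecTuple n // ∀ i, m.1 i ≤ k} =>
      g k * ∏ i, ((m.1.1 i : ℝ) ^ c i)⁻¹) (g k * multHarmonic n c k) :=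
    fun k => (h k).mul_left _
  have h2 : ((fun m : DecTuple (n + 1) =>
      g (m.1 0 - 1) * ∏ i : Fin n, ((m.1 i.succ : ℝ) ^ c i)⁻¹) ∘ decTupleEquiv n)
      = fun x => g x.1 * ∏ i, ((x.2.1.1 i : ℝ) ^ c i)⁻¹ := by
    ext x
    simp [decTupleEquiv]
  rw [h2]
  refine HasSum.sigma_of_hasSum hs.hasSum h1 ?_
  refine (summable_sigma_of_nonneg fun x => mul_nonneg (hg _) (by positivity)).2
    ⟨fun k => (h1 k).summable, ?_⟩
  simpa only [(h1 _).tsum_eq] using hs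

lemma hasSum_multHarmonic (n : ℕ) (c : Fin n → ℕ) (N : ℕ) :
    HasSum (fun m : {m : DecTuple n // ∀ i, m.1 i ≤ N} =>
      ∏ i, ((m.1.1 i : ℝ) ^ c i)⁻¹) (multHarmonic n c N) := by
  induction n generalizing N with
  | zero =>
    have : Unique {m : DecTuple 0 // ∀ i, m.1 i ≤ N} :=
      ⟨⟨⟨⟨Fin.elim0, fun i => i.elim0, fun i => i.elim0⟩, fun i => i.elim0⟩⟩,
        fun x => Subsingleton.elim _ _⟩
    have h := hasSum_unique
      (fun m : {m : DecTuple 0 // ∀ i, m.1 i ≤ N} => ∏ i, ((m.1.1 i : ℝ) ^ c i)⁻¹)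
    rwa [univ_eq_empty, prod_empty] at h
  | succ n ih =>
    have h := hasSum_decTuple_succ (c := Fin.tail c)
      (g := fun k => if k < N then (((k : ℝ) + 1) ^ c 0)⁻¹ else 0)
      (fun k => by positivity)
      (summable_of_ne_finset_zero (s := range N) fun k hk => by simp_all)
      (fun N => ih (Fin.tail c) N)
    have h1 : ∑' k, (if k < N then (((k : ℝ) + 1) ^ c 0)⁻¹ else 0) *
        multHarmonic n (Fin.tail c) k = multHarmonic (n + 1) c N := by
      have h0 : ∀ k ∉ range N, (if k < N then (((k : ℝ) + 1) ^ c 0)⁻¹ else 0) *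
          multHarmonic n (Fin.tail c) k = 0 := fun k hk => by
        rw [if_neg (by simpa using hk), zero_mul]
      rw [tsum_eq_sum h0, multHarmonic]
      exact sum_congr rfl fun k hk => by rw [if_pos (mem_range.1 hk)]
    rw [h1] at h
    let f : DecTuple (n + 1) → ℝ := fun m => ∏ i, ((m.1 i : ℝ) ^ c i)⁻¹
    let S : Set (DecTuple (n + 1)) := {m | ∀ i, m.1 i ≤ N}
    change HasSum (f ∘ ((↑) : S → DecTuple (n + 1))) _
    rw [hasSum_subtype_iff_indicator]
    convert h using 1
    ext m
    have hm := m.2.2 0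
    have hiff : (∀ i, m.1 i ≤ N) ↔ m.1 0 - 1 < N :=
      ⟨fun h => by have := h 0; omega,
        fun h i => (m.2.1.antitone (Fin.zero_le i)).trans (by omega)⟩
    have hcast : ((m.1 0 - 1 : ℕ) : ℝ) + 1 = m.1 0 := by
      exact_mod_cast Nat.sub_add_cancel hm
    by_cases hN : m.1 0 - 1 < N
    · rw [Set.indicator_of_mem (show m ∈ S from hiff.2 hN), if_pos hN, hcast]
      exact Fin.prod_univ_succ _
    · rw [Set.indicator_of_notMem (show m ∉ S from fun h => hN (hiff.1 h)), if_neg hN, zero_mul]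

lemma summable_inv_pow_mul_multHarmonic {n a : ℕ} (hn : n ≤ 3) (ha : 2 ≤ a) {c : Fin n → ℕ}
    (hc : ∀ i, 1 ≤ c i) :
    Summable fun m : ℕ => (((m : ℝ) + 1) ^ a)⁻¹ * multHarmonic n c m := by
  refine summable_of_le_majorant 1
    (fun m => mul_nonneg (by positivity) (multHarmonic_nonneg n c m)) fun m => ?_
  have h1 : (1 : ℝ) ≤ (m : ℝ) + 1 := by linarith [m.cast_nonneg (α := ℝ)]
  rw [one_mul]
  refine le_trans ?_ (pow_mul_le_majorant hn (multHarmonic_le n c hc m))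
  gcongr
  exact multHarmonic_nonneg n c m

lemma mzv_cons {n a : ℕ} (hn : n ≤ 3) (ha : 2 ≤ a) {c : Fin n → ℕ} (hc : ∀ i, 1 ≤ c i) :
    mzv (Fin.cons a c : Fin (n + 1) → ℕ)
      = ∑' m : ℕ, (((m : ℝ) + 1) ^ a)⁻¹ * multHarmonic n c m := by
  rw [← (hasSum_decTuple_succ (g := fun m : ℕ => (((m : ℝ) + 1) ^ a)⁻¹)
    (fun k => by positivity) (summable_inv_pow_mul_multHarmonic hn ha hc)
    (hasSum_multHarmonic n c)).tsum_eq]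
  refine tsum_congr fun m => ?_
  have hcast : ((m.1 0 - 1 : ℕ) : ℝ) + 1 = m.1 0 := by
    exact_mod_cast Nat.sub_add_cancel (m.2.2 0)
  rw [Fin.prod_univ_succ, hcast]
  simp

lemma sum_antidiagonalTuple_succ (n l : ℕ) (F : (Fin (n + 1) → ℕ) → ℝ) :
    ∑ c ∈ Nat.antidiagonalTuple (n + 1) l, F c
      = ∑ p ∈ antidiagonal l, ∑ c ∈ Nat.antidiagonalTuple n p.2, F (Fin.cons p.1 c) := by
  rw [sum_sigma']
  refine sum_bij' (fun c _ => (⟨(c 0, l - c 0), Fin.tail c⟩ : Σ _ : ℕ × ℕ, (Fin n → ℕ)))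
    (fun x _ => Fin.cons x.1.1 x.2) ?_ ?_ ?_ ?_ ?_
  · intro c hc
    rw [Nat.mem_antidiagonalTuple, Fin.sum_univ_succ] at hc
    simp only [mem_sigma, HasAntidiagonal.mem_antidiagonal, Nat.mem_antidiagonalTuple, Fin.tail]
    omega
  · intro x hx
    simp only [mem_sigma, HasAntidiagonal.mem_antidiagonal, Nat.mem_antidiagonalTuple] at hx
    rw [Nat.mem_antidiagonalTuple, Fin.sum_univ_succ]
    simp [hx.2, hx.1]
  · intro c _
    simp
  · intro x hx
    obtain ⟨⟨a, b⟩, c⟩ := x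
    simp only [mem_sigma, HasAntidiagonal.mem_antidiagonal, Nat.mem_antidiagonalTuple] at hx
    simp [← hx.1]
  · intro c _
    simp

/-- The power series `x / (k + 1 - x)`. -/
noncomputable def geomSeries (k : ℕ) : PowerSeries ℝ :=
  PowerSeries.mk fun j => if 1 ≤ j then (((k : ℝ) + 1) ^ j)⁻¹ else 0

/-- The power series `x / (k + 1 - 2 * x) - x / (k + 1)`. -/
noncomputable def leadSeries (k : ℕ) : PowerSeries ℝ :=
  PowerSeries.mk fun j => if 2 ≤ j then 2 ^ (j - 1) * (((k : ℝ) + 1) ^ j)⁻¹ else 0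

/-- The elementary symmetric functions of the first `m` series `geomSeries`. -/
noncomputable def geomEsum : ℕ → ℕ → PowerSeries ℝ
  | 0, _ => 1
  | n + 1, m => ∑ k ∈ range m, geomSeries k * geomEsum n k

lemma coeff_geomEsum (n m j : ℕ) :
    PowerSeries.coeff j (geomEsum n m)
      = ∑ c ∈ (Nat.antidiagonalTuple n j).filter (fun c => ∀ i, 1 ≤ c i),
          multHarmonic n c m := by
  induction n generalizing m j with
  | zero =>
    cases j with
    | zero => simp [geomEsum, multHarmonic]
    | succ j => simp [geomEsum, PowerSeries.coeff_one]
  | succ n ih =>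
    rw [sum_filter, sum_antidiagonalTuple_succ, geomEsum, map_sum]
    simp_rw [PowerSeries.coeff_mul, ih, geomSeries, PowerSeries.coeff_mk, sum_filter]
    rw [sum_comm]
    refine sum_congr rfl fun p _ => ?_
    simp_rw [mul_sum]
    rw [sum_comm]
    refine sum_congr rfl fun c _ => ?_
    by_cases h1 : 1 ≤ p.1 <;> by_cases h2 : ∀ i, 1 ≤ c i <;>
      simp [Fin.forall_fin_succ, h1, h2, multHarmonic]

/-- The sum over all tuples of weight `l`, weighted by a function of the first entry, of multiple
zeta values. -/
lemma sum_mzv_eq {n : ℕ} (hn : n ≤ 3) (l : ℕ) (w : ℕ → ℝ) :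
    HasSum (fun m => PowerSeries.coeff l (leadSeries m *
        PowerSeries.mk fun j => w j * PowerSeries.coeff j (geomEsum n m)))
      (∑ c ∈ (Nat.antidiagonalTuple (n + 1) l).filter (fun c => 2 ≤ c 0 ∧ ∀ i, 1 ≤ c i),
        w (l - c 0) * 2 ^ (c 0 - 1) * mzv c) := by
  rw [sum_filter, sum_antidiagonalTuple_succ]
  simp_rw [PowerSeries.coeff_mul]
  refine hasSum_sum fun p hp => ?_
  have hp2 : l - p.1 = p.2 := by
    rw [← HasAntidiagonal.mem_antidiagonal.1 hp]; omega
  simp_rw [leadSeries, PowerSeries.coeff_mk, coeff_geomEsum, sum_filter, mul_sum]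
  refine hasSum_sum fun c _ => ?_
  by_cases h1 : 2 ≤ p.1
  · by_cases h2 : ∀ i, 1 ≤ c i
    · have h3 : ∀ i, 1 ≤ (Fin.cons p.1 c : Fin (n + 1) → ℕ) i := by
        rw [Fin.forall_fin_succ]
        exact ⟨by simpa using (by omega : 1 ≤ p.1), by simpa using h2⟩
      simp only [Fin.cons_zero, h1, h2, h3, hp2, if_true, and_self, implies_true]
      rw [mzv_cons hn h1 h2]
      refine Eq.subst (motive := fun f => HasSum f _) (funext fun m => ?_)
        ((summable_inv_pow_mul_multHarmonic hn h1 h2).hasSum.mul_left (w p.2 * 2 ^ (p.1 - 1)))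
      ring
    · have h3 : ¬ ∀ i, 1 ≤ (Fin.cons p.1 c : Fin (n + 1) → ℕ) i := by
        rw [Fin.forall_fin_succ]
        exact fun h => h2 (by simpa using h.2)
      simp only [h2, h3, and_false, if_false, mul_zero]
      exact hasSum_zero
  · simp only [Fin.cons_zero, h1, false_and, if_false, zero_mul]
    exact hasSum_zero

section

open PowerSeries

/-- The Euler operator `x d/dx`. -/
noncomputable def euler (A : PowerSeries ℝ) : PowerSeries ℝ := X * derivative ℝ A

lemma coeff_euler (A : PowerSeries ℝ) (j : ℕ) : coeff j (euler A) = j * coeff j A := by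
  cases j with
  | zero => simp [euler]
  | succ j =>
    rw [euler, coeff_succ_X_mul, coeff_derivative]
    push_cast
    ring

lemma euler_mul (A B : PowerSeries ℝ) : euler (A * B) = euler A * B + A * euler B := by
  simp only [euler, Derivation.leibniz, smul_eq_mul]
  ring

lemma euler_add (A B : PowerSeries ℝ) : euler (A + B) = euler A + euler B := by
  simp only [euler, map_add, mul_add]

lemma euler_sum {ι : Type*} (s : Finset ι) (A : ι → PowerSeries ℝ) :
    euler (∑ i ∈ s, A i) = ∑ i ∈ s, euler (A i) := by
  simp only [euler, map_sum, mul_sum]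

lemma C_sub_X_mul_geomSeries (k : ℕ) : (C ((k : ℝ) + 1) - X) * geomSeries k = X := by
  have h : (k : ℝ) + 1 ≠ 0 := by positivity
  ext j
  rw [sub_mul, map_sub, coeff_C_mul]
  rcases j with _ | _ | j
  · simp [geomSeries]
  · simp [geomSeries, coeff_succ_X_mul, h]
  · rw [coeff_succ_X_mul, coeff_X]
    simp only [geomSeries, coeff_mk]
    simp only [le_add_iff_nonneg_left, zero_le, if_true]
    rw [pow_succ _ (j + 1), mul_inv, mul_left_comm, mul_inv_cancel₀ h]
    simp

lemma euler_geomSeries (k : ℕ) : euler (geomSeries k) = geomSeries k + geomSeries k ^ 2 := by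
  have h := C_sub_X_mul_geomSeries k
  have h0 : (C ((k : ℝ) + 1) - X : PowerSeries ℝ) ≠ 0 := by
    intro h1
    rw [h1, zero_mul] at h
    exact X_ne_zero h.symm
  have h2 : derivative ℝ ((C ((k : ℝ) + 1) - X) * geomSeries k) = 1 := by rw [h, derivative_X]
  simp only [Derivation.leibniz, smul_eq_mul, map_sub, derivative_C, derivative_X] at h2
  refine mul_left_cancel₀ h0 ?_
  unfold euler
  linear_combination X * h2 - (1 + geomSeries k) * h

/-- The power sums of the first `m` series `geomSeries`. -/
noncomputable def geomPsum (j m : ℕ) : PowerSeries ℝ := ∑ k ∈ range m, geomSeries k ^ j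

lemma geomPsum_succ (j m : ℕ) : geomPsum j (m + 1) = geomPsum j m + geomSeries m ^ j := by
  simp [geomPsum, sum_range_succ]

lemma geomEsum_succ (n m : ℕ) :
    geomEsum (n + 1) (m + 1) = geomEsum (n + 1) m + geomSeries m * geomEsum n m := by
  simp [geomEsum, sum_range_succ]

lemma geomEsum_one (m : ℕ) : geomEsum 1 m = geomPsum 1 m := by
  simp [geomEsum, geomPsum]

lemma two_mul_geomEsum (m : ℕ) : 2 * geomEsum 2 m = geomPsum 1 m ^ 2 - geomPsum 2 m := by
  induction m with
  | zero => simp [geomEsum, geomPsum]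
  | succ m ih => rw [geomEsum_succ, mul_add, ih, geomEsum_one, geomPsum_succ, geomPsum_succ]; ring

lemma six_mul_geomEsum (m : ℕ) :
    6 * geomEsum 3 m = geomPsum 1 m ^ 3 - 3 * geomPsum 1 m * geomPsum 2 m + 2 * geomPsum 3 m := by
  induction m with
  | zero => simp [geomEsum, geomPsum]
  | succ m ih =>
    rw [geomEsum_succ, mul_add, ih, geomPsum_succ, geomPsum_succ, geomPsum_succ]
    linear_combination 3 * geomSeries m * two_mul_geomEsum m

lemma euler_geomSeries_pow (j k : ℕ) :
    euler (geomSeries k ^ j) = j * (geomSeries k ^ j + geomSeries k ^ (j + 1)) := by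
  induction j with
  | zero => simp [euler]
  | succ j ih =>
    rw [pow_succ, euler_mul, ih, euler_geomSeries]
    push_cast
    ring

lemma euler_geomPsum (j m : ℕ) :
    euler (geomPsum j m) = j * (geomPsum j m + geomPsum (j + 1) m) := by
  simp only [geomPsum, euler_sum, euler_geomSeries_pow, ← mul_sum, sum_add_distrib]

lemma euler_euler_geomEsum_one (m : ℕ) :
    euler (euler (geomEsum 1 m)) - 3 * euler (geomEsum 1 m) + 2 * geomEsum 1 m
      = 2 * geomPsum 3 m := by
  simp only [geomEsum_one, euler_geomPsum, Nat.cast_one, one_mul, euler_add]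
  push_cast
  ring

lemma euler_geomEsum_two (m : ℕ) :
    euler (geomEsum 2 m) - 2 * geomEsum 2 m = geomPsum 1 m * geomPsum 2 m - geomPsum 3 m := by
  have h : 2 * euler (geomEsum 2 m) = 2 * geomPsum 1 m * (geomPsum 1 m + geomPsum 2 m)
      - 2 * (geomPsum 2 m + geomPsum 3 m) := by
    have h1 : 2 * geomEsum 2 m + geomPsum 2 m = geomPsum 1 m * geomPsum 1 m := by
      rw [two_mul_geomEsum]; ring
    have h2 := congrArg euler h1
    rw [euler_add, two_mul, euler_add, euler_mul, euler_geomPsum, euler_geomPsum] at h2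
    push_cast at h2
    linear_combination h2
  have h0 : (2 : PowerSeries ℝ) ≠ 0 := by
    rw [← map_ofNat (C (R := ℝ)) 2, Ne, map_eq_zero_iff _ C_injective]
    norm_num
  refine mul_left_cancel₀ h0 ?_
  linear_combination h - 2 * two_mul_geomEsum m

/-- The generating series of the weighted sums of multiple harmonic sums. -/
noncomputable def weightSeries (m : ℕ) : PowerSeries ℝ :=
  leadSeries m * (4 * geomPsum 1 m ^ 3 + 2 * geomPsum 3 m)

lemma weightSeries_eq (m : ℕ) :
    weightSeries m =
      leadSeries m * (mk fun j => 24 * coeff j (geomEsum 3 m))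
      + leadSeries m * (mk fun j : ℕ => 12 * ((j : ℝ) - 2) * coeff j (geomEsum 2 m))
      + leadSeries m * (mk fun j : ℕ =>
          3 * ((j : ℝ) - 1) * ((j : ℝ) - 2) * coeff j (geomEsum 1 m)) := by
  have h3 : (mk fun j => 24 * coeff j (geomEsum 3 m)) = 24 * geomEsum 3 m := by
    ext j
    rw [coeff_mk, ← coeff_C_mul, map_ofNat]
  have h2 : (mk fun j : ℕ => 12 * ((j : ℝ) - 2) * coeff j (geomEsum 2 m))
      = 12 * (euler (geomEsum 2 m) - 2 * geomEsum 2 m) := by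
    ext j
    rw [coeff_mk, ← map_ofNat (C (R := ℝ)) 12, ← map_ofNat (C (R := ℝ)) 2, coeff_C_mul, map_sub,
      coeff_C_mul, coeff_euler]
    ring
  have h1 : (mk fun j : ℕ => 3 * ((j : ℝ) - 1) * ((j : ℝ) - 2) * coeff j (geomEsum 1 m))
      = 3 * (euler (euler (geomEsum 1 m)) - 3 * euler (geomEsum 1 m) + 2 * geomEsum 1 m) := by
    ext j
    rw [coeff_mk, ← map_ofNat (C (R := ℝ)) 3, ← map_ofNat (C (R := ℝ)) 2, coeff_C_mul, map_add,
      map_sub, coeff_C_mul, coeff_C_mul, coeff_euler, coeff_euler]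
    ring
  rw [h1, h2, h3, euler_euler_geomEsum_one, euler_geomEsum_two, weightSeries]
  linear_combination -4 * leadSeries m * six_mul_geomEsum m

end

/-- The power series `A` converges at `x` with value `v`. -/
def EvalsTo (A : PowerSeries ℝ) (x v : ℝ) : Prop :=
  HasSum (fun l => PowerSeries.coeff l A * x ^ l) v

namespace EvalsTo

variable {A B : PowerSeries ℝ} {x v w : ℝ}

lemma add (hA : EvalsTo A x v) (hB : EvalsTo B x w) : EvalsTo (A + B) x (v + w) := by
  simpa [EvalsTo, add_mul] using HasSum.add hA hB

lemma const_mul (c : ℝ) (hA : EvalsTo A x v) : EvalsTo (PowerSeries.C c * A) x (c * v) := by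
  simpa [EvalsTo, PowerSeries.coeff_C_mul, mul_assoc] using HasSum.mul_left c hA

lemma mul (hA : EvalsTo A x v) (hB : EvalsTo B x w) : EvalsTo (A * B) x (v * w) := by
  have hA' : Summable fun l => ‖PowerSeries.coeff l A * x ^ l‖ := HasSum.summable hA |>.norm
  have hB' : Summable fun l => ‖PowerSeries.coeff l B * x ^ l‖ := HasSum.summable hB |>.norm
  have h1 := (summable_norm_sum_mul_antidiagonal_of_summable_norm hA' hB').of_norm.hasSum
  rw [← tsum_mul_tsum_eq_tsum_sum_antidiagonal_of_summable_norm hA' hB', HasSum.tsum_eq hA,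
    HasSum.tsum_eq hB] at h1
  have h2 : (fun l => PowerSeries.coeff l (A * B) * x ^ l)
      = fun l => ∑ p ∈ antidiagonal l,
        PowerSeries.coeff p.1 A * x ^ p.1 * (PowerSeries.coeff p.2 B * x ^ p.2) := by
    ext l
    rw [PowerSeries.coeff_mul, sum_mul]
    refine sum_congr rfl fun p hp => ?_
    rw [← HasAntidiagonal.mem_antidiagonal.1 hp, pow_add]
    ring
  rw [EvalsTo, h2]
  exact h1

lemma one : EvalsTo 1 x 1 := by
  have h := hasSum_single (f := fun l => PowerSeries.coeff l (1 : PowerSeries ℝ) * x ^ l) 0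
    fun l hl => by simp [PowerSeries.coeff_one, hl]
  simpa [EvalsTo] using h

lemma pow (hA : EvalsTo A x v) (n : ℕ) : EvalsTo (A ^ n) x (v ^ n) := by
  induction n with
  | zero => simpa using one
  | succ n ih => rw [pow_succ, pow_succ]; exact ih.mul hA

lemma sum {ι : Type*} {s : Finset ι} {A : ι → PowerSeries ℝ} {v : ι → ℝ}
    (h : ∀ i ∈ s, EvalsTo (A i) x (v i)) : EvalsTo (∑ i ∈ s, A i) x (∑ i ∈ s, v i) := by
  simpa [EvalsTo, sum_mul] using hasSum_sum h

end EvalsTo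

lemma evalsTo_geomSeries (k : ℕ) {x : ℝ} (hx : |x| < 1) :
    EvalsTo (geomSeries k) x (x * shiftRecip (-x) k) := by
  have hk : (1 : ℝ) ≤ (k : ℝ) + 1 := by linarith [k.cast_nonneg (α := ℝ)]
  have hr : |x * ((k : ℝ) + 1)⁻¹| < 1 := by
    rw [abs_mul, abs_of_nonneg (by positivity : 0 ≤ ((k : ℝ) + 1)⁻¹)]
    exact mul_lt_one_of_nonneg_of_lt_one_left (abs_nonneg x) hx (inv_le_one_of_one_le₀ hk)
  have h := (hasSum_geometric_of_abs_lt_one hr).mul_left (x * ((k : ℝ) + 1)⁻¹)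
  have h1 : HasSum (fun l => PowerSeries.coeff (l + 1) (geomSeries k) * x ^ (l + 1))
      (x * shiftRecip (-x) k) := by
    have hx1 := (abs_lt.1 hx).2
    have h2 : x * shiftRecip (-x) k
        = x * ((k : ℝ) + 1)⁻¹ * (1 - x * ((k : ℝ) + 1)⁻¹)⁻¹ := by
      have h3 : (k : ℝ) + 1 + -x ≠ 0 := by linarith
      rw [shiftRecip, mul_assoc, ← mul_inv]
      congr 2
      field_simp
      ring
    rw [h2]
    refine Eq.subst (motive := fun f => HasSum f _) (funext fun l => ?_) h
    simp only [geomSeries, PowerSeries.coeff_mk, le_add_iff_nonneg_left, zero_le, if_true]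
    rw [mul_pow, ← inv_pow, pow_succ, pow_succ]
    ring
  have h4 := (hasSum_nat_add_iff' (f := fun l => PowerSeries.coeff l (geomSeries k) * x ^ l)
    (g := x * shiftRecip (-x) k) 1).1
  refine h4 ?_
  simpa [geomSeries] using h1

lemma evalsTo_leadSeries (k : ℕ) {x : ℝ} (hx : |2 * x| < 1) :
    EvalsTo (leadSeries k) x (-x * recipGap (-(2 * x)) k) := by
  have h := HasSum.mul_left (1 / 2) (evalsTo_geomSeries k hx)
  have h1 := HasSum.sub h (hasSum_single
    (f := fun l : ℕ => if l = 1 then x * ((k : ℝ) + 1)⁻¹ else 0) 1 fun l hl => by simp [hl])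
  unfold EvalsTo
  have h2 : -x * recipGap (-(2 * x)) k = 1 / 2 * (2 * x * shiftRecip (-(2 * x)) k)
      - (if 1 = 1 then x * ((k : ℝ) + 1)⁻¹ else 0) := by
    simp only [recipGap, if_true]; ring
  rw [h2]
  refine Eq.subst (motive := fun f => HasSum f _) (funext fun l => ?_) h1
  rcases l with _ | _ | l
  · simp [geomSeries, leadSeries]
  · simp [geomSeries, leadSeries]; ring
  · simp only [geomSeries, leadSeries, PowerSeries.coeff_mk]
    simp [mul_pow, pow_succ]
    ring

lemma evalsTo_geomPsum (j m : ℕ) {x : ℝ} (hx : |x| < 1) :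
    EvalsTo (geomPsum j m) x (x ^ j * recipPsum j (-x) m) := by
  have h := EvalsTo.sum (s := range m) fun k _ => (evalsTo_geomSeries k hx).pow j
  rw [recipPsum, mul_sum, geomPsum]
  simpa only [mul_pow] using h

lemma evalsTo_weightSeries (m : ℕ) {x : ℝ} (hx : |2 * x| < 1) :
    EvalsTo (weightSeries m) x
      (-24 * x ^ 4 * (recipGap (2 * -x) m * symWeight (-x) m)) := by
  have hx1 : |x| < 1 := by
    rw [abs_mul, abs_two] at hx
    linarith [abs_nonneg x]
  have h := (evalsTo_leadSeries m hx).mul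
    ((((evalsTo_geomPsum 1 m hx1).pow 3).const_mul 4).add
      ((evalsTo_geomPsum 3 m hx1).const_mul 2))
  rw [map_ofNat, map_ofNat] at h
  have hv : -24 * x ^ 4 * (recipGap (2 * -x) m * symWeight (-x) m)
      = -x * recipGap (-(2 * x)) m * (4 * (x ^ 1 * recipPsum 1 (-x) m) ^ 3
        + 2 * (x ^ 3 * recipPsum 3 (-x) m)) := by
    rw [symWeight, mul_neg]
    ring
  rw [hv]
  exact h

/-- Interchange of summation for a family of power series with nonnegative coefficients. -/
lemma hasSum_tsum_coeff {A : ℕ → PowerSeries ℝ} {r x : ℝ} {v u : ℕ → ℝ}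
    (hA : ∀ m l, 0 ≤ PowerSeries.coeff l (A m)) (hv : ∀ m, EvalsTo (A m) r (v m))
    (hs : Summable v) (hx : |x| ≤ r) (hu : ∀ m, EvalsTo (A m) x (u m)) :
    HasSum (fun l => (∑' m, PowerSeries.coeff l (A m)) * x ^ l) (∑' m, u m) := by
  have hr : 0 ≤ r := (abs_nonneg x).trans hx
  have h1 : Summable fun p : ℕ × ℕ => PowerSeries.coeff p.2 (A p.1) * r ^ p.2 := by
    refine (summable_prod_of_nonneg fun p => mul_nonneg (hA _ _) (pow_nonneg hr _)).2
      ⟨fun m => (hv m).summable, ?_⟩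
    exact hs.congr fun m => (hv m).tsum_eq.symm
  have h2 : Summable fun p : ℕ × ℕ => PowerSeries.coeff p.2 (A p.1) * x ^ p.2 := by
    refine h1.of_norm_bounded fun p => ?_
    rw [norm_mul, norm_pow, Real.norm_of_nonneg (hA _ _), Real.norm_eq_abs]
    have := hA p.1 p.2
    gcongr
  have h3 := h2.hasSum.prod_fiberwise hu
  rw [h3.tsum_eq]
  have h4 : Summable fun p : ℕ × ℕ => PowerSeries.coeff p.1 (A p.2) * x ^ p.1 :=
    (Equiv.prodComm ℕ ℕ).summable_iff.1 h2
  have h5 : ∑' p : ℕ × ℕ, PowerSeries.coeff p.1 (A p.2) * x ^ p.1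
      = ∑' p : ℕ × ℕ, PowerSeries.coeff p.2 (A p.1) * x ^ p.2 :=
    ((Equiv.prodComm ℕ ℕ).tsum_eq fun p : ℕ × ℕ => PowerSeries.coeff p.1 (A p.2) * x ^ p.1).symm
  rw [← h5]
  have h6 := h4.hasSum.prod_fiberwise fun l => (h4.prod_factor l).hasSum
  simpa only [tsum_mul_right] using h6

/-- The generating series of the polynomially weighted inverse powers of `m + 1`. -/
noncomputable def zetaSeries (m : ℕ) : PowerSeries ℝ :=
  PowerSeries.mk fun l =>
    if 5 ≤ l then ((l : ℝ) + 1) * ((l : ℝ) ^ 2 - l + 6) / 2 * (((m : ℝ) + 1) ^ l)⁻¹ else 0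

lemma weight_nonneg (l : ℕ) : 0 ≤ ((l : ℝ) + 1) * ((l : ℝ) ^ 2 - l + 6) / 2 := by
  have h : 0 ≤ (l : ℝ) ^ 2 - l + 6 := by nlinarith [sq_nonneg ((l : ℝ) - 1)]
  positivity

lemma coeff_zetaSeries_nonneg (m l : ℕ) : 0 ≤ PowerSeries.coeff l (zetaSeries m) := by
  have h := weight_nonneg l
  rw [zetaSeries, PowerSeries.coeff_mk]
  positivity

lemma coeff_geomSeries_polynomial (m l : ℕ) :
    PowerSeries.coeff l (PowerSeries.C 3 * geomSeries m ^ 4 + PowerSeries.C 6 * geomSeries m ^ 3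
        + PowerSeries.C 6 * geomSeries m ^ 2 + PowerSeries.C 6 * geomSeries m)
      = ((l : ℝ) + 1) * ((l : ℝ) ^ 2 - l + 6) / 2 * PowerSeries.coeff l (geomSeries m) := by
  have h (j : ℕ) : (l : ℝ) * PowerSeries.coeff l (geomSeries m ^ j)
      = j * (PowerSeries.coeff l (geomSeries m ^ j)
        + PowerSeries.coeff l (geomSeries m ^ (j + 1))) := by
    rw [← coeff_euler, euler_geomSeries_pow, ← map_natCast (PowerSeries.C (R := ℝ)) j,
      PowerSeries.coeff_C_mul, map_add]
  have h1 := h 1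
  have h2 := h 2
  have h3 := h 3
  simp only [map_add, PowerSeries.coeff_C_mul]
  rw [pow_one] at h1
  norm_num at h1 h2 h3
  linear_combination (-1) * h3 - (l + 3) / 2 * h2 - (3 + (l + 3) * (l - 2) / 2 + 3) * h1

lemma hasSum_ite_le {f : ℕ → ℝ} {v : ℝ} (h : HasSum f v) (n : ℕ) :
    HasSum (fun l => if n ≤ l then f l else 0) (v - ∑ l ∈ range n, f l) := by
  have h1 : HasSum (fun l => if l < n then f l else 0) (∑ l ∈ range n, f l) := by
    have h2 : HasSum (fun l => if l < n then f l else 0)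
        (∑ l ∈ range n, if l < n then f l else 0) :=
      hasSum_sum_of_ne_finset_zero fun l hl => by rw [if_neg (by simpa using hl)]
    rwa [sum_congr rfl fun l hl => if_pos (mem_range.1 hl)] at h2
  refine Eq.subst (motive := fun g => HasSum g _) (funext fun l => ?_) (h.sub h1)
  split_ifs <;> first | omega | simp

lemma evalsTo_zetaSeries (m : ℕ) {x : ℝ} (hx : |x| < 1) :
    EvalsTo (zetaSeries m) x
      (3 * (x * shiftRecip (-x) m) ^ 4 + 6 * (x * shiftRecip (-x) m) ^ 3
        + 6 * (x * shiftRecip (-x) m) ^ 2 + 6 * (x * shiftRecip (-x) m)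
        - (6 * x * ((m : ℝ) + 1)⁻¹ + 12 * x ^ 2 * ((m : ℝ) + 1)⁻¹ ^ 2
          + 24 * x ^ 3 * ((m : ℝ) + 1)⁻¹ ^ 3 + 45 * x ^ 4 * ((m : ℝ) + 1)⁻¹ ^ 4)) := by
  have h := evalsTo_geomSeries m hx
  have h1 := hasSum_ite_le (((((h.pow 4).const_mul 3).add ((h.pow 3).const_mul 6)).add
    ((h.pow 2).const_mul 6)).add (h.const_mul 6)) 5
  simp only [coeff_geomSeries_polynomial] at h1
  have h2 : ∑ l ∈ range 5, ((l : ℝ) + 1) * ((l : ℝ) ^ 2 - l + 6) / 2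
        * PowerSeries.coeff l (geomSeries m) * x ^ l
      = 6 * x * ((m : ℝ) + 1)⁻¹ + 12 * x ^ 2 * ((m : ℝ) + 1)⁻¹ ^ 2
          + 24 * x ^ 3 * ((m : ℝ) + 1)⁻¹ ^ 3 + 45 * x ^ 4 * ((m : ℝ) + 1)⁻¹ ^ 4 := by
    simp only [sum_range_succ, range_zero, sum_empty, geomSeries, PowerSeries.coeff_mk, ← inv_pow]
    norm_num
    ring
  rw [h2] at h1
  refine Eq.subst (motive := fun g => HasSum g _) (funext fun l => ?_) h1
  simp only [zetaSeries, geomSeries, PowerSeries.coeff_mk]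
  split_ifs <;> first | omega | simp

lemma summable_evalsTo_zetaSeries {r : ℝ} (hr : 0 ≤ r) {v : ℕ → ℝ}
    (hv : ∀ m, EvalsTo (zetaSeries m) r (v m)) : Summable v := by
  have h0 : ∀ m, 0 ≤ v m := fun m =>
    HasSum.nonneg (fun l => mul_nonneg (coeff_zetaSeries_nonneg m l) (pow_nonneg hr l)) (hv m)
  refine summable_of_le_majorant (v 0) h0 fun m => ?_
  have h1 : v m ≤ (((m : ℝ) + 1) ^ 2)⁻¹ * v 0 := by
    refine hasSum_le (fun l => ?_) (hv m) (HasSum.mul_left (((m : ℝ) + 1) ^ 2)⁻¹ (hv 0))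
    rw [← mul_assoc]
    refine mul_le_mul_of_nonneg_right ?_ (pow_nonneg hr l)
    simp only [zetaSeries, PowerSeries.coeff_mk]
    split_ifs with hl
    · have hm : (1 : ℝ) ≤ (m : ℝ) + 1 := by linarith [m.cast_nonneg (α := ℝ)]
      have h2 : (((m : ℝ) + 1) ^ l)⁻¹ ≤ (((m : ℝ) + 1) ^ 2)⁻¹ :=
        inv_anti₀ (by positivity) (pow_le_pow_right₀ hm (by omega))
      have := mul_le_mul_of_nonneg_left h2 (weight_nonneg l)
      simp only [Nat.cast_zero, zero_add, one_pow, inv_one, mul_one]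
      linarith
    · simp
  have h3 := mul_le_mul_of_nonneg_right (inv_sq_le_majorant m) (h0 0)
  linarith

lemma coeff_nonneg_mul {A B : PowerSeries ℝ} (hA : ∀ l, 0 ≤ PowerSeries.coeff l A)
    (hB : ∀ l, 0 ≤ PowerSeries.coeff l B) (l : ℕ) : 0 ≤ PowerSeries.coeff l (A * B) := by
  rw [PowerSeries.coeff_mul]
  exact sum_nonneg fun p _ => mul_nonneg (hA _) (hB _)

lemma coeff_nonneg_pow {A : PowerSeries ℝ} (hA : ∀ l, 0 ≤ PowerSeries.coeff l A) (n l : ℕ) :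
    0 ≤ PowerSeries.coeff l (A ^ n) := by
  induction n generalizing l with
  | zero => rw [pow_zero, PowerSeries.coeff_one]; positivity
  | succ n ih => rw [pow_succ]; exact coeff_nonneg_mul ih hA l

lemma coeff_geomPsum_nonneg (j m l : ℕ) : 0 ≤ PowerSeries.coeff l (geomPsum j m) := by
  rw [geomPsum, map_sum]
  refine sum_nonneg fun k _ => coeff_nonneg_pow (fun i => ?_) j l
  rw [geomSeries, PowerSeries.coeff_mk]
  positivity

lemma coeff_weightSeries_nonneg (m l : ℕ) : 0 ≤ PowerSeries.coeff l (weightSeries m) := by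
  refine coeff_nonneg_mul (fun i => ?_) (fun i => ?_) l
  · rw [leadSeries, PowerSeries.coeff_mk]
    positivity
  · rw [← map_ofNat (PowerSeries.C (R := ℝ)) 4, ← map_ofNat (PowerSeries.C (R := ℝ)) 2, map_add,
      PowerSeries.coeff_C_mul, PowerSeries.coeff_C_mul]
    have h1 := coeff_nonneg_pow (coeff_geomPsum_nonneg 1 m) 3 i
    have h2 := coeff_geomPsum_nonneg 3 m i
    positivity

lemma summable_recipGap_mul_symWeight_neg :
    Summable fun m => -recipGap (-(1 / 2)) m * symWeight (-(1 / 4)) m := by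
  have hy : ∀ k : ℕ, 0 ≤ shiftRecip (-(1 / 4)) k := fun k => by
    have := k.cast_nonneg (α := ℝ)
    exact inv_nonneg.2 (by linarith)
  have hp : ∀ j m, recipPsum j (-(1 / 4)) m ≤ (4 / 3) ^ j * recipPsum j 0 m := by
    intro j m
    rw [recipPsum, recipPsum, mul_sum]
    refine sum_le_sum fun k _ => ?_
    rw [← mul_pow]
    refine pow_le_pow_left₀ (hy k) ?_ j
    have := k.cast_nonneg (α := ℝ)
    unfold shiftRecip
    rw [add_zero, ← div_eq_mul_inv, inv_eq_one_div, div_le_div_iff₀ (by linarith) (by linarith)]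
    linarith
  have hp0 : ∀ j m, 0 ≤ recipPsum j (-(1 / 4)) m := fun j m =>
    sum_nonneg fun k _ => pow_nonneg (hy k) j
  have hw0 : ∀ m, 0 ≤ symWeight (-(1 / 4)) m := fun m => by
    have h1 := hp0 1 m
    have h2 := hp0 3 m
    unfold symWeight
    positivity
  have hw : ∀ m, symWeight (-(1 / 4)) m ≤ (4 / 3) ^ 3 * symWeight 0 m := fun m => by
    have h1 := pow_le_pow_left₀ (hp0 1 m) (hp 1 m) 3
    have h2 := hp 3 m
    unfold symWeight
    rw [mul_pow] at h1
    norm_num at h1 h2 ⊢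
    linarith
  have hg : ∀ m, 0 ≤ -recipGap (-(1 / 2)) m ∧
      -recipGap (-(1 / 2)) m ≤ (((m : ℝ) + 1) ^ 2)⁻¹ := fun m => by
    have hm := m.cast_nonneg (α := ℝ)
    have h1 : (0 : ℝ) < (m : ℝ) + 1 + -(1 / 2) := by linarith
    have h0 : (m : ℝ) + 1 + -(1 / 2) ≠ 0 := h1.ne'
    have h2 : (0 : ℝ) < (m : ℝ) + 1 := by linarith
    have h3 : -recipGap (-(1 / 2)) m
        = 1 / 2 * (((m : ℝ) + 1 + -(1 / 2))⁻¹ * ((m : ℝ) + 1)⁻¹) := by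
      rw [recipGap, shiftRecip, inv_sub_inv h2.ne' h0, ← mul_inv]
      ring
    rw [h3]
    refine ⟨by positivity, ?_⟩
    have h4 : 1 / 2 * ((m : ℝ) + 1 + -(1 / 2))⁻¹ ≤ ((m : ℝ) + 1)⁻¹ := by
      rw [← div_eq_mul_inv, inv_eq_one_div, div_le_div_iff₀ h1 h2]
      linarith
    rw [← mul_assoc, sq, mul_inv]
    exact mul_le_mul_of_nonneg_right h4 (by positivity)
  refine summable_of_le_majorant ((4 / 3) ^ 3) (fun m => mul_nonneg (hg m).1 (hw0 m)) fun m => ?_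
  calc -recipGap (-(1 / 2)) m * symWeight (-(1 / 4)) m
      ≤ (((m : ℝ) + 1) ^ 2)⁻¹ * ((4 / 3) ^ 3 * symWeight 0 m) :=
        mul_le_mul (hg m).2 (hw m) (hw0 m) (by positivity)
    _ = (4 / 3) ^ 3 * ((((m : ℝ) + 1) ^ 2)⁻¹ * symWeight 0 m) := by ring
    _ ≤ (4 / 3) ^ 3 * majorant m := by
        gcongr
        exact pow_mul_le_majorant le_rfl (symWeight_le le_rfl m)

lemma hasSum_weightSeries {s : ℝ} (hs : 0 < s) (hs4 : s ≤ 1 / 4) :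
    HasSum (fun l => (∑' m, PowerSeries.coeff l (weightSeries m)) * (-s) ^ l)
      (-24 * s ^ 4 * weightedSum s) := by
  have h := hasSum_tsum_coeff (r := 1 / 4) (x := -s) coeff_weightSeries_nonneg
    (fun m => evalsTo_weightSeries m (by norm_num [abs_lt])) ?_
    (by rw [abs_neg, abs_of_pos hs]; exact hs4)
    (fun m => evalsTo_weightSeries m (by rw [abs_lt]; constructor <;> linarith))
  · rw [tsum_mul_left, neg_neg, Even.neg_pow (by decide)] at h
    exact h
  · have h1 := summable_recipGap_mul_symWeight_neg.mul_left (24 * (1 / 4) ^ 4)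
    refine h1.congr fun m => ?_
    rw [show (2 : ℝ) * -(1 / 4) = -(1 / 2) by norm_num]
    ring

lemma hasSum_zetaSeries {s : ℝ} (hs : 0 < s) (hs4 : s ≤ 1 / 4) :
    HasSum (fun l => (∑' m, PowerSeries.coeff l (zetaSeries m)) * (-s) ^ l)
      (-24 * s ^ 4 * weightedSumForm s - 45 * hurwitzSum 4 0 * s ^ 4) := by
  have h := hasSum_tsum_coeff (r := 1 / 4) (x := -s) coeff_zetaSeries_nonneg
    (fun m => evalsTo_zetaSeries m (by norm_num [abs_lt]))
    (summable_evalsTo_zetaSeries (by norm_num)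
      fun m => evalsTo_zetaSeries m (by norm_num [abs_lt]))
    (by rw [abs_neg, abs_of_pos hs]; exact hs4)
    (fun m => evalsTo_zetaSeries m (by rw [abs_lt]; constructor <;> linarith))
  have hy (j : ℕ) (hj : 2 ≤ j) : HasSum (fun m => shiftRecip s m ^ j) (hurwitzSum j s) :=
    (summable_shiftRecip_pow hs.le hj).hasSum
  have h0 (j : ℕ) (hj : 2 ≤ j) : HasSum (fun m : ℕ => ((m : ℝ) + 1)⁻¹ ^ j) (hurwitzSum j 0) := by
    rw [hurwitzSum_zero_eq]
    exact (summable_inv_pow hj).hasSum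
  have hg : HasSum (fun m => recipGap s m * ((m : ℝ) + 1)⁻¹ ^ 0) (gapSum 0 s) :=
    (summable_gapSum hs.le 0).hasSum
  have h1 := ((((((hy 4 (by norm_num)).mul_left (3 * s ^ 4)).add
    ((hy 3 (by norm_num)).mul_left (-6 * s ^ 3))).add ((hy 2 le_rfl).mul_left (6 * s ^ 2))).add
    (hg.mul_left (6 * s))).add ((h0 2 le_rfl).mul_left (-12 * s ^ 2))).add
    ((h0 3 (by norm_num)).mul_left (24 * s ^ 3)) |>.add
    ((h0 4 (by norm_num)).mul_left (-45 * s ^ 4))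
  rw [tsum_congr fun m => ?_, h1.tsum_eq] at h
  · have h2 : -24 * s ^ 4 * weightedSumForm s - 45 * hurwitzSum 4 0 * s ^ 4
        = 3 * s ^ 4 * hurwitzSum 4 s + -6 * s ^ 3 * hurwitzSum 3 s + 6 * s ^ 2 * hurwitzSum 2 s
          + 6 * s * gapSum 0 s + -12 * s ^ 2 * hurwitzSum 2 0 + 24 * s ^ 3 * hurwitzSum 3 0
          + -45 * s ^ 4 * hurwitzSum 4 0 := by
      unfold weightedSumForm
      field_simp
      ring
    rw [h2]
    exact h
  · rw [neg_neg, recipGap]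
    ring

/-- A power series vanishing on a left neighbourhood of zero is zero. -/
lemma eq_zero_of_hasSum_zero {d : ℕ → ℝ} {r : ℝ} (hr : 0 < r)
    (h : ∀ s, 0 < s → s ≤ r → HasSum (fun l => d l * (-s) ^ l) 0) : d = 0 := by
  set p := FormalMultilinearSeries.ofScalars ℝ d with hp
  have hrad : ENNReal.ofReal r ≤ p.radius := by
    refine p.le_radius_of_summable (r := r.toNNReal) ?_
    refine (h r hr le_rfl).summable.norm.congr fun l => ?_
    rw [hp, FormalMultilinearSeries.ofScalars_norm, norm_mul, norm_pow, norm_neg,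
      Real.norm_of_nonneg hr.le, Real.coe_toNNReal r hr.le]
  have hball := p.hasFPowerSeriesOnBall ((ENNReal.ofReal_pos.2 hr).trans_le hrad)
  have hz : ∀ s, 0 < s → s ≤ r → p.sum (-s) = 0 := by
    intro s hs hsr
    have h1 := FormalMultilinearSeries.ofScalars_sum_eq (E := ℝ) d (-s)
    rw [FormalMultilinearSeries.ofScalarsSum] at h1
    rw [hp, h1]
    simpa only [smul_eq_mul] using (h s hs hsr).tsum_eq
  rcases hball.hasFPowerSeriesAt.analyticAt.eventually_eq_zero_or_eventually_ne_zero with h1 | h1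
  · have h2 := hball.hasFPowerSeriesAt.eq_zero_of_eventually h1
    exact (FormalMultilinearSeries.ofScalars_series_eq_zero ℝ).1 h2
  · exfalso
    have h2 : Tendsto (fun n : ℕ => -(r / ((n : ℝ) + 1))) atTop (𝓝[≠] 0) := by
      refine tendsto_nhdsWithin_iff.2 ⟨?_, Eventually.of_forall fun n => ?_⟩
      · have h3 := (tendsto_one_div_add_atTop_nhds_zero_nat (𝕜 := ℝ)).const_mul (-r)
        rw [mul_zero] at h3
        exact h3.congr fun n => by ring
      · have : r / ((n : ℝ) + 1) ≠ 0 := by positivity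
        simpa using this
    obtain ⟨n, hn⟩ := (h2.eventually h1).exists
    exact hn (hz _ (by positivity)
      (div_le_self hr.le (by linarith [n.cast_nonneg (α := ℝ)])))

lemma tsum_coeff_weightSeries_eq {l : ℕ} (hl : 5 ≤ l) :
    ∑' m, PowerSeries.coeff l (weightSeries m) = ∑' m, PowerSeries.coeff l (zetaSeries m) := by
  obtain ⟨K, hK⟩ := exists_weightedSum_eq
  let d : ℕ → ℝ := fun l => ∑' m, PowerSeries.coeff l (weightSeries m)
    - ∑' m, PowerSeries.coeff l (zetaSeries m)
    - if l = 4 then 45 * hurwitzSum 4 0 - 24 * K else 0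
  have hd : d = 0 := by
    refine eq_zero_of_hasSum_zero (r := 1 / 4) (by norm_num) fun s hs hs4 => ?_
    have h1 := (hasSum_weightSeries hs hs4).sub (hasSum_zetaSeries hs hs4)
    have h2 := h1.sub (hasSum_single
      (f := fun l : ℕ => (if l = 4 then 45 * hurwitzSum 4 0 - 24 * K else 0) * (-s) ^ l) 4
      fun l hl => by simp [hl])
    rw [hK s hs (by linarith)] at h2
    have h3 : (0 : ℝ) = -24 * s ^ 4 * (weightedSumForm s + K)
        - (-24 * s ^ 4 * weightedSumForm s - 45 * hurwitzSum 4 0 * s ^ 4)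
        - (if 4 = 4 then 45 * hurwitzSum 4 0 - 24 * K else 0) * (-s) ^ 4 := by
      rw [if_pos rfl]; ring
    rw [h3]
    refine Eq.subst (motive := fun g => HasSum g _) (funext fun l => ?_) h2
    simp only [d]
    ring
  have h := congrFun hd l
  simp only [d, if_neg (by omega : l ≠ 4), sub_zero, Pi.zero_apply] at h
  linarith

lemma tsum_coeff_zetaSeries {l : ℕ} (hl : 5 ≤ l) :
    ∑' m, PowerSeries.coeff l (zetaSeries m)
      = ((l : ℝ) + 1) * ((l : ℝ) ^ 2 - l + 6) / 2 * rz l := by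
  simp only [zetaSeries, PowerSeries.coeff_mk, if_pos hl]
  rw [tsum_mul_left, rz, tsum_pnat_eq_tsum_succ (f := fun n : ℕ => ((n : ℝ) ^ l)⁻¹)]
  simp

/-- Proposition 4.2 (i) of Machide: for `l ≥ 5`,
`((l+1)(l²-l+6)/48) ζ(l)
  = Σ_{l₁≥2, l₂,l₃,l₄≥1, Σ=l} 2^(l₁-1) ζ(l₁,l₂,l₃,l₄)
    + (1/2) Σ_{l₁≥2, l₂,l₃≥1, Σ=l} (l-l₁-2) 2^(l₁-1) ζ(l₁,l₂,l₃)
    + (1/8) Σ_{l₁≥2, l₂≥1, Σ=l} (l-l₁-1)(l-l₁-2) 2^(l₁-1) ζ(l₁,l₂)`. -/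
theorem weighted_sum_depth_four_i (l : ℕ) (hl : 5 ≤ l) :
    ((l : ℝ) + 1) * ((l : ℝ) ^ 2 - (l : ℝ) + 6) / 48 * rz l
      = (∑ c ∈ (Finset.Nat.antidiagonalTuple 4 l).filter
            (fun c => 2 ≤ c 0 ∧ ∀ i, 1 ≤ c i),
          (2 : ℝ) ^ (c 0 - 1) * mzv c)
        + (1 / 2) * (∑ c ∈ (Finset.Nat.antidiagonalTuple 3 l).filter
            (fun c => 2 ≤ c 0 ∧ ∀ i, 1 ≤ c i),
          ((l : ℝ) - (c 0 : ℝ) - 2) * (2 : ℝ) ^ (c 0 - 1) * mzv c)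
        + (1 / 8) * (∑ c ∈ (Finset.Nat.antidiagonalTuple 2 l).filter
            (fun c => 2 ≤ c 0 ∧ ∀ i, 1 ≤ c i),
          ((l : ℝ) - (c 0 : ℝ) - 1) * ((l : ℝ) - (c 0 : ℝ) - 2)
            * (2 : ℝ) ^ (c 0 - 1) * mzv c) := by
  have h := (((sum_mzv_eq (n := 3) le_rfl l fun _ => 24).add
    (sum_mzv_eq (n := 2) (by norm_num) l fun j => 12 * ((j : ℝ) - 2))).add
    (sum_mzv_eq (n := 1) (by norm_num) l fun j => 3 * ((j : ℝ) - 1) * ((j : ℝ) - 2))).tsum_eq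
  simp only [← map_add, ← weightSeries_eq] at h
  rw [tsum_coeff_weightSeries_eq hl, tsum_coeff_zetaSeries hl] at h
  have hcast {n : ℕ} {c : Fin (n + 1) → ℕ} (hc : c ∈ (Nat.antidiagonalTuple (n + 1) l).filter
      (fun c => 2 ≤ c 0 ∧ ∀ i, 1 ≤ c i)) : ((l - c 0 : ℕ) : ℝ) = (l : ℝ) - c 0 := by
    refine Nat.cast_sub ?_
    rw [← Nat.mem_antidiagonalTuple.1 (mem_filter.1 hc).1]
    exact single_le_sum (fun _ _ => Nat.zero_le _) (mem_univ 0)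
  have h4 : ∑ c ∈ (Nat.antidiagonalTuple 4 l).filter (fun c => 2 ≤ c 0 ∧ ∀ i, 1 ≤ c i),
      24 * (2 : ℝ) ^ (c 0 - 1) * mzv c
      = 24 * ∑ c ∈ (Nat.antidiagonalTuple 4 l).filter (fun c => 2 ≤ c 0 ∧ ∀ i, 1 ≤ c i),
        (2 : ℝ) ^ (c 0 - 1) * mzv c := by
    rw [mul_sum]
    exact sum_congr rfl fun c _ => by ring
  have h3 : ∑ c ∈ (Nat.antidiagonalTuple 3 l).filter (fun c => 2 ≤ c 0 ∧ ∀ i, 1 ≤ c i),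
      12 * (((l - c 0 : ℕ) : ℝ) - 2) * (2 : ℝ) ^ (c 0 - 1) * mzv c
      = 12 * ∑ c ∈ (Nat.antidiagonalTuple 3 l).filter (fun c => 2 ≤ c 0 ∧ ∀ i, 1 ≤ c i),
        ((l : ℝ) - c 0 - 2) * (2 : ℝ) ^ (c 0 - 1) * mzv c := by
    rw [mul_sum]
    exact sum_congr rfl fun c hc => by rw [hcast hc]; ring
  have h2 : ∑ c ∈ (Nat.antidiagonalTuple 2 l).filter (fun c => 2 ≤ c 0 ∧ ∀ i, 1 ≤ c i),
      3 * (((l - c 0 : ℕ) : ℝ) - 1) * (((l - c 0 : ℕ) : ℝ) - 2) * (2 : ℝ) ^ (c 0 - 1) * mzv c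
      = 3 * ∑ c ∈ (Nat.antidiagonalTuple 2 l).filter (fun c => 2 ≤ c 0 ∧ ∀ i, 1 ≤ c i),
        ((l : ℝ) - c 0 - 1) * ((l : ℝ) - c 0 - 2) * (2 : ℝ) ^ (c 0 - 1) * mzv c := by
    rw [mul_sum]
    exact sum_congr rfl fun c hc => by rw [hcast hc]; ring
  rw [h4, h3, h2] at h
  linarith
end

section
/- For any integer l ≥ 5, one has ((l+1)(l²−7l+18)/24) ζ(l) = Σ_{l₁≥2, l₂,l₃,l₄≥1, l₁+l₂+l₃+l₄=l} 2^{l₁−1} ζ(l₁,l₂,l₃,l₄) + (1/4) Σ_{j₁,j₂≥3, j₁+j₂=l} (j₁−1)(j₂−1) ζ(j₁) ζ(j₂). -/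
open scoped BigOperators

/-- Interchange of two nonnegative summations. -/
theorem hasSum_tsum_comm_of_nonneg {α β : Type*} {f : α → β → ℝ} {g : α → ℝ} {s : ℝ}
    (hf : ∀ a b, 0 ≤ f a b) (hg : ∀ a, HasSum (f a) (g a)) (hs : HasSum g s) :
    HasSum (fun b => ∑' a, f a b) s := by
  have hsum : Summable (fun p : α × β => f p.1 p.2) := by
    rw [summable_prod_of_nonneg (fun p => hf p.1 p.2)]
    refine ⟨fun a => (hg a).summable, ?_⟩
    simpa only [(hg _).tsum_eq] using hs.summable
  have h1 : HasSum (fun p : α × β => f p.1 p.2) s := by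
    have := hsum.hasSum.prod_fiberwise (fun a => hg a)
    rw [hs.unique this]
    exact hsum.hasSum
  have h2 : HasSum (fun p : β × α => f p.2 p.1) s :=
    (Equiv.prodComm β α).hasSum_iff.2 h1
  exact h2.prod_fiberwise (fun b => (h2.summable.prod_factor b).hasSum)

theorem hasSum_comm_of_nonneg {α β : Type*} {f : α → β → ℝ} {g : α → ℝ} {h : β → ℝ} {s : ℝ}
    (hf : ∀ a b, 0 ≤ f a b) (hg : ∀ a, HasSum (f a) (g a)) (hh : ∀ b, HasSum (f · b) (h b))
    (hs : HasSum g s) : HasSum h s := by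
  simpa only [(hh _).tsum_eq] using hasSum_tsum_comm_of_nonneg hf hg hs

/-- The elementary symmetric polynomial of degree `k` in `1 / (j - t)`, `1 ≤ j ≤ m`. -/
noncomputable def esymmShift (t : ℝ) : ℕ → ℕ → ℝ
  | _, 0 => 1
  | 0, _ + 1 => 0
  | m + 1, k + 1 => esymmShift t m (k + 1) + ((m : ℝ) + 1 - t)⁻¹ * esymmShift t m k

@[simp] theorem esymmShift_zero_right (t : ℝ) (m : ℕ) : esymmShift t m 0 = 1 := by
  cases m <;> rfl

@[simp] theorem esymmShift_zero_succ (t : ℝ) (k : ℕ) : esymmShift t 0 (k + 1) = 0 := rfl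

theorem esymmShift_succ_succ (t : ℝ) (m k : ℕ) :
    esymmShift t (m + 1) (k + 1)
      = esymmShift t m (k + 1) + ((m : ℝ) + 1 - t)⁻¹ * esymmShift t m k := rfl

theorem add_one_sub_pos {t : ℝ} (ht : t < 1) (m : ℕ) : 0 < (m : ℝ) + 1 - t := by
  have : (0 : ℝ) ≤ m := m.cast_nonneg
  linarith

theorem esymmShift_nonneg {t : ℝ} (ht : t < 1) (m k : ℕ) : 0 ≤ esymmShift t m k := by
  induction m generalizing k with
  | zero => cases k <;> simp
  | succ m ih =>
    cases k with
    | zero => simp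
    | succ k =>
      have := add_one_sub_pos ht m
      have h1 := ih k
      have h2 := ih (k + 1)
      rw [esymmShift_succ_succ]
      positivity

theorem esymmShift_succ_eq_sum (t : ℝ) (m k : ℕ) :
    esymmShift t m (k + 1)
      = ∑ j ∈ Finset.range m, ((j : ℝ) + 1 - t)⁻¹ * esymmShift t j k := by
  induction m with
  | zero => simp
  | succ m ih => rw [esymmShift_succ_succ, Finset.sum_range_succ, ih]

theorem prod_one_add_eq_sum_esymmShift (t y : ℝ) (m n : ℕ) (h : m < n) :
    ∏ k ∈ Finset.range m, (1 + y * ((k : ℝ) + 1 - t)⁻¹)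
      = ∑ k ∈ Finset.range n, esymmShift t m k * y ^ k := by
  induction m generalizing n with
  | zero =>
    obtain ⟨n, rfl⟩ := Nat.exists_eq_succ_of_ne_zero h.ne'
    simp [Finset.sum_range_succ']
  | succ m ih =>
    obtain ⟨n, rfl⟩ := Nat.exists_eq_succ_of_ne_zero (Nat.ne_zero_of_lt h)
    rw [Finset.prod_range_succ, Finset.sum_range_succ', mul_add, mul_one]
    nth_rw 1 [ih (n + 1) (by omega)]
    rw [ih n (by omega), Finset.sum_range_succ', Finset.sum_mul]
    simp only [esymmShift_succ_succ, add_mul, Finset.sum_add_distrib, esymmShift_zero_right]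
    have : ∀ i ∈ Finset.range n, esymmShift t m i * y ^ i * (y * ((m : ℝ) + 1 - t)⁻¹)
        = ((m : ℝ) + 1 - t)⁻¹ * esymmShift t m i * y ^ (i + 1) := fun i _ => by ring
    rw [Finset.sum_congr rfl this]
    ring

theorem prod_one_add_le_sqrt {t : ℝ} (ht : t ≤ 1 / 4) (m : ℕ) :
    ∏ k ∈ Finset.range m, (1 + 1 / 4 * ((k : ℝ) + 1 - t)⁻¹) ≤ Real.sqrt (m + 1) := by
  induction m with
  | zero => simp
  | succ m ih =>
    have hm : (0 : ℝ) ≤ m := m.cast_nonneg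
    have hpos := add_one_sub_pos (show t < 1 by linarith) m
    rw [Finset.prod_range_succ]
    refine (mul_le_mul_of_nonneg_right ih (by positivity)).trans ?_
    refine Real.le_sqrt_of_sq_le ?_
    rw [mul_pow, Real.sq_sqrt (by positivity)]
    have h1 : 1 / 4 * ((m : ℝ) + 1 - t)⁻¹ ≤ 1 / 3 * ((m : ℝ) + 1)⁻¹ := by
      rw [← div_eq_mul_inv, ← div_eq_mul_inv, div_le_div_iff₀ hpos (by positivity)]
      linarith
    have h2 : (1 + 1 / 4 * ((m : ℝ) + 1 - t)⁻¹) ^ 2 ≤ (1 + 1 / 3 * ((m : ℝ) + 1)⁻¹) ^ 2 := by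
      gcongr
    refine (mul_le_mul_of_nonneg_left h2 (by positivity)).trans ?_
    have h3 : ((m : ℝ) + 1) * (1 + 1 / 3 * ((m : ℝ) + 1)⁻¹) ^ 2
        = (m + 1) + 2 / 3 + 1 / 9 * ((m : ℝ) + 1)⁻¹ := by
      field_simp; ring
    have h4 : ((m : ℝ) + 1)⁻¹ ≤ 1 := inv_le_one_of_one_le₀ (by linarith)
    rw [h3]; push_cast; linarith

theorem esymmShift_le_sqrt {t : ℝ} (ht : t ≤ 1 / 4) (m k : ℕ) :
    esymmShift t m k ≤ 4 ^ k * Real.sqrt (m + 1) := by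
  have h := prod_one_add_le_sqrt ht m
  rw [prod_one_add_eq_sum_esymmShift t _ m (m + k + 1) (by omega)] at h
  have h1 : esymmShift t m k * (1 / 4) ^ k ≤ Real.sqrt (m + 1) := by
    refine le_trans ?_ h
    refine Finset.single_le_sum (f := fun k => esymmShift t m k * (1 / 4 : ℝ) ^ k)
      (fun i _ => ?_) (Finset.mem_range.2 (by omega))
    have := esymmShift_nonneg (show t < 1 by linarith) m i
    positivity
  calc esymmShift t m k = 4 ^ k * (esymmShift t m k * (1 / 4) ^ k) := by
        rw [mul_left_comm, ← mul_pow]; norm_num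
    _ ≤ _ := by gcongr

theorem summable_sqrt_div_sq :
    Summable (fun m : ℕ => Real.sqrt ((m : ℝ) + 1) / ((m : ℝ) + 1) ^ 2) := by
  have h := (summable_nat_add_iff 1).2
    (Real.summable_nat_rpow_inv.2 (show (1 : ℝ) < 3 / 2 by norm_num))
  refine h.congr fun m => ?_
  have hm : (0 : ℝ) < m + 1 := by positivity
  push_cast
  rw [Real.sqrt_eq_rpow, ← Real.rpow_natCast, ← Real.rpow_sub hm, ← Real.rpow_neg hm.le]
  norm_num

theorem sub_inv_le {s : ℝ} (hs : s ≤ 1 / 2) (m : ℕ) :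
    ((m : ℝ) + 1 - s)⁻¹ ≤ 2 * ((m : ℝ) + 1)⁻¹ := by
  have hm : (0 : ℝ) ≤ m := m.cast_nonneg
  rw [← div_eq_mul_inv, inv_eq_one_div, div_le_div_iff₀ (by linarith) (by positivity)]
  linarith

/-- The connector `∏_{k ≤ m} (k - t) / (k + n - t)` of the connected sums used below. -/
noncomputable def sumConnector (t : ℝ) (n m : ℕ) : ℝ :=
  ∏ k ∈ Finset.range m, (((k : ℝ) + 1 - t) / ((k : ℝ) + 1 + n - t))

theorem sumConnector_succ_right (t : ℝ) (n m : ℕ) :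
    sumConnector t n (m + 1)
      = sumConnector t n m * (((m : ℝ) + 1 - t) / ((m : ℝ) + 1 + n - t)) :=
  Finset.prod_range_succ _ _

theorem add_one_add_sub_pos {t : ℝ} (ht : t < 1) (m n : ℕ) : 0 < (m : ℝ) + 1 + n - t := by
  have : (0 : ℝ) ≤ m := m.cast_nonneg
  have : (0 : ℝ) ≤ n := n.cast_nonneg
  linarith

theorem sumConnector_pos {t : ℝ} (ht : t < 1) (n m : ℕ) : 0 < sumConnector t n m :=
  Finset.prod_pos fun k _ => div_pos (add_one_sub_pos ht k) (add_one_add_sub_pos ht k n)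

@[simp] theorem sumConnector_zero_left {t : ℝ} (ht : t < 1) (m : ℕ) :
    sumConnector t 0 m = 1 :=
  Finset.prod_eq_one fun k _ => by
    rw [Nat.cast_zero, add_zero, div_self (add_one_sub_pos ht k).ne']

theorem sumConnector_succ_left {t : ℝ} (ht : t < 1) (n m : ℕ) :
    sumConnector t (n + 1) m * ((m : ℝ) + n + 1 - t) = sumConnector t n m * ((n : ℝ) + 1 - t) := by
  induction m with
  | zero => simp [sumConnector]
  | succ m ih =>
    have h1 := add_one_add_sub_pos ht m n
    have h2 := add_one_add_sub_pos ht m (n + 1)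
    rw [sumConnector_succ_right, sumConnector_succ_right]
    push_cast at h2 ⊢
    have e : sumConnector t (n + 1) m * (((m : ℝ) + 1 - t) / (m + 1 + (n + 1) - t))
        * (m + 1 + n + 1 - t) = sumConnector t (n + 1) m * (m + 1 - t) := by
      field_simp; ring
    rw [e]
    field_simp
    linear_combination (m + 1 - t) * ih

theorem sumConnector_one {t : ℝ} (ht : t < 1) (m : ℕ) :
    sumConnector t 1 m = (1 - t) / ((m : ℝ) + 1 - t) := by
  have h := sumConnector_succ_left ht 0 m
  rw [sumConnector_zero_left ht] at h
  rw [eq_div_iff (add_one_sub_pos ht m).ne']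
  simpa using h

theorem sumConnector_succ_le_one {t : ℝ} (ht : t < 1) (n m : ℕ) :
    sumConnector t (n + 1) m ≤ sumConnector t 1 m := by
  refine Finset.prod_le_prod (fun k _ => ?_) fun k _ => ?_
  · exact (div_pos (add_one_sub_pos ht k) (add_one_add_sub_pos ht k (n + 1))).le
  · refine div_le_div_of_nonneg_left (add_one_sub_pos ht k).le (add_one_add_sub_pos ht k 1) ?_
    have : (0 : ℝ) ≤ n := n.cast_nonneg
    push_cast; linarith

theorem hasSum_sumConnector_left {t : ℝ} (ht : t < 1) (m : ℕ) :
    HasSum (fun n : ℕ => ((n : ℝ) + 1 - t)⁻¹ * sumConnector t (n + 1) (m + 1))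
      ((m : ℝ) + 1)⁻¹ := by
  have hpart : ∀ N : ℕ, ∑ n ∈ Finset.range N,
      ((n : ℝ) + 1 - t)⁻¹ * sumConnector t (n + 1) (m + 1)
        = ((m : ℝ) + 1)⁻¹ * (1 - sumConnector t N (m + 1)) := by
    intro N
    induction N with
    | zero => simp [sumConnector_zero_left ht]
    | succ N ih =>
      rw [Finset.sum_range_succ, ih]
      have h := sumConnector_succ_left ht N (m + 1)
      have h1 := add_one_sub_pos ht N
      push_cast at h
      field_simp
      linear_combination h
  rw [hasSum_iff_tendsto_nat_of_nonneg fun n =>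
    mul_nonneg (inv_pos.2 (add_one_sub_pos ht n)).le (sumConnector_pos ht _ _).le]
  simp only [hpart]
  have hlim : Filter.Tendsto (fun N : ℕ => sumConnector t N (m + 1)) Filter.atTop (nhds 0) := by
    have hz : Filter.Tendsto (fun N : ℕ => (1 - t) / ((N : ℝ) + (1 - t))) Filter.atTop (nhds 0) :=
      (tendsto_natCast_atTop_atTop.atTop_add tendsto_const_nhds).const_div_atTop _
    refine squeeze_zero (fun N => (sumConnector_pos ht _ _).le) (fun N => ?_) hz
    rw [sumConnector, Finset.prod_range_succ']
    have h1 : ∏ k ∈ Finset.range m,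
        ((((k + 1 : ℕ) : ℝ) + 1 - t) / (((k + 1 : ℕ) : ℝ) + 1 + N - t)) ≤ 1 := by
      refine Finset.prod_le_one (fun k _ => ?_) fun k _ => ?_
      · exact (div_pos (add_one_sub_pos ht (k + 1)) (add_one_add_sub_pos ht (k + 1) N)).le
      · refine div_le_one_of_le₀ ?_ (add_one_add_sub_pos ht (k + 1) N).le
        have : (0 : ℝ) ≤ N := N.cast_nonneg
        linarith
    have h2 : (0 : ℝ) < 1 + N - t := by simpa using add_one_add_sub_pos ht 0 N
    have h3 : 0 ≤ (1 - t) / ((N : ℝ) + (1 - t)) := div_nonneg (by linarith) (by linarith)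
    calc _ = _ * ((1 - t) / ((N : ℝ) + (1 - t))) := by
          push_cast; congr 2 <;> ring
      _ ≤ 1 * ((1 - t) / ((N : ℝ) + (1 - t))) := mul_le_mul_of_nonneg_right h1 h3
      _ = _ := one_mul _
  simpa using ((tendsto_const_nhds (x := (1 : ℝ))).sub hlim).const_mul ((m : ℝ) + 1)⁻¹

theorem tendsto_sumConnector_mul_esymmShift {t : ℝ} (ht : t ≤ 1 / 4) (n k : ℕ) :
    Filter.Tendsto (fun m : ℕ => sumConnector t (n + 1) m * esymmShift t m k)
      Filter.atTop (nhds 0) := by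
  have ht1 : t < 1 := by linarith
  have hz : Filter.Tendsto
      (fun m : ℕ => ((1 - t) * 2 * 4 ^ k) / Real.sqrt ((m : ℝ) + 1)) Filter.atTop (nhds 0) :=
    (Real.tendsto_sqrt_atTop.comp
      (tendsto_natCast_atTop_atTop.atTop_add tendsto_const_nhds)).const_div_atTop _
  refine squeeze_zero (fun m => mul_nonneg (sumConnector_pos ht1 _ _).le
    (esymmShift_nonneg ht1 _ _)) (fun m => ?_) hz
  have h1 := sumConnector_succ_le_one ht1 n m
  rw [sumConnector_one ht1, div_eq_mul_inv] at h1
  have hm : (0 : ℝ) < (m : ℝ) + 1 := by positivity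
  calc _ ≤ ((1 - t) * (2 * ((m : ℝ) + 1)⁻¹)) * (4 ^ k * Real.sqrt (m + 1)) := by
        refine mul_le_mul (h1.trans ?_) (esymmShift_le_sqrt ht m k)
          (esymmShift_nonneg ht1 _ _) ?_
        · exact mul_le_mul_of_nonneg_left (sub_inv_le (by linarith) m) (by linarith)
        · have : 0 ≤ 1 - t := by linarith
          positivity
    _ = _ := by
        have hs := Real.sq_sqrt hm.le
        have hs0 := Real.sqrt_pos.2 hm
        field_simp
        rw [hs]

theorem hasSum_sumConnector_right {t : ℝ} (ht : t ≤ 1 / 4) (n k : ℕ) :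
    HasSum (fun m : ℕ => sumConnector t (n + 1) (m + 1)
        * (((m : ℝ) + 1 - t)⁻¹ * esymmShift t m k)) (((n : ℝ) + 1)⁻¹ ^ (k + 1)) := by
  have ht1 : t < 1 := by linarith
  have hstep : ∀ m : ℕ, sumConnector t (n + 1) (m + 1) * ((m : ℝ) + 1 - t)⁻¹
      = ((n : ℝ) + 1)⁻¹ * (sumConnector t (n + 1) m - sumConnector t (n + 1) (m + 1)) := by
    intro m
    have h1 := add_one_sub_pos ht1 m
    have h2 := add_one_add_sub_pos ht1 m (n + 1)
    rw [sumConnector_succ_right]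
    push_cast at h2 ⊢
    field_simp
    ring
  rw [hasSum_iff_tendsto_nat_of_nonneg fun m =>
    mul_nonneg (sumConnector_pos ht1 _ _).le (mul_nonneg (inv_pos.2 (add_one_sub_pos ht1 m)).le
      (esymmShift_nonneg ht1 _ _))]
  induction k with
  | zero =>
    have hpart : ∀ N : ℕ, ∑ m ∈ Finset.range N, sumConnector t (n + 1) (m + 1)
        * (((m : ℝ) + 1 - t)⁻¹ * esymmShift t m 0)
          = ((n : ℝ) + 1)⁻¹ * (1 - sumConnector t (n + 1) N * esymmShift t N 0) := by
      intro N
      induction N with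
      | zero => simp [sumConnector]
      | succ N ih =>
        rw [Finset.sum_range_succ, ih, ← mul_assoc, hstep]
        simp only [esymmShift_zero_right]
        ring
    simp only [hpart]
    simpa using ((tendsto_const_nhds (x := (1 : ℝ))).sub
      (tendsto_sumConnector_mul_esymmShift ht n 0)).const_mul ((n : ℝ) + 1)⁻¹
  | succ k ihk =>
    have hpart : ∀ N : ℕ, ∑ m ∈ Finset.range N, sumConnector t (n + 1) (m + 1)
        * (((m : ℝ) + 1 - t)⁻¹ * esymmShift t m (k + 1))
          = ((n : ℝ) + 1)⁻¹ * (∑ m ∈ Finset.range N, sumConnector t (n + 1) (m + 1)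
            * (((m : ℝ) + 1 - t)⁻¹ * esymmShift t m k)
              - sumConnector t (n + 1) N * esymmShift t N (k + 1)) := by
      intro N
      induction N with
      | zero => simp
      | succ N ih =>
        rw [Finset.sum_range_succ, ih, ← mul_assoc, hstep, Finset.sum_range_succ,
          esymmShift_succ_succ]
        ring
    simp only [hpart]
    simpa [pow_succ'] using
      (ihk.sub (tendsto_sumConnector_mul_esymmShift ht n (k + 1))).const_mul ((n : ℝ) + 1)⁻¹

/-- The generating function of the sum formula for multiple zeta values of depth `k + 1`. -/
theorem hasSum_sum_formula {t : ℝ} (ht : t ≤ 1 / 4) (k : ℕ) {s : ℝ}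
    (hs : HasSum (fun n : ℕ => ((n : ℝ) + 1 - t)⁻¹ * ((n : ℝ) + 1)⁻¹ ^ (k + 1)) s) :
    HasSum (fun m : ℕ => ((m : ℝ) + 1)⁻¹ * (((m : ℝ) + 1 - t)⁻¹ * esymmShift t m k)) s := by
  have ht1 : t < 1 := by linarith
  refine hasSum_comm_of_nonneg (f := fun n m : ℕ => ((n : ℝ) + 1 - t)⁻¹
    * sumConnector t (n + 1) (m + 1) * (((m : ℝ) + 1 - t)⁻¹ * esymmShift t m k))
    (fun n m => ?_) (fun n => ?_) (fun m => ?_) hs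
  · exact mul_nonneg (mul_nonneg (inv_pos.2 (add_one_sub_pos ht1 n)).le
      (sumConnector_pos ht1 _ _).le)
      (mul_nonneg (inv_pos.2 (add_one_sub_pos ht1 m)).le (esymmShift_nonneg ht1 _ _))
  · simpa only [mul_assoc] using (hasSum_sumConnector_right ht n k).mul_left _
  · exact (hasSum_sumConnector_left ht1 m).mul_right _

/-- The coefficients of the binomial series `(1 - X) ^ y`. -/
noncomputable def binomCoeff (y : ℝ) (n : ℕ) : ℝ :=
  ∏ k ∈ Finset.range n, (((k : ℝ) - y) / ((k : ℝ) + 1))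

theorem binomCoeff_zero (y : ℝ) : binomCoeff y 0 = 1 := rfl

theorem binomCoeff_succ (y : ℝ) (n : ℕ) :
    binomCoeff y (n + 1) = binomCoeff y n * (((n : ℝ) - y) / ((n : ℝ) + 1)) :=
  Finset.prod_range_succ _ _

theorem binomCoeff_succ_mul (y : ℝ) (n : ℕ) :
    binomCoeff y (n + 1) * ((n : ℝ) + 1) = binomCoeff y n * ((n : ℝ) - y) := by
  have : (n : ℝ) + 1 ≠ 0 := by positivity
  rw [binomCoeff_succ]; field_simp

/-- The coefficients of the hypergeometric series `₂F₁(-t, -y; 1 - t; X)`. -/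
noncomputable def gaussCoeff (t y : ℝ) (n : ℕ) : ℝ :=
  binomCoeff y n * (1 - n / ((n : ℝ) - t))

theorem gaussCoeff_zero (t y : ℝ) : gaussCoeff t y 0 = 1 := by
  simp [gaussCoeff, binomCoeff_zero]

theorem gaussCoeff_mul {t : ℝ} (y : ℝ) {n : ℕ} (h : (n : ℝ) - t ≠ 0) :
    gaussCoeff t y n * ((n : ℝ) - t) = -t * binomCoeff y n := by
  rw [gaussCoeff]; field_simp; ring

open PowerSeries in
theorem one_sub_X_mul_derivative_binom (y : ℝ) :
    (1 - X) * d⁄dX ℝ (mk (binomCoeff y)) = -(C y) * mk (binomCoeff y) := by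
  ext n
  cases n with
  | zero =>
    rw [sub_mul, one_mul, map_sub, coeff_zero_X_mul, coeff_derivative]
    simp [binomCoeff_succ, binomCoeff_zero]
  | succ n =>
    rw [sub_mul, one_mul, map_sub, coeff_succ_X_mul, neg_mul, map_neg, coeff_C_mul]
    simp only [coeff_derivative, coeff_mk]
    have h1 := binomCoeff_succ_mul y (n + 1)
    have h2 := binomCoeff_succ_mul y n
    push_cast at h1 ⊢
    linear_combination h1

open PowerSeries in
theorem binom_mul_binom_neg (y : ℝ) :
    (mk (binomCoeff y) : ℝ⟦X⟧) * mk (binomCoeff (-y)) = 1 := by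
  have h0 : (1 - X : ℝ⟦X⟧) ≠ 0 := fun h => by
    have := congrArg (coeff 0) h
    simp at this
  refine PowerSeries.derivative.ext ?_ ?_
  · apply mul_left_cancel₀ h0
    have h1 := one_sub_X_mul_derivative_binom y
    have h2 := one_sub_X_mul_derivative_binom (-y)
    rw [map_neg, neg_neg] at h2
    rw [Derivation.leibniz, Derivation.map_one_eq_zero, smul_eq_mul, smul_eq_mul]
    linear_combination mk (binomCoeff y) * h2 + mk (binomCoeff (-y)) * h1
  · simp [binomCoeff_zero]

open PowerSeries in
theorem X_mul_derivative_gauss {t : ℝ} (y : ℝ) (h : ∀ n : ℕ, (n : ℝ) - t ≠ 0) :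
    X * d⁄dX ℝ (mk (gaussCoeff t y)) = C t * mk (gaussCoeff t y) - C t * mk (binomCoeff y) := by
  ext n
  have hn := gaussCoeff_mul y (h n)
  rw [map_sub, coeff_C_mul, coeff_C_mul, coeff_mk, coeff_mk]
  cases n with
  | zero => simp [gaussCoeff_zero, binomCoeff_zero]
  | succ n =>
    rw [coeff_succ_X_mul, coeff_derivative, coeff_mk]
    push_cast at hn
    linear_combination hn

open PowerSeries in
/-- Coefficients of Euler's transformation of `₂F₁(-t, y; 1 - t; X)`. -/
theorem coeff_binom_mul_gauss {t : ℝ} (y : ℝ) (h : ∀ n : ℕ, (n : ℝ) - t ≠ 0) (m : ℕ) :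
    coeff (m + 1) (mk (binomCoeff y) * mk (gaussCoeff t (-y)))
      = -y * ((m : ℝ) + 1 - t)⁻¹
        * ∏ k ∈ Finset.range m, (1 + -y * ((k : ℝ) + 1 - t)⁻¹) := by
  set F : ℝ⟦X⟧ := mk (binomCoeff y) * mk (gaussCoeff t (-y)) with hF
  have hF0 : coeff 0 F = 1 := by simp [hF, binomCoeff_zero, gaussCoeff_zero]
  have hode : (1 - X) * (X * d⁄dX ℝ F) = C t * F - X * (C t * F) - C t + X * C t
      - X * (C y * F) := by
    have h1 := one_sub_X_mul_derivative_binom y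
    have h2 := X_mul_derivative_gauss (-y) h
    have h3 := binom_mul_binom_neg y
    rw [hF, Derivation.leibniz, smul_eq_mul, smul_eq_mul]
    linear_combination (1 - X) * mk (binomCoeff y) * h2 + X * mk (gaussCoeff t (-y)) * h1
      - (1 - X) * C t * h3
  have hne : ∀ n : ℕ, (n : ℝ) + 1 - t ≠ 0 := fun n => by simpa using h (n + 1)
  induction m with
  | zero =>
    have := congrArg (coeff (0 + 1)) hode
    rw [sub_mul, one_mul] at this
    simp only [map_sub, map_add, coeff_succ_X_mul, coeff_C_mul, coeff_derivative, hF0] at this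
    simp only [coeff_zero_X_mul, coeff_zero_C, coeff_succ_C, Nat.cast_zero] at this
    have h0 := hne 0
    simp only [Nat.cast_zero] at h0
    simp only [Finset.range_zero, Finset.prod_empty, Nat.cast_zero]
    field_simp
    linear_combination this
  | succ m ih =>
    have := congrArg (coeff (m + 1 + 1)) hode
    rw [sub_mul, one_mul] at this
    simp only [map_sub, map_add, coeff_succ_X_mul, coeff_C_mul, coeff_derivative,
      coeff_succ_C] at this
    rw [ih] at this
    have h1 := hne (m + 1)
    have h0 := hne m
    rw [Finset.prod_range_succ]
    push_cast at this h1 ⊢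
    generalize ∏ k ∈ Finset.range m, (1 + -y * ((k : ℝ) + 1 - t)⁻¹) = P at *
    rw [← mul_left_inj' h1]
    field_simp at this ⊢
    linear_combination this

open PowerSeries in
theorem coeff_gauss_mul_gauss {t : ℝ} (y : ℝ) (h : ∀ n : ℕ, (n : ℝ) - t ≠ 0) (m : ℕ) :
    coeff (m + 1) (mk (gaussCoeff t y) * mk (gaussCoeff t (-y))) * ((m : ℝ) + 1 - 2 * t)
      = -(t * y * ((m : ℝ) + 1 - t)⁻¹
        * (∏ k ∈ Finset.range m, (1 + y * ((k : ℝ) + 1 - t)⁻¹)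
          - ∏ k ∈ Finset.range m, (1 + -y * ((k : ℝ) + 1 - t)⁻¹))) := by
  have hode : X * d⁄dX ℝ (mk (gaussCoeff t y) * mk (gaussCoeff t (-y)))
      = C (2 * t) * (mk (gaussCoeff t y) * mk (gaussCoeff t (-y)))
        - C t * (mk (binomCoeff y) * mk (gaussCoeff t (-y)))
        - C t * (mk (binomCoeff (-y)) * mk (gaussCoeff t (- -y))) := by
    have h1 := X_mul_derivative_gauss y h
    have h2 := X_mul_derivative_gauss (-y) h
    rw [Derivation.leibniz, smul_eq_mul, smul_eq_mul, map_mul, neg_neg]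
    have h3 : (C 2 : ℝ⟦X⟧) = 2 := map_ofNat _ _
    rw [h3]
    linear_combination mk (gaussCoeff t y) * h2 + mk (gaussCoeff t (-y)) * h1
  have := congrArg (coeff (m + 1)) hode
  simp only [map_sub, coeff_succ_X_mul, coeff_C_mul, coeff_derivative] at this
  rw [coeff_binom_mul_gauss y h, coeff_binom_mul_gauss (-y) h] at this
  simp only [neg_neg] at this
  linear_combination this

theorem abs_binomCoeff_mul_sqrt_le {y : ℝ} (hy : |y| ≤ 1 / 4) (n : ℕ) :
    |binomCoeff y n| * Real.sqrt ((n : ℝ) + 1) ≤ 1 := by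
  induction n with
  | zero => simp [binomCoeff_zero]
  | succ n ih =>
    have hn : (0 : ℝ) ≤ n := n.cast_nonneg
    rw [binomCoeff_succ, abs_mul, abs_div, abs_of_pos (show (0 : ℝ) < n + 1 by positivity),
      mul_assoc]
    refine le_trans (mul_le_mul_of_nonneg_left ?_ (abs_nonneg _)) ih
    have h1 : |(n : ℝ) - y| ≤ n + 1 / 4 := by
      rw [abs_le] at hy ⊢
      constructor <;> linarith
    refine Real.le_sqrt_of_sq_le ?_
    push_cast
    rw [mul_pow, Real.sq_sqrt (by positivity), div_pow, div_mul_eq_mul_div,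
      div_le_iff₀ (by positivity)]
    have h2 : |(n : ℝ) - y| ^ 2 ≤ (n + 1 / 4) ^ 2 := by gcongr
    nlinarith

theorem abs_binomCoeff_le {y : ℝ} (hy : |y| ≤ 1 / 4) (n : ℕ) :
    |binomCoeff y n| ≤ 1 / Real.sqrt ((n : ℝ) + 1) := by
  rw [le_div_iff₀ (Real.sqrt_pos.2 (by positivity))]
  exact abs_binomCoeff_mul_sqrt_le hy n

theorem tendsto_binomCoeff {y : ℝ} (hy : |y| ≤ 1 / 4) :
    Filter.Tendsto (binomCoeff y) Filter.atTop (nhds 0) := by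
  refine squeeze_zero_norm (abs_binomCoeff_le hy) ?_
  exact (Real.tendsto_sqrt_atTop.comp
    (tendsto_natCast_atTop_atTop.atTop_add tendsto_const_nhds)).const_div_atTop _

theorem summable_norm_gaussCoeff {t y : ℝ} (ht : t ≤ 1 / 4) (hy : |y| ≤ 1 / 4) :
    Summable (fun n => ‖gaussCoeff t y n‖) := by
  rw [← summable_nat_add_iff 1]
  refine Summable.of_nonneg_of_le (fun n => norm_nonneg _) (fun n => ?_)
    (summable_sqrt_div_sq.mul_left (2 * |t|))
  have hn : (0 : ℝ) ≤ n := n.cast_nonneg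
  have hpos := add_one_sub_pos (show t < 1 by linarith) n
  have hne : ((n + 1 : ℕ) : ℝ) - t ≠ 0 := by push_cast; exact hpos.ne'
  have h1 : gaussCoeff t y (n + 1) = -t * binomCoeff y (n + 1) * ((n : ℝ) + 1 - t)⁻¹ := by
    rw [← gaussCoeff_mul y hne]; push_cast at hne ⊢; field_simp
  have hs : 0 < Real.sqrt ((n : ℝ) + 1) := Real.sqrt_pos.2 (by positivity)
  have h2 : |binomCoeff y (n + 1)| ≤ 1 / Real.sqrt ((n : ℝ) + 1) := by
    refine (abs_binomCoeff_le hy (n + 1)).trans ?_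
    refine one_div_le_one_div_of_le hs (Real.sqrt_le_sqrt ?_)
    push_cast; linarith
  rw [h1, Real.norm_eq_abs, abs_mul, abs_mul, abs_neg, abs_of_pos (inv_pos.2 hpos)]
  calc |t| * |binomCoeff y (n + 1)| * ((n : ℝ) + 1 - t)⁻¹
      ≤ |t| * (1 / Real.sqrt ((n : ℝ) + 1)) * (2 * ((n : ℝ) + 1)⁻¹) := by
        gcongr
        exact sub_inv_le (by linarith) n
    _ = _ := by
        have := Real.sq_sqrt (show (0 : ℝ) ≤ n + 1 by positivity)
        field_simp
        rw [this]

theorem summable_gaussCoeff {t y : ℝ} (ht : t ≤ 1 / 4) (hy : |y| ≤ 1 / 4) :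
    Summable (gaussCoeff t y) :=
  (summable_norm_gaussCoeff ht hy).of_norm

/-- The value `₂F₁(-t, -y; 1 - t; 1)`. -/
noncomputable def hypSum (t y : ℝ) : ℝ := ∑' n, gaussCoeff t y n

/-- The contiguity relation behind Gauss's summation theorem. -/
theorem hypSum_contiguous {t y : ℝ} (ht : t ≤ 1 / 4) (hy : |y| ≤ 1 / 4) :
    (1 - t) * hypSum t y = (1 - t + y) * hypSum (t - 1) y := by
  have h1 := (summable_gaussCoeff ht hy).hasSum.mul_left (1 - t)
  have h2 := (summable_gaussCoeff (show t - 1 ≤ 1 / 4 by linarith) hy).hasSum.mul_left (1 - t + y)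
  have h3 := (h1.sub h2).tendsto_sum_nat
  have hpart : ∀ N : ℕ, ∑ n ∈ Finset.range N,
      ((1 - t) * gaussCoeff t y n - (1 - t + y) * gaussCoeff (t - 1) y n)
        = (1 - t) * (binomCoeff y N * (N / ((N : ℝ) - t))) := by
    intro N
    induction N with
    | zero => simp
    | succ N ih =>
      have hp := add_one_sub_pos (show t < 1 by linarith) N
      rw [Finset.sum_range_succ, ih, binomCoeff_succ, gaussCoeff, gaussCoeff]
      have e1 : (N : ℝ) - (t - 1) = N + 1 - t := by ring
      have hN : (N : ℝ) + 1 ≠ 0 := by positivity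
      rw [e1]
      push_cast
      field_simp
      ring
  simp only [hpart] at h3
  have hb : Filter.Tendsto (fun N : ℕ => (N : ℝ) / ((N : ℝ) - t)) Filter.atTop (nhds 1) := by
    simpa [sub_eq_add_neg] using tendsto_natCast_div_add_atTop (-t)
  have h4 := ((tendsto_binomCoeff hy).mul hb).const_mul (1 - t)
  have h5 := tendsto_nhds_unique h3 h4
  simp only [zero_mul, mul_zero] at h5
  exact sub_eq_zero.1 h5

theorem hypSum_eq_prod_mul {t y : ℝ} (ht : t ≤ 1 / 4) (hy : |y| ≤ 1 / 4)
    (M : ℕ) :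
    hypSum t y
      = (∏ k ∈ Finset.range M, (1 + y * ((k : ℝ) + 1 - t)⁻¹)) * hypSum (t - M) y := by
  induction M with
  | zero => simp
  | succ M ih =>
    have hM : (0 : ℝ) ≤ M := M.cast_nonneg
    have h := hypSum_contiguous (show t - M ≤ 1 / 4 by linarith) hy
    have hp := add_one_sub_pos (show t < 1 by linarith) M
    rw [ih, Finset.prod_range_succ, mul_assoc]
    congr 1
    have e : t - ((M + 1 : ℕ) : ℝ) = t - M - 1 := by push_cast; ring
    rw [e]
    field_simp
    linear_combination h

theorem hypSum_zero (y : ℝ) : hypSum 0 y = 1 := by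
  rw [hypSum, tsum_eq_single 0]
  · exact gaussCoeff_zero 0 y
  · intro n hn
    have : (n : ℝ) ≠ 0 := by exact_mod_cast hn
    rw [gaussCoeff, sub_zero, div_self this, sub_self, mul_zero]

theorem binomCoeff_nonneg {y : ℝ} (h0 : y ≤ 0) (n : ℕ) : 0 ≤ binomCoeff y n :=
  Finset.prod_nonneg fun k _ => by
    have : (0 : ℝ) ≤ k := k.cast_nonneg
    exact div_nonneg (by linarith) (by linarith)

theorem binomCoeff_succ_nonpos {y : ℝ} (h0 : 0 ≤ y) (h1 : y ≤ 1) (n : ℕ) :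
    binomCoeff y (n + 1) ≤ 0 := by
  rw [binomCoeff, Finset.prod_range_succ']
  refine mul_nonpos_of_nonneg_of_nonpos (Finset.prod_nonneg fun k _ => ?_) ?_
  · have : (0 : ℝ) ≤ k := k.cast_nonneg
    push_cast
    exact div_nonneg (by linarith) (by linarith)
  · simpa using h0

theorem one_sub_div_anti {s t : ℝ} (hst : s ≤ t) (ht : t < 1) (n : ℕ) :
    1 - ((n + 1 : ℕ) : ℝ) / (((n + 1 : ℕ) : ℝ) - t)
      ≤ 1 - ((n + 1 : ℕ) : ℝ) / (((n + 1 : ℕ) : ℝ) - s) := by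
  have h := add_one_sub_pos ht n
  have h' := add_one_sub_pos (hst.trans_lt ht) n
  push_cast
  gcongr

theorem hypSum_le_of_nonpos {s t y : ℝ} (hst : s ≤ t) (ht : t ≤ 1 / 4) (hy : |y| ≤ 1 / 4)
    (h0 : y ≤ 0) : hypSum t y ≤ hypSum s y := by
  refine (summable_gaussCoeff ht hy).tsum_le_tsum (fun n => ?_)
    (summable_gaussCoeff (hst.trans ht) hy)
  cases n with
  | zero => rw [gaussCoeff_zero, gaussCoeff_zero]
  | succ n =>
    exact mul_le_mul_of_nonneg_left (one_sub_div_anti hst (by linarith) n)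
      (binomCoeff_nonneg h0 _)

theorem hypSum_le_of_nonneg {s t y : ℝ} (hst : s ≤ t) (ht : t ≤ 1 / 4) (hy : |y| ≤ 1 / 4)
    (h0 : 0 ≤ y) : hypSum s y ≤ hypSum t y := by
  refine (summable_gaussCoeff (hst.trans ht) hy).tsum_le_tsum (fun n => ?_)
    (summable_gaussCoeff ht hy)
  cases n with
  | zero => rw [gaussCoeff_zero, gaussCoeff_zero]
  | succ n =>
    exact mul_le_mul_of_nonpos_left (one_sub_div_anti hst (by linarith) n)
      (binomCoeff_succ_nonpos h0 ((le_abs_self y).trans (hy.trans (by norm_num))) _)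

theorem hypSum_neg_nat_pos {y : ℝ} (hy : |y| ≤ 1 / 4) (M : ℕ) : 0 < hypSum (-M) y := by
  have h := hypSum_eq_prod_mul (show (0 : ℝ) ≤ 1 / 4 by norm_num) hy M
  rw [hypSum_zero, zero_sub] at h
  refine pos_of_mul_pos_right (h ▸ one_pos) (Finset.prod_nonneg fun k _ => ?_)
  have hk : (1 : ℝ) ≤ k + 1 - 0 := by simp
  have h1 : ((k : ℝ) + 1 - 0)⁻¹ ≤ 1 := inv_le_one_of_one_le₀ hk
  have h2 : (0 : ℝ) ≤ ((k : ℝ) + 1 - 0)⁻¹ := by positivity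
  rw [abs_le] at hy
  nlinarith

theorem abs_hypSum_div_sub_one_le {t y : ℝ} (ht0 : 0 ≤ t) (ht : t ≤ 1 / 4) (hy : |y| ≤ 1 / 4) (M : ℕ) :
    |hypSum (t - (M + 1 : ℕ)) y / hypSum (-(M + 1 : ℕ)) y - 1| ≤ 1 / ((M : ℝ) + 1) := by
  have hM : (0 : ℝ) ≤ M := M.cast_nonneg
  have hpos := hypSum_neg_nat_pos hy (M + 1)
  have hc := hypSum_contiguous (show -(M : ℝ) ≤ 1 / 4 by linarith) hy
  have e : -(M : ℝ) - 1 = -((M + 1 : ℕ) : ℝ) := by push_cast; ring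
  rw [e] at hc
  have h1 : hypSum (-M) y = (1 + y / ((M : ℝ) + 1)) * hypSum (-(M + 1 : ℕ)) y := by
    field_simp
    linear_combination hc
  have hle1 : -((M + 1 : ℕ) : ℝ) ≤ t - (M + 1 : ℕ) := by linarith
  have hle2 : t - (M + 1 : ℕ) ≤ -(M : ℝ) := by push_cast; linarith
  have hy' := abs_le.1 hy
  have hb : |y / ((M : ℝ) + 1)| ≤ 1 / ((M : ℝ) + 1) := by
    rw [abs_div, abs_of_pos (show (0 : ℝ) < M + 1 by positivity)]
    gcongr
    linarith
  rw [abs_le] at hb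
  have hd : (0 : ℝ) ≤ 1 / ((M : ℝ) + 1) := by positivity
  rcases le_total y 0 with h0 | h0
  · have a := hypSum_le_of_nonpos hle1 (by linarith) hy h0
    have b := hypSum_le_of_nonpos hle2 (by linarith) hy h0
    rw [h1, ← le_div_iff₀ hpos] at b
    rw [← div_le_one hpos] at a
    rw [abs_le]; constructor <;> linarith
  · have a := hypSum_le_of_nonneg hle1 (by linarith) hy h0
    have b := hypSum_le_of_nonneg hle2 (by linarith) hy h0
    rw [h1, ← div_le_iff₀ hpos] at b
    rw [← one_le_div hpos] at a
    rw [abs_le]; constructor <;> linarith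

/-- Gauss's summation theorem, as an infinite product. -/
theorem tendsto_prod_hypSum {t y : ℝ} (ht0 : 0 ≤ t) (ht : t ≤ 1 / 4) (hy : |y| ≤ 1 / 4) :
    Filter.Tendsto (fun M : ℕ => (∏ k ∈ Finset.range M, (1 + y * ((k : ℝ) + 1 - t)⁻¹))
      / ∏ k ∈ Finset.range M, (1 + y * ((k : ℝ) + 1)⁻¹)) Filter.atTop (nhds (hypSum t y)) := by
  have hr : Filter.Tendsto
      (fun M : ℕ => hypSum (t - (M + 1 : ℕ)) y / hypSum (-(M + 1 : ℕ)) y)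
      Filter.atTop (nhds 1) := by
    rw [tendsto_iff_norm_sub_tendsto_zero]
    exact squeeze_zero (fun _ => norm_nonneg _) (fun M => abs_hypSum_div_sub_one_le ht0 ht hy M)
      tendsto_one_div_add_atTop_nhds_zero_nat
  rw [← Filter.tendsto_add_atTop_iff_nat 1]
  have h := (tendsto_const_nhds (x := hypSum t y)).div hr one_ne_zero
  rw [div_one] at h
  refine h.congr' ?_
  have hev : ∀ᶠ M : ℕ in Filter.atTop,
      hypSum (t - (M + 1 : ℕ)) y / hypSum (-(M + 1 : ℕ)) y ≠ 0 :=
    hr.eventually_ne one_ne_zero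
  filter_upwards [hev] with M hM
  have e1 := hypSum_eq_prod_mul ht hy (M + 1)
  have e2 := hypSum_eq_prod_mul (show (0 : ℝ) ≤ 1 / 4 by norm_num) hy (M + 1)
  simp only [hypSum_zero, zero_sub, sub_zero] at e2
  have hpos := hypSum_neg_nat_pos hy (M + 1)
  have hne : hypSum (t - (M + 1 : ℕ)) y ≠ 0 := fun h0 => hM (by rw [h0, zero_div])
  have hp : ∏ k ∈ Finset.range (M + 1), (1 + y * ((k : ℝ) + 1)⁻¹) ≠ 0 := fun h0 => by
    rw [h0, zero_mul] at e2; exact one_ne_zero e2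
  simp only [Pi.div_apply]
  rw [e1]
  generalize ∏ k ∈ Finset.range (M + 1), (1 + y * ((k : ℝ) + 1 - t)⁻¹) = A
  generalize ∏ k ∈ Finset.range (M + 1), (1 + y * ((k : ℝ) + 1)⁻¹) = B at e2 hp ⊢
  field_simp
  linear_combination -A * e2

theorem prod_one_add_sub_prod_one_sub (t y : ℝ) (m : ℕ) :
    ∏ k ∈ Finset.range m, (1 + y * ((k : ℝ) + 1 - t)⁻¹)
        - ∏ k ∈ Finset.range m, (1 + -y * ((k : ℝ) + 1 - t)⁻¹)
      - (2 * y * esymmShift t m 1 + 2 * y ^ 3 * esymmShift t m 3)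
      = ∑ k ∈ Finset.range m, esymmShift t m (k + 5) * (y ^ (k + 5) - (-y) ^ (k + 5)) := by
  rw [prod_one_add_eq_sum_esymmShift t y m (m + 5) (by omega),
    prod_one_add_eq_sum_esymmShift t (-y) m (m + 5) (by omega), ← Finset.sum_sub_distrib]
  simp only [← mul_sub, Finset.sum_range_succ']
  ring

theorem abs_prod_one_add_sub_prod_one_sub_le {t y : ℝ} (ht : t ≤ 1 / 4) (hy0 : 0 ≤ y)
    (hy : y ≤ 1 / 4) (m : ℕ) :
    |∏ k ∈ Finset.range m, (1 + y * ((k : ℝ) + 1 - t)⁻¹)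
        - ∏ k ∈ Finset.range m, (1 + -y * ((k : ℝ) + 1 - t)⁻¹)
      - (2 * y * esymmShift t m 1 + 2 * y ^ 3 * esymmShift t m 3)|
      ≤ 2 * 4 ^ 5 * y ^ 5 * Real.sqrt (m + 1) := by
  have hE := fun k => esymmShift_nonneg (show t < 1 by linarith) m k
  rw [prod_one_add_sub_prod_one_sub]
  have h := prod_one_add_le_sqrt ht m
  rw [prod_one_add_eq_sum_esymmShift t _ m (5 + m) (by omega), Finset.sum_range_add] at h
  have h0 : 0 ≤ ∑ k ∈ Finset.range 5, esymmShift t m k * (1 / 4 : ℝ) ^ k :=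
    Finset.sum_nonneg fun k _ => mul_nonneg (hE k) (by positivity)
  have h1 : ∑ k ∈ Finset.range m, esymmShift t m (5 + k) * (1 / 4 : ℝ) ^ (5 + k)
      ≤ Real.sqrt (m + 1) := by linarith
  refine le_trans ?_ (mul_le_mul_of_nonneg_left h1 (by positivity))
  rw [Finset.mul_sum]
  refine (Finset.abs_sum_le_sum_abs _ _).trans (Finset.sum_le_sum fun k _ => ?_)
  rw [abs_mul, abs_of_nonneg (hE _), add_comm k 5]
  have h2 : |y ^ (5 + k) - (-y) ^ (5 + k)| ≤ 2 * y ^ (5 + k) := by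
    refine (abs_sub _ _).trans_eq ?_
    rw [abs_pow, abs_pow, abs_neg, abs_of_nonneg hy0]
    ring
  have h3 : y ^ (5 + k) ≤ 4 ^ 5 * y ^ 5 * (1 / 4) ^ (5 + k) := by
    have : y ^ k ≤ (1 / 4) ^ k := by gcongr
    calc y ^ (5 + k) = y ^ 5 * y ^ k := pow_add _ _ _
      _ ≤ y ^ 5 * (1 / 4) ^ k := by gcongr
      _ = _ := by rw [pow_add]; ring
  calc _ ≤ esymmShift t m (5 + k) * (2 * (4 ^ 5 * y ^ 5 * (1 / 4) ^ (5 + k))) :=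
        mul_le_mul_of_nonneg_left (by linarith) (hE _)
    _ = _ := by ring

/-- The weight `1 / (m - 2t) - 1 / (m - t)`, with `m` shifted by one. -/
noncomputable def weightDiff (t : ℝ) (m : ℕ) : ℝ :=
  t * ((m : ℝ) + 1 - t)⁻¹ * ((m : ℝ) + 1 - 2 * t)⁻¹

theorem weightDiff_nonneg {t : ℝ} (ht0 : 0 ≤ t) (ht : t ≤ 1 / 4) (m : ℕ) :
    0 ≤ weightDiff t m := by
  have h1 := add_one_sub_pos (show t < 1 by linarith) m
  have h2 := add_one_sub_pos (show 2 * t < 1 by linarith) m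
  unfold weightDiff
  positivity

theorem summable_weightDiff_mul_sqrt {t : ℝ} (ht0 : 0 ≤ t) (ht : t ≤ 1 / 4) :
    Summable (fun m : ℕ => weightDiff t m * Real.sqrt (m + 1)) := by
  refine Summable.of_nonneg_of_le
    (fun m => mul_nonneg (weightDiff_nonneg ht0 ht m) (Real.sqrt_nonneg _)) (fun m => ?_)
    (summable_sqrt_div_sq.mul_left (4 * t))
  have h1 := add_one_sub_pos (show t < 1 by linarith) m
  have h2 := add_one_sub_pos (show 2 * t < 1 by linarith) m
  calc weightDiff t m * Real.sqrt (m + 1)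
      ≤ t * (2 * ((m : ℝ) + 1)⁻¹) * (2 * ((m : ℝ) + 1)⁻¹) * Real.sqrt (m + 1) := by
        unfold weightDiff
        gcongr
        · exact sub_inv_le (by linarith) m
        · exact sub_inv_le (by linarith) m
    _ = _ := by
        have : (m : ℝ) + 1 ≠ 0 := by positivity
        field_simp
        norm_num

theorem summable_weightDiff_mul_esymmShift {t : ℝ} (ht0 : 0 ≤ t) (ht : t ≤ 1 / 4) (k : ℕ) :
    Summable (fun m : ℕ => weightDiff t m * esymmShift t m k) := by
  refine Summable.of_nonneg_of_le (fun m => mul_nonneg (weightDiff_nonneg ht0 ht m)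
    (esymmShift_nonneg (by linarith) m k)) (fun m => ?_)
    ((summable_weightDiff_mul_sqrt ht0 ht).mul_left (4 ^ k))
  rw [mul_left_comm]
  exact mul_le_mul_of_nonneg_left (esymmShift_le_sqrt ht m k) (weightDiff_nonneg ht0 ht m)

theorem hasSum_hypSum_mul_hypSum_neg {t y : ℝ} (ht0 : 0 < t) (ht : t ≤ 1 / 4)
    (hy : |y| ≤ 1 / 4) :
    HasSum (fun m : ℕ => -(y * (weightDiff t m
        * (∏ k ∈ Finset.range m, (1 + y * ((k : ℝ) + 1 - t)⁻¹)
          - ∏ k ∈ Finset.range m, (1 + -y * ((k : ℝ) + 1 - t)⁻¹)))))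
      (hypSum t y * hypSum t (-y) - 1) := by
  have hy' : |-y| ≤ 1 / 4 := by rwa [abs_neg]
  have hs1 := summable_norm_gaussCoeff ht hy
  have hs2 := summable_norm_gaussCoeff ht hy'
  have hsum := (summable_norm_sum_mul_antidiagonal_of_summable_norm hs1 hs2).of_norm
  have hW := tsum_mul_tsum_eq_tsum_sum_antidiagonal_of_summable_norm hs1 hs2
  have hne : ∀ n : ℕ, (n : ℝ) - t ≠ 0 := by
    intro n
    cases n with
    | zero => simpa using ht0.ne'
    | succ n =>
      have := add_one_sub_pos (show t < 1 by linarith) n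
      push_cast; exact this.ne'
  have h := (hasSum_nat_add_iff' 1).2 (hW ▸ hsum.hasSum)
  simp only [Finset.range_one, Finset.sum_singleton, Finset.Nat.antidiagonal_zero,
    gaussCoeff_zero, mul_one] at h
  refine h.congr_fun fun m => ?_
  have hc := coeff_gauss_mul_gauss y hne m
  have h2 := add_one_sub_pos (show 2 * t < 1 by linarith) m
  rw [PowerSeries.coeff_mul, ← eq_div_iff h2.ne'] at hc
  simp only [PowerSeries.coeff_mk] at hc
  rw [hc, weightDiff]
  ring

theorem exists_abs_hypSum_mul_sub_le {t : ℝ} (ht0 : 0 < t) (ht : t ≤ 1 / 4) :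
    ∃ K : ℝ, ∀ y : ℝ, 0 ≤ y → y ≤ 1 / 4 →
      |hypSum t y * hypSum t (-y) - (1 - 2 * y ^ 2 * ∑' m, weightDiff t m * esymmShift t m 1
        - 2 * y ^ 4 * ∑' m, weightDiff t m * esymmShift t m 3)| ≤ K * y ^ 6 := by
  have hS := (summable_weightDiff_mul_sqrt ht0.le ht).hasSum
  refine ⟨2 * 4 ^ 5 * ∑' m : ℕ, weightDiff t m * Real.sqrt (m + 1), fun y hy0 hy => ?_⟩
  have hW := hasSum_hypSum_mul_hypSum_neg ht0 ht (abs_le.2 ⟨by linarith, hy⟩)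
  have h1 := (summable_weightDiff_mul_esymmShift ht0.le ht 1).hasSum
  have h3 := (summable_weightDiff_mul_esymmShift ht0.le ht 3).hasSum
  have hd := (hW.add (h1.mul_left (2 * y ^ 2))).add (h3.mul_left (2 * y ^ 4))
  have hb := hS.mul_left (2 * 4 ^ 5 * y ^ 6)
  have hle : ∀ m, ‖_‖ ≤ _ := fun m => by
    have h := abs_prod_one_add_sub_prod_one_sub_le ht hy0 hy m
    have hw := weightDiff_nonneg ht0.le ht m
    calc ‖-(y * (weightDiff t m
        * (∏ k ∈ Finset.range m, (1 + y * ((k : ℝ) + 1 - t)⁻¹)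
          - ∏ k ∈ Finset.range m, (1 + -y * ((k : ℝ) + 1 - t)⁻¹))))
          + 2 * y ^ 2 * (weightDiff t m * esymmShift t m 1)
          + 2 * y ^ 4 * (weightDiff t m * esymmShift t m 3)‖
        = y * (weightDiff t m * |∏ k ∈ Finset.range m, (1 + y * ((k : ℝ) + 1 - t)⁻¹)
        - ∏ k ∈ Finset.range m, (1 + -y * ((k : ℝ) + 1 - t)⁻¹)
      - (2 * y * esymmShift t m 1 + 2 * y ^ 3 * esymmShift t m 3)|) := by
          rw [← abs_of_nonneg hw, ← abs_mul, abs_of_nonneg hw, ← abs_of_nonneg hy0, ← abs_mul,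
            abs_of_nonneg hy0, Real.norm_eq_abs, ← abs_neg]
          congr 1
          ring
      _ ≤ y * (weightDiff t m * (2 * 4 ^ 5 * y ^ 5 * Real.sqrt (m + 1))) := by gcongr
      _ = 2 * 4 ^ 5 * y ^ 6 * (weightDiff t m * Real.sqrt (m + 1)) := by ring
  have := tsum_of_norm_bounded hb hle
  rw [hd.tsum_eq, Real.norm_eq_abs] at this
  convert this using 1
  · congr 1; ring
  · ring

theorem abs_log_one_sub_add_le {x : ℝ} (h0 : 0 ≤ x) (h : x ≤ 1 / 2) :
    |Real.log (1 - x) + x + x ^ 2 / 2| ≤ 2 * x ^ 3 := by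
  have h1 := Real.abs_log_sub_add_sum_range_le (show |x| < 1 by rw [abs_of_nonneg h0]; linarith) 2
  rw [abs_of_nonneg h0] at h1
  simp only [Finset.sum_range_succ, Finset.sum_range_zero] at h1
  norm_num at h1
  refine (le_of_eq_of_le ?_ h1).trans ?_
  · congr 1; ring
  · rw [div_le_iff₀ (by linarith)]
    nlinarith [pow_nonneg h0 3]

theorem summable_inv_sub_pow {t : ℝ} (ht : t ≤ 1 / 4) {k : ℕ} (hk : 2 ≤ k) :
    Summable (fun n : ℕ => ((n : ℝ) + 1 - t)⁻¹ ^ k) := by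
  have h := ((summable_nat_add_iff 1).2
    (Real.summable_nat_pow_inv.2 (show 1 < k by omega))).mul_left
    (2 ^ k)
  refine Summable.of_nonneg_of_le (fun n => ?_) (fun n => ?_) h
  · exact pow_nonneg (inv_pos.2 (add_one_sub_pos (by linarith) n)).le _
  · rw [← inv_pow, ← mul_pow]
    push_cast
    exact pow_le_pow_left₀ (inv_pos.2 (add_one_sub_pos (by linarith) n)).le
      (sub_inv_le (by linarith) n) k

theorem sq_mul_inv_sub_le {t y : ℝ} (ht : t ≤ 1 / 4) (hy0 : 0 ≤ y) (hy : y ≤ 1 / 4) (n : ℕ) :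
    y ^ 2 * ((n : ℝ) + 1 - t)⁻¹ ^ 2 ≤ 1 / 4 := by
  have hn : (0 : ℝ) ≤ n := n.cast_nonneg
  have hv : ((n : ℝ) + 1)⁻¹ ≤ 1 := inv_le_one_of_one_le₀ (by linarith)
  have hu := sub_inv_le (show t ≤ 1 / 2 by linarith) n
  have hu0 := (inv_pos.2 (add_one_sub_pos (show t < 1 by linarith) n)).le
  rw [← mul_pow]
  calc (y * ((n : ℝ) + 1 - t)⁻¹) ^ 2 ≤ (1 / 4 * 2) ^ 2 := by
        gcongr; linarith
    _ = _ := by norm_num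

/-- The second order expansion of `log ∏ (1 - y² / (k - t)²)`. -/
theorem exists_tendsto_exp_log {t : ℝ} (ht : t ≤ 1 / 4) :
    ∃ K : ℝ, ∀ y : ℝ, 0 ≤ y → y ≤ 1 / 4 → ∃ L : ℝ,
      Filter.Tendsto (fun M : ℕ => ∏ k ∈ Finset.range M, (1 - y ^ 2 * ((k : ℝ) + 1 - t)⁻¹ ^ 2))
        Filter.atTop (nhds (Real.exp L)) ∧
      |L + y ^ 2 * (∑' k : ℕ, ((k : ℝ) + 1 - t)⁻¹ ^ 2)
        + y ^ 4 / 2 * (∑' k : ℕ, ((k : ℝ) + 1 - t)⁻¹ ^ 4)| ≤ K * y ^ 6 := by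
  have h2 := (summable_inv_sub_pow ht le_rfl).hasSum
  have h4 := (summable_inv_sub_pow ht (show 2 ≤ 4 by norm_num)).hasSum
  have h6 := (summable_inv_sub_pow ht (show 2 ≤ 6 by norm_num)).hasSum
  refine ⟨2 * ∑' k : ℕ, ((k : ℝ) + 1 - t)⁻¹ ^ 6, fun y hy0 hy => ?_⟩
  have hx := sq_mul_inv_sub_le ht hy0 hy
  have hb : ∀ k : ℕ, ‖Real.log (1 - y ^ 2 * ((k : ℝ) + 1 - t)⁻¹ ^ 2)
      + y ^ 2 * ((k : ℝ) + 1 - t)⁻¹ ^ 2 + y ^ 4 / 2 * ((k : ℝ) + 1 - t)⁻¹ ^ 4‖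
        ≤ 2 * y ^ 6 * ((k : ℝ) + 1 - t)⁻¹ ^ 6 := fun k => by
    have h := abs_log_one_sub_add_le
      (show 0 ≤ y ^ 2 * ((k : ℝ) + 1 - t)⁻¹ ^ 2 by positivity) ((hx k).trans (by norm_num))
    rw [Real.norm_eq_abs]
    convert h using 1
    · congr 1; ring
    · ring
  have hsb := h6.mul_left (2 * y ^ 6)
  have hs := Summable.of_norm_bounded hsb.summable hb
  have hl := (hs.hasSum.sub (h4.mul_left (y ^ 4 / 2))).sub (h2.mul_left (y ^ 2))
  have hlog := hl.congr_fun (g := fun k : ℕ => Real.log (1 - y ^ 2 * ((k : ℝ) + 1 - t)⁻¹ ^ 2))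
    (fun k => by ring)
  refine ⟨_, (hlog.tendsto_sum_nat.rexp).congr fun M => ?_, ?_⟩
  · rw [Real.exp_sum]
    exact Finset.prod_congr rfl fun k _ => Real.exp_log (by linarith [hx k])
  · have := tsum_of_norm_bounded hsb hb
    rw [Real.norm_eq_abs] at this
    convert this using 1
    · congr 1; ring
    · ring

theorem eq_zero_of_abs_mul_sq_add_le {A B K : ℝ}
    (h : ∀ y : ℝ, 0 < y → y ≤ 1 / 4 → |A * y ^ 2 + B * y ^ 4| ≤ K * y ^ 6) : A = 0 ∧ B = 0 := by
  have h1 : ∀ y : ℝ, 0 < y → y ≤ 1 / 4 → |A + B * y ^ 2| ≤ K * y ^ 4 := fun y hy hy' => by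
    have := h y hy hy'
    have e : A * y ^ 2 + B * y ^ 4 = y ^ 2 * (A + B * y ^ 2) := by ring
    rw [e, abs_mul, abs_of_nonneg (by positivity), show K * y ^ 6 = y ^ 2 * (K * y ^ 4) by ring]
      at this
    exact le_of_mul_le_mul_left this (by positivity)
  have hev : ∀ᶠ y : ℝ in nhdsWithin 0 (Set.Ioi 0), 0 < y ∧ y ≤ 1 / 4 := by
    filter_upwards [Ioc_mem_nhdsGT (show (0 : ℝ) < 1 / 4 by norm_num)] with y hy using hy
  have lim : ∀ f : ℝ → ℝ, Continuous f →
      Filter.Tendsto f (nhdsWithin 0 (Set.Ioi 0)) (nhds (f 0)) :=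
    fun f hf => (hf.tendsto 0).mono_left nhdsWithin_le_nhds
  have hA : A = 0 := by
    have := le_of_tendsto_of_tendsto (lim (fun y => |A + B * y ^ 2|) (by fun_prop))
      (lim (fun y => K * y ^ 4) (by fun_prop)) (hev.mono fun y hy => h1 y hy.1 hy.2)
    simpa using this
  refine ⟨hA, ?_⟩
  subst hA
  have h2 : ∀ y : ℝ, 0 < y → y ≤ 1 / 4 → |B| ≤ K * y ^ 2 := fun y hy hy' => by
    have := h1 y hy hy'
    rw [zero_add, abs_mul, abs_of_nonneg (show 0 ≤ y ^ 2 by positivity),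
      show K * y ^ 4 = K * y ^ 2 * y ^ 2 by ring] at this
    exact le_of_mul_le_mul_right this (by positivity)
  have := le_of_tendsto_of_tendsto (lim (fun _ => |B|) (by fun_prop))
      (lim (fun y => K * y ^ 2) (by fun_prop)) (hev.mono fun y hy => h2 y hy.1 hy.2)
  simpa using this

theorem abs_exp_sub_le {D A B K y : ℝ} (hy0 : 0 ≤ y) (hy : y ≤ 1) (hK : 0 ≤ K)
    (hD : |D + y ^ 2 * A + y ^ 4 / 2 * B| ≤ K * y ^ 6) :
    |Real.exp D - (1 - y ^ 2 * A - y ^ 4 / 2 * B + y ^ 4 / 2 * A ^ 2)|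
      ≤ (K + (|A| + |B| + K) ^ 2 + (|A| + |B| + K) ^ 3 * Real.exp (|A| + |B| + K)) * y ^ 6 := by
  set C := |A| + |B| + K with hC
  have hA := abs_nonneg A
  have hB := abs_nonneg B
  have hC0 : 0 ≤ C := by positivity
  have h64 : y ^ 6 ≤ y ^ 4 := pow_le_pow_of_le_one hy0 hy (by norm_num)
  have h42 : y ^ 4 ≤ y ^ 2 := pow_le_pow_of_le_one hy0 hy (by norm_num)
  have h2 : y ^ 2 ≤ 1 := pow_le_one₀ hy0 hy
  have hy4 : 0 ≤ y ^ 4 := by positivity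
  have hy2 : 0 ≤ y ^ 2 := by positivity
  have hDA : |D + y ^ 2 * A| ≤ (|B| + K) * y ^ 4 := by
    have h : D + y ^ 2 * A = (D + y ^ 2 * A + y ^ 4 / 2 * B) - y ^ 4 / 2 * B := by ring
    have hb : |y ^ 4 / 2 * B| = y ^ 4 / 2 * |B| := by
      rw [abs_mul, abs_of_nonneg (by positivity)]
    have := abs_sub (D + y ^ 2 * A + y ^ 4 / 2 * B) (y ^ 4 / 2 * B)
    rw [h]
    nlinarith [mul_le_mul_of_nonneg_left h64 hK, mul_nonneg hy4 hB]
  have ha : |y ^ 2 * A| = y ^ 2 * |A| := by rw [abs_mul, abs_of_nonneg hy2]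
  have hDC : |D| ≤ C * y ^ 2 := by
    have := abs_sub (D + y ^ 2 * A) (y ^ 2 * A)
    rw [add_sub_cancel_right] at this
    have := mul_le_mul_of_nonneg_left h42 (show 0 ≤ |B| + K by positivity)
    nlinarith
  have hsq : |D ^ 2 - (y ^ 2 * A) ^ 2| ≤ 2 * C ^ 2 * y ^ 6 := by
    rw [sq_sub_sq, abs_mul]
    have h1 : |D - y ^ 2 * A| ≤ 2 * C * y ^ 2 := by
      have := abs_sub D (y ^ 2 * A)
      nlinarith [mul_nonneg hy2 hB, mul_nonneg hy2 hK]
    calc _ ≤ (C * y ^ 4) * (2 * C * y ^ 2) := by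
          refine mul_le_mul (hDA.trans ?_) h1 (abs_nonneg _) (by positivity)
          exact mul_le_mul_of_nonneg_right (by linarith) hy4
      _ = _ := by ring
  have hexp : |Real.exp D - (1 + D + D ^ 2 / 2)| ≤ C ^ 3 * Real.exp C * y ^ 6 := by
    have h : |Real.exp D - (1 + D + D ^ 2 / 2)| ≤ |D| ^ 3 * Real.exp |D| := by
      have h := Complex.norm_exp_sub_sum_le_norm_mul_exp (D : ℂ) 3
      have e : Complex.exp D - ∑ m ∈ Finset.range 3, (D : ℂ) ^ m / m.factorial
          = ((Real.exp D - (1 + D + D ^ 2 / 2) : ℝ) : ℂ) := by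
        simp [Finset.sum_range_succ, Nat.factorial]
      rwa [e, Complex.norm_real, Complex.norm_real] at h
    refine h.trans ?_
    have h1 : |D| ≤ C := hDC.trans (mul_le_of_le_one_right hC0 h2)
    calc |D| ^ 3 * Real.exp |D| ≤ (C * y ^ 2) ^ 3 * Real.exp C := by gcongr
      _ = _ := by ring
  rw [abs_le] at *
  constructor <;> nlinarith

/-- The cubic weighted sum in closed form, in terms of power sums. -/
theorem four_mul_tsum_weightDiff_mul_esymmShift {t : ℝ} (ht0 : 0 < t) (ht : t ≤ 1 / 4) :
    4 * ∑' m, weightDiff t m * esymmShift t m 3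
      = (∑' n : ℕ, ((n : ℝ) + 1 - t)⁻¹ ^ 4 - ∑' n : ℕ, ((n : ℝ) + 1)⁻¹ ^ 4)
        - (∑' n : ℕ, ((n : ℝ) + 1 - t)⁻¹ ^ 2 - ∑' n : ℕ, ((n : ℝ) + 1)⁻¹ ^ 2) ^ 2 := by
  obtain ⟨K1, h1⟩ := exists_tendsto_exp_log ht
  obtain ⟨K0, h0⟩ := exists_tendsto_exp_log (show (0 : ℝ) ≤ 1 / 4 by norm_num)
  obtain ⟨K, h⟩ := exists_abs_hypSum_mul_sub_le ht0 ht
  simp only [sub_zero] at h0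
  set A1 := ∑' n : ℕ, ((n : ℝ) + 1 - t)⁻¹ ^ 2
  set A0 := ∑' n : ℕ, ((n : ℝ) + 1)⁻¹ ^ 2
  set B1 := ∑' n : ℕ, ((n : ℝ) + 1 - t)⁻¹ ^ 4
  set B0 := ∑' n : ℕ, ((n : ℝ) + 1)⁻¹ ^ 4
  set H1 := ∑' m, weightDiff t m * esymmShift t m 1
  set H3 := ∑' m, weightDiff t m * esymmShift t m 3
  set J := |K1| + |K0|
  set C := |A1 - A0| + |B1 - B0| + J
  have key := eq_zero_of_abs_mul_sq_add_le (A := 2 * H1 - (A1 - A0))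
    (B := 2 * H3 - (B1 - B0) / 2 + (A1 - A0) ^ 2 / 2)
    (K := K + (J + C ^ 2 + C ^ 3 * Real.exp C)) fun y hy0 hy => ?_
  · linarith [key.2]
  obtain ⟨L1, hL1, hb1⟩ := h1 y hy0.le hy
  obtain ⟨L0, hL0, hb0⟩ := h0 y hy0.le hy
  have hW : hypSum t y * hypSum t (-y) = Real.exp (L1 - L0) := by
    have ha : |y| ≤ 1 / 4 := abs_le.2 ⟨by linarith, hy⟩
    have hT := (tendsto_prod_hypSum ht0.le ht ha).mul
      (tendsto_prod_hypSum ht0.le ht (show |-y| ≤ 1 / 4 by rwa [abs_neg]))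
    refine tendsto_nhds_unique hT ?_
    rw [Real.exp_sub]
    refine (hL1.div hL0 (Real.exp_pos _).ne').congr fun M => ?_
    rw [Pi.div_apply, div_mul_div_comm, ← Finset.prod_mul_distrib, ← Finset.prod_mul_distrib]
    congr 1 <;> exact Finset.prod_congr rfl fun k _ => by ring
  have hD : |(L1 - L0) + y ^ 2 * (A1 - A0) + y ^ 4 / 2 * (B1 - B0)| ≤ J * y ^ 6 := by
    have e : (L1 - L0) + y ^ 2 * (A1 - A0) + y ^ 4 / 2 * (B1 - B0)
      = (L1 + y ^ 2 * A1 + y ^ 4 / 2 * B1) - (L0 + y ^ 2 * A0 + y ^ 4 / 2 * B0) := by ring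
    have hy6 : 0 ≤ y ^ 6 := by positivity
    rw [e, add_mul]
    exact (abs_sub _ _).trans (add_le_add
      (hb1.trans (mul_le_mul_of_nonneg_right (le_abs_self _) hy6))
      (hb0.trans (mul_le_mul_of_nonneg_right (le_abs_self _) hy6)))
  have hE := abs_exp_sub_le hy0.le (by linarith) (by positivity) hD
  have hF := h y hy0.le hy
  rw [hW] at hF
  rw [abs_le] at *
  constructor <;> linarith

theorem eq_zero_of_hasSum_mul_pow {a : ℕ → ℝ}
    (h : ∀ t : ℝ, 0 < t → t ≤ 1 / 4 → HasSum (fun l => a l * t ^ l) 0) (n : ℕ) : a n = 0 := by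
  induction n using Nat.strong_induction_on with
  | _ n ih =>
    have hle : ∀ t : ℝ, 0 < t → t ≤ 1 / 4 →
        HasSum (fun l => a (l + (n + 1)) * t ^ l) (-(a n) / t) := fun t ht ht' => by
      have h1 := (hasSum_nat_add_iff' (n + 1)).2 (h t ht ht')
      rw [Finset.sum_range_succ, Finset.sum_eq_zero fun i hi => by
        rw [ih i (Finset.mem_range.1 hi), zero_mul], zero_add, zero_sub] at h1
      have h2 := h1.div_const (t ^ (n + 1))
      rw [show -(a n * t ^ n) / t ^ (n + 1) = -(a n) / t by rw [pow_succ]; field_simp] at h2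
      refine h2.congr_fun fun l => ?_
      rw [pow_add]
      field_simp
    have hC := (hle (1 / 4) (by norm_num) le_rfl).summable.abs.hasSum
    set C := ∑' l, |a (l + (n + 1)) * (1 / 4 : ℝ) ^ l|
    have hb : ∀ t : ℝ, 0 < t → t ≤ 1 / 4 → |a n| ≤ C * t := fun t ht ht' => by
      have h1 := tsum_of_norm_bounded hC (f := fun l => a (l + (n + 1)) * t ^ l) fun l => by
        rw [Real.norm_eq_abs, abs_mul, abs_mul, abs_of_nonneg (show 0 ≤ t ^ l by positivity),
          abs_of_nonneg (show 0 ≤ (1 / 4 : ℝ) ^ l by positivity)]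
        gcongr
      rwa [(hle t ht ht').tsum_eq, Real.norm_eq_abs, abs_div, abs_neg, abs_of_pos ht,
        div_le_iff₀ ht] at h1
    have hlim : Filter.Tendsto (fun t : ℝ => C * t) (nhdsWithin 0 (Set.Ioi 0)) (nhds (C * 0)) :=
      ((continuous_const.mul continuous_id).tendsto 0).mono_left nhdsWithin_le_nhds
    have := ge_of_tendsto hlim (b := |a n|) (by
      filter_upwards [Ioc_mem_nhdsGT (show (0 : ℝ) < 1 / 4 by norm_num)] with t ht
        using hb t ht.1 ht.2)
    simpa using this

theorem hasSum_mul_of_nonneg {ι κ : Type*} {f : ι → ℝ} {g : κ → ℝ} {a b : ℝ} (hf : HasSum f a)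
    (hg : HasSum g b) (hf0 : 0 ≤ f) (hg0 : 0 ≤ g) :
    HasSum (fun p : ι × κ => f p.1 * g p.2) (a * b) :=
  hf.mul hg (hf.summable.mul_of_nonneg hg.summable hf0 hg0)

theorem hasSum_prod_of_nonneg {n : ℕ} {f : Fin n → ℕ → ℝ} {s : Fin n → ℝ}
    (hf : ∀ i c, 0 ≤ f i c) (hs : ∀ i, HasSum (f i) (s i)) :
    HasSum (fun c : Fin n → ℕ => ∏ i, f i (c i)) (∏ i, s i) := by
  induction n with
  | zero => simp
  | succ n ih =>
    have h := ih (fun i => hf i.succ) (fun i => hs i.succ)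
    have hf0 : 0 ≤ f 0 := Pi.le_def.2 (hf 0)
    have hprod : 0 ≤ fun c : Fin n → ℕ => ∏ i, f i.succ (c i) :=
      Pi.le_def.2 fun c => Finset.prod_nonneg fun i _ => hf i.succ (c i)
    have hm := hasSum_mul_of_nonneg (hs 0) h hf0 hprod
    let e : ℕ × (Fin n → ℕ) ≃ (Fin (n + 1) → ℕ) := Fin.consEquiv fun _ => ℕ
    rw [Fin.prod_univ_succ, ← e.hasSum_iff]
    refine hm.congr_fun fun p => ?_
    simp [e, Fin.consEquiv, Fin.prod_univ_succ]

/-- Strictly decreasing quadruples of positive integers as iterated dependent pairs. -/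
def strictAntiEquiv :
    (Σ a : ℕ, Σ i : Fin a, Σ j : Fin i, Fin j)
      ≃ {m : Fin 4 → ℕ // StrictAnti m ∧ ∀ i, 0 < m i} where
  toFun p := ⟨![p.1 + 1, p.2.1 + 1, p.2.2.1 + 1, p.2.2.2 + 1], by
    obtain ⟨a, i, j, k⟩ := p
    refine ⟨Fin.strictAnti_iff_succ_lt.2 fun x => ?_, fun x => ?_⟩
    · fin_cases x
      · simp
      · simp
      · simp
    · fin_cases x <;> simp⟩
  invFun m := ⟨m.1 0 - 1,
    ⟨m.1 1 - 1, by have := m.2.1 (show (0 : Fin 4) < 1 by decide); have := m.2.2 1; omega⟩,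
    ⟨m.1 2 - 1, by
      have := m.2.1 (show (1 : Fin 4) < 2 by decide); have := m.2.2 2; simp only; omega⟩,
    ⟨m.1 3 - 1, by
      have := m.2.1 (show (2 : Fin 4) < 3 by decide); have := m.2.2 3; simp only; omega⟩⟩
  left_inv p := rfl
  right_inv m := by
    refine Subtype.ext (funext fun x => ?_)
    have := m.2.2 x
    fin_cases x <;> exact Nat.sub_add_cancel this

theorem hasSum_strictAnti_of_nonneg {w u : ℕ → ℝ} {s : ℝ} (hw : ∀ n, 0 < n → 0 ≤ w n)
    (hu : ∀ n, 0 < n → 0 ≤ u n)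
    (hs : HasSum (fun a => w (a + 1) * ∑ i ∈ Finset.range a, u (i + 1) *
      ∑ j ∈ Finset.range i, u (j + 1) * ∑ k ∈ Finset.range j, u (k + 1)) s) :
    HasSum (fun m : {m : Fin 4 → ℕ // StrictAnti m ∧ ∀ i, 0 < m i} =>
      w (m.1 0) * ∏ i : Fin 3, u (m.1 i.succ)) s := by
  rw [← strictAntiEquiv.hasSum_iff]
  have hin : ∀ a : ℕ, HasSum (fun p : Σ i : Fin a, Σ j : Fin i, Fin j =>
      ((fun m : {m : Fin 4 → ℕ // StrictAnti m ∧ ∀ i, 0 < m i} =>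
        w (m.1 0) * ∏ i : Fin 3, u (m.1 i.succ)) ∘ strictAntiEquiv) ⟨a, p⟩)
      (w (a + 1) * ∑ i ∈ Finset.range a, u (i + 1) *
        ∑ j ∈ Finset.range i, u (j + 1) * ∑ k ∈ Finset.range j, u (k + 1)) := fun a => by
    convert hasSum_fintype _ using 1
    rw [Fintype.sum_sigma, ← Fin.sum_univ_eq_sum_range, Finset.mul_sum]
    refine Finset.sum_congr rfl fun i _ => ?_
    rw [Fintype.sum_sigma, ← Fin.sum_univ_eq_sum_range, Finset.mul_sum, Finset.mul_sum]
    refine Finset.sum_congr rfl fun j _ => ?_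
    rw [← Fin.sum_univ_eq_sum_range, Finset.mul_sum, Finset.mul_sum, Finset.mul_sum]
    refine Finset.sum_congr rfl fun k _ => ?_
    simp only [Function.comp_apply, Fin.prod_univ_three, mul_assoc]
    rfl
  refine HasSum.sigma_of_hasSum hs hin ?_
  refine (summable_sigma_of_nonneg fun p => mul_nonneg (hw _ ((strictAntiEquiv p).2.2 _))
    (Finset.prod_nonneg fun i _ => hu _ ((strictAntiEquiv p).2.2 _))).2
    ⟨fun a => (hin a).summable, ?_⟩
  exact hs.summable.congr fun a => (hin a).tsum_eq.symm

theorem hasSum_ite_pow {x : ℝ} (h0 : 0 ≤ x) (h1 : x < 1) (r : ℕ) :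
    HasSum (fun l : ℕ => if r ≤ l then x ^ l else 0) (x ^ r * (1 - x)⁻¹) := by
  rw [← hasSum_nat_add_iff' r, Finset.sum_eq_zero (fun i hi => if_neg (by
    have := Finset.mem_range.1 hi; omega)), sub_zero]
  refine ((hasSum_geometric_of_lt_one h0 h1).mul_left (x ^ r)).congr_fun fun l => ?_
  rw [if_pos (by omega), pow_add, mul_comm]

theorem hasSum_ite_choose_mul_pow {x : ℝ} (h0 : 0 ≤ x) (h1 : x < 1) (r : ℕ) :
    HasSum (fun l : ℕ => (if r + 2 ≤ l then ((l - 1).choose r : ℝ) else 0) * x ^ l)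
      ((x * (1 - x)⁻¹) ^ (r + 1) - x ^ (r + 1)) := by
  have h := hasSum_choose_mul_geometric_of_norm_lt_one r
    (show ‖x‖ < 1 by rwa [Real.norm_of_nonneg h0])
  have h' := (hasSum_nat_add_iff' 1).2 (h.mul_left (x ^ (r + 1)))
  rw [← hasSum_nat_add_iff' (r + 2), Finset.sum_eq_zero (fun i hi => by
    rw [if_neg (by have := Finset.mem_range.1 hi; omega), zero_mul]), sub_zero]
  convert h' using 1
  · ext l
    rw [if_pos (by omega), show l + (r + 2) - 1 = l + 1 + r by omega]
    ring
  · simp [mul_pow]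

theorem rz_eq_tsum (k : ℕ) : rz k = ∑' n : ℕ, (((n : ℝ) + 1) ^ k)⁻¹ := by
  rw [rz, tsum_pnat_eq_tsum_succ (f := fun n : ℕ => ((n : ℝ) ^ k)⁻¹)]
  simp

theorem hasSum_mul_rz_mul_pow {t : ℝ} (ht0 : 0 ≤ t) {c : ℕ → ℝ} (hc : ∀ l, 0 ≤ c l)
    {g : ℕ → ℝ} {s : ℝ} (hg : ∀ n : ℕ, HasSum (fun l => c l * (t * ((n : ℝ) + 1)⁻¹) ^ l) (g n))
    (hs : HasSum g s) : HasSum (fun l => c l * rz l * t ^ l) s := by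
  have h := hasSum_tsum_comm_of_nonneg
    (fun n l => mul_nonneg (hc l) (by positivity)) hg hs
  refine h.congr_fun fun l => ?_
  rw [rz_eq_tsum, mul_right_comm, ← tsum_mul_left]
  refine tsum_congr fun n => ?_
  rw [mul_pow, inv_pow, mul_assoc]

theorem inv_sub_eq_mul_inv_one_sub (t : ℝ) (n : ℕ) :
    ((n : ℝ) + 1 - t)⁻¹ = ((n : ℝ) + 1)⁻¹ * (1 - t * ((n : ℝ) + 1)⁻¹)⁻¹ := by
  rw [← mul_inv]
  congr 1
  field_simp

theorem mul_inv_lt_one {t : ℝ} (ht : t < 1) (n : ℕ) : t * ((n : ℝ) + 1)⁻¹ < 1 := by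
  rw [← div_eq_mul_inv, div_lt_one (by positivity)]
  linarith [add_one_sub_pos ht n]

theorem hasSum_rz_mul_pow {t s : ℝ} (ht0 : 0 ≤ t) (ht : t ≤ 1 / 4) (r : ℕ)
    (hs : HasSum (fun n : ℕ => ((n : ℝ) + 1 - t)⁻¹ * ((n : ℝ) + 1)⁻¹ ^ (r + 1)) s) :
    HasSum (fun l => (if r + 2 ≤ l then 1 else 0) * rz l * t ^ l) (t ^ (r + 2) * s) := by
  refine hasSum_mul_rz_mul_pow ht0 (fun l => by split_ifs <;> norm_num) (fun n => ?_)
    (hs.mul_left (t ^ (r + 2)))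
  have h := hasSum_ite_pow (x := t * ((n : ℝ) + 1)⁻¹) (by positivity)
    (mul_inv_lt_one (by linarith) n) (r + 2)
  rw [inv_sub_eq_mul_inv_one_sub t n]
  convert h using 1
  · ext l; split_ifs <;> simp
  · rw [mul_pow]; ring

theorem hasSum_choose_mul_rz_mul_pow {t : ℝ} (ht0 : 0 ≤ t) (ht : t ≤ 1 / 4) {r : ℕ}
    (hr : 1 ≤ r) :
    HasSum (fun l => (if r + 2 ≤ l then ((l - 1).choose r : ℝ) else 0) * rz l * t ^ l)
      (t ^ (r + 1) * (∑' n : ℕ, ((n : ℝ) + 1 - t)⁻¹ ^ (r + 1)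
        - ∑' n : ℕ, ((n : ℝ) + 1)⁻¹ ^ (r + 1))) := by
  have h1 := (summable_inv_sub_pow ht (show 2 ≤ r + 1 by omega)).hasSum
  have h0 := (summable_inv_sub_pow (show (0 : ℝ) ≤ 1 / 4 by norm_num)
    (show 2 ≤ r + 1 by omega)).hasSum
  simp only [sub_zero] at h0
  refine hasSum_mul_rz_mul_pow ht0 (fun l => by split_ifs <;> positivity) (fun n => ?_)
    ((h1.sub h0).mul_left (t ^ (r + 1)))
  have h := hasSum_ite_choose_mul_pow (x := t * ((n : ℝ) + 1)⁻¹) (by positivity)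
    (mul_inv_lt_one (by linarith) n) r
  rw [mul_assoc, ← inv_sub_eq_mul_inv_one_sub t n, mul_pow, mul_pow, ← mul_sub] at h
  exact h

/-- The weighted sum of multiple zeta values of depth four and weight `l`. -/
noncomputable def weightedMzvSum (l : ℕ) : ℝ :=
  ∑ c ∈ (Finset.Nat.antidiagonalTuple 4 l).filter (fun c => 2 ≤ c 0 ∧ ∀ i, 1 ≤ c i),
    (2 : ℝ) ^ (c 0 - 1) * mzv c

theorem hasSum_weightedMzvSum_mul_pow {t s : ℝ} (ht0 : 0 ≤ t) (ht : t ≤ 1 / 4)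
    (hs : HasSum (fun m : ℕ => (((m : ℝ) + 1 - 2 * t)⁻¹ - ((m : ℝ) + 1)⁻¹) * esymmShift t m 3)
      s) :
    HasSum (fun l => weightedMzvSum l * t ^ l) (t ^ 4 * s) := by
  let φ : ℕ → ℕ → ℝ := fun n c => if 2 ≤ c then 2 ^ (c - 1) * (t ^ c * ((n : ℝ) ^ c)⁻¹) else 0
  let ψ : ℕ → ℕ → ℝ := fun n c => if 1 ≤ c then t ^ c * ((n : ℝ) ^ c)⁻¹ else 0
  have hψ0 : ∀ n c, 0 ≤ ψ n c := fun n c => by simp only [ψ]; split_ifs <;> positivity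
  have hφ0 : ∀ n c, 0 ≤ φ n c := fun n c => by simp only [φ]; split_ifs <;> positivity
  have hψ : ∀ n : ℕ, HasSum (ψ (n + 1)) (t * ((n : ℝ) + 1 - t)⁻¹) := fun n => by
    have h := hasSum_ite_pow (x := t * ((n : ℝ) + 1)⁻¹) (by positivity)
      (mul_inv_lt_one (by linarith) n) 1
    rw [pow_one, mul_assoc, ← inv_sub_eq_mul_inv_one_sub t n] at h
    refine h.congr_fun fun c => ?_
    simp only [ψ, mul_pow, inv_pow]
    push_cast
    rfl
  have hφ : ∀ n : ℕ, HasSum (φ (n + 1)) (t * (((n : ℝ) + 1 - 2 * t)⁻¹ - ((n : ℝ) + 1)⁻¹)) :=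
    fun n => by
      have h := (hasSum_ite_pow (x := 2 * t * ((n : ℝ) + 1)⁻¹) (by positivity)
        (mul_inv_lt_one (by linarith) n) 2).mul_left (1 / 2)
      have e : 1 / 2 * ((2 * t * ((n : ℝ) + 1)⁻¹) ^ 2 * (1 - 2 * t * ((n : ℝ) + 1)⁻¹)⁻¹)
          = t * (((n : ℝ) + 1 - 2 * t)⁻¹ - ((n : ℝ) + 1)⁻¹) := by
        have hp := add_one_sub_pos (show 2 * t < 1 by linarith) n
        have h2 := inv_sub_eq_mul_inv_one_sub (2 * t) n
        calc _ = 2 * t ^ 2 * ((n : ℝ) + 1)⁻¹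
              * (((n : ℝ) + 1)⁻¹ * (1 - 2 * t * ((n : ℝ) + 1)⁻¹)⁻¹) := by ring
          _ = _ := by
            rw [← h2]
            field_simp
            ring
      rw [e] at h
      refine h.congr_fun fun c => ?_
      simp only [φ]
      split_ifs with hc
      · obtain ⟨c, rfl⟩ := Nat.exists_eq_add_of_le hc
        rw [show 2 + c - 1 = c + 1 by omega, mul_pow, mul_pow, inv_pow]
        push_cast
        ring
      · simp
  let F : {m : Fin 4 → ℕ // StrictAnti m ∧ ∀ i, 0 < m i} → (Fin 4 → ℕ) → ℝ :=
    fun m c => φ (m.1 0) (c 0) * ∏ i : Fin 3, ψ (m.1 i.succ) (c i.succ)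
  let w : ℕ → ℝ := fun n => t * (((n : ℝ) - 2 * t)⁻¹ - (n : ℝ)⁻¹)
  let u : ℕ → ℝ := fun n => t * ((n : ℝ) - t)⁻¹
  have hw : ∀ n, 0 < n → HasSum (φ n) (w n) := fun n hn => by
    obtain ⟨n, rfl⟩ := Nat.exists_eq_succ_of_ne_zero hn.ne'
    simpa [w] using hφ n
  have hu : ∀ n, 0 < n → HasSum (ψ n) (u n) := fun n hn => by
    obtain ⟨n, rfl⟩ := Nat.exists_eq_succ_of_ne_zero hn.ne'
    simpa [u] using hψ n
  have hF : ∀ m, HasSum (F m) (w (m.1 0) * ∏ i : Fin 3, u (m.1 i.succ)) := fun m => by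
    have h := hasSum_prod_of_nonneg (n := 4)
      (f := Fin.cons (φ (m.1 0)) fun i : Fin 3 => ψ (m.1 i.succ))
      (s := Fin.cons (w (m.1 0)) fun i : Fin 3 => u (m.1 i.succ))
      (fun i => Fin.cases (fun c => hφ0 _ c) (fun i c => hψ0 _ c) i)
      (fun i => Fin.cases (hw _ (m.2.2 _)) (fun i => hu _ (m.2.2 _)) i)
    simpa only [Fin.prod_univ_succ (n := 3), Fin.cons_zero, Fin.cons_succ] using h
  have hm := hasSum_strictAnti_of_nonneg (w := w) (u := u) (s := t ^ 4 * s)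
    (fun n hn => (hw n hn).nonneg (hφ0 n)) (fun n hn => (hu n hn).nonneg (hψ0 n)) (by
      refine (hs.mul_left (t ^ 4)).congr_fun fun m => ?_
      simp only [esymmShift_succ_eq_sum, esymmShift_zero_right, w, u, Finset.mul_sum]
      push_cast
      refine Finset.sum_congr rfl fun i _ => Finset.sum_congr rfl fun j _ =>
        Finset.sum_congr rfl fun k _ => ?_
      ring)
  have hc := hasSum_tsum_comm_of_nonneg
    (fun m c => mul_nonneg (hφ0 _ _) (Finset.prod_nonneg fun i _ => hψ0 _ _)) hF hm
  rw [← (Finset.Nat.sigmaAntidiagonalTupleEquivTuple 4).hasSum_iff] at hc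
  refine (hc.sigma fun l => hasSum_fintype _).congr_fun fun l => ?_
  rw [weightedMzvSum, Finset.sum_filter, Finset.sum_mul, ← Finset.sum_coe_sort]
  refine Finset.sum_congr rfl fun c _ => ?_
  obtain ⟨c, hcl⟩ := c
  rw [Finset.Nat.mem_antidiagonalTuple] at hcl
  simp only [Function.comp_apply, Finset.Nat.sigmaAntidiagonalTupleEquivTuple_apply, φ, ψ]
  by_cases h : 2 ≤ c 0 ∧ ∀ i, 1 ≤ c i
  · rw [if_pos h, mzv, mul_right_comm, ← tsum_mul_left]
    refine tsum_congr fun m => ?_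
    rw [if_pos h.1, Finset.prod_congr rfl fun i _ => if_pos (h.2 (Fin.succ i)),
      Finset.prod_mul_distrib, Finset.prod_pow_eq_pow_sum, Fin.prod_univ_succ (n := 3), ← hcl,
      Fin.sum_univ_succ (n := 3), pow_add]
    ring
  · rw [if_neg h, zero_mul, eq_comm]
    refine (tsum_congr fun m => ?_).trans tsum_zero
    by_cases h0 : 2 ≤ c 0
    · obtain ⟨i, hi⟩ : ∃ i, ¬ 1 ≤ c i := by
        by_contra hcon
        push Not at hcon
        exact h ⟨h0, hcon⟩
      cases i using Fin.cases with
      | zero => omega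
      | succ i => rw [Finset.prod_eq_zero (Finset.mem_univ i) (if_neg hi), mul_zero]
    · rw [if_neg h0, zero_mul]

theorem summable_inv_sub_mul_inv_pow {t : ℝ} (ht : t ≤ 1 / 4) {k : ℕ} (hk : 1 ≤ k) :
    Summable (fun n : ℕ => ((n : ℝ) + 1 - t)⁻¹ * ((n : ℝ) + 1)⁻¹ ^ k) := by
  have h := ((summable_nat_add_iff 1).2
    (Real.summable_nat_pow_inv.2 (show 1 < k + 1 by omega))).mul_left 2
  refine Summable.of_nonneg_of_le (fun n => ?_) (fun n => ?_) h
  · have := add_one_sub_pos (show t < 1 by linarith) n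
    positivity
  · push_cast
    rw [← inv_pow, pow_succ', ← mul_assoc]
    exact mul_le_mul_of_nonneg_right (sub_inv_le (by linarith) n) (by positivity)

theorem hasSum_weightedMzvSum_mul_pow_closed {t : ℝ} (ht0 : 0 < t) (ht : t ≤ 1 / 4) :
    HasSum (fun l => weightedMzvSum l * t ^ l)
      (t ^ 4 * ∑' m, weightDiff t m * esymmShift t m 3
        + t ^ 5 * ∑' n : ℕ, ((n : ℝ) + 1 - t)⁻¹ * ((n : ℝ) + 1)⁻¹ ^ 4) := by
  have hS := hasSum_sum_formula ht 3
    (summable_inv_sub_mul_inv_pow ht (show 1 ≤ 3 + 1 by norm_num)).hasSum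
  have h := (summable_weightDiff_mul_esymmShift ht0.le ht 3).hasSum.add (hS.mul_left t)
  convert hasSum_weightedMzvSum_mul_pow ht0.le ht (h.congr_fun fun m => ?_) using 1
  · ring
  · have h1 := add_one_sub_pos (show t < 1 by linarith) m
    have h2 := add_one_sub_pos (show 2 * t < 1 by linarith) m
    rw [weightDiff]
    field_simp
    ring

/-- The coefficients of `t² ∑ (1 / (n - t)² - 1 / n²)`. -/
noncomputable def rzDerivCoeff (j : ℕ) : ℝ := (if 3 ≤ j then ((j - 1).choose 1 : ℝ) else 0) * rz j

theorem hasSum_antidiagonal_rzDerivCoeff {t s : ℝ}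
    (hs : HasSum (fun j => rzDerivCoeff j * t ^ j) s) :
    HasSum (fun l => (∑ p ∈ Finset.HasAntidiagonal.antidiagonal l,
      rzDerivCoeff p.1 * rzDerivCoeff p.2) * t ^ l) (s ^ 2) := by
  have hn : Summable fun j => ‖rzDerivCoeff j * t ^ j‖ := hs.summable.norm
  have h := (summable_norm_sum_mul_antidiagonal_of_summable_norm hn hn).of_norm.hasSum
  rw [← tsum_mul_tsum_eq_tsum_sum_antidiagonal_of_summable_norm hn hn, hs.tsum_eq, ← sq] at h
  refine h.congr_fun fun l => ?_
  rw [Finset.sum_mul]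
  refine Finset.sum_congr rfl fun p hp => ?_
  rw [← Finset.HasAntidiagonal.mem_antidiagonal.1 hp, pow_add]
  ring

theorem weightedMzvSum_eq (l : ℕ) :
    weightedMzvSum l = (if 5 ≤ l then 1 else 0) * rz l
      + 1 / 4 * ((if 5 ≤ l then ((l - 1).choose 3 : ℝ) else 0) * rz l)
      - 1 / 4 * ∑ p ∈ Finset.HasAntidiagonal.antidiagonal l,
        rzDerivCoeff p.1 * rzDerivCoeff p.2 := by
  rw [← sub_eq_zero]
  refine eq_zero_of_hasSum_mul_pow (a := fun l => weightedMzvSum l - ((if 5 ≤ l then 1 else 0)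
    * rz l + 1 / 4 * ((if 5 ≤ l then ((l - 1).choose 3 : ℝ) else 0) * rz l)
      - 1 / 4 * ∑ p ∈ Finset.HasAntidiagonal.antidiagonal l, rzDerivCoeff p.1 * rzDerivCoeff p.2))
    (fun t ht0 ht => ?_) l
  have hA := hasSum_weightedMzvSum_mul_pow_closed ht0 ht
  have h1 := hasSum_rz_mul_pow ht0.le ht 3
    (summable_inv_sub_mul_inv_pow ht (show 1 ≤ 3 + 1 by norm_num)).hasSum
  have h3 := hasSum_choose_mul_rz_mul_pow ht0.le ht (show 1 ≤ 3 by norm_num)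
  have h2 := hasSum_antidiagonal_rzDerivCoeff
    (hasSum_choose_mul_rz_mul_pow ht0.le ht (le_refl 1))
  have h4 := four_mul_tsum_weightDiff_mul_esymmShift ht0 ht
  have h := hA.sub ((h1.add (h3.mul_left (1 / 4))).sub (h2.mul_left (1 / 4)))
  refine HasSum.congr_fun (Eq.subst (motive := HasSum _) ?_ h) fun l => ?_
  · linear_combination (t ^ 4 / 4) * h4
  · simp only [rzDerivCoeff]
    ring

theorem sum_antidiagonal_rzDerivCoeff (l : ℕ) (hl : 5 ≤ l) :
    ∑ p ∈ Finset.HasAntidiagonal.antidiagonal l, rzDerivCoeff p.1 * rzDerivCoeff p.2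
      = ∑ j ∈ Finset.Icc 3 (l - 3),
          ((j : ℝ) - 1) * ((l : ℝ) - (j : ℝ) - 1) * rz j * rz (l - j) := by
  rw [Finset.Nat.sum_antidiagonal_eq_sum_range_succ (fun i j => rzDerivCoeff i * rzDerivCoeff j)]
  symm
  refine Finset.sum_subset_zero_on_sdiff (fun j hj => ?_) (fun j hj => ?_) fun j hj => ?_
  · rw [Finset.mem_Icc] at hj
    exact Finset.mem_range.2 (by omega)
  · rw [Finset.mem_sdiff, Finset.mem_Icc, Finset.mem_range] at hj
    by_cases h3 : 3 ≤ j
    · rw [rzDerivCoeff, rzDerivCoeff, if_neg (show ¬ 3 ≤ l - j by omega)]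
      ring
    · rw [rzDerivCoeff, if_neg h3]
      ring
  · rw [Finset.mem_Icc] at hj
    rw [rzDerivCoeff, rzDerivCoeff, if_pos hj.1, if_pos (by omega), Nat.choose_one_right,
      Nat.choose_one_right, Nat.cast_sub (by omega), Nat.cast_sub (by omega),
      Nat.cast_sub (by omega)]
    push_cast
    ring

theorem cast_choose_three (n : ℕ) :
    ((n + 2).choose 3 : ℝ) = ((n : ℝ) + 2) * (n + 1) * n / 6 := by
  induction n with
  | zero => simp
  | succ n ih =>
    rw [show n + 1 + 2 = (n + 2) + 1 by ring, Nat.choose_succ_succ' (n + 2) 2, Nat.cast_add, ih,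
      Nat.cast_choose_two]
    push_cast
    ring

/-- Proposition 4.2 (ii) of Machide: for `l ≥ 5`,
`((l+1)(l²-7l+18)/24) ζ(l)
  = Σ_{l₁≥2, l₂,l₃,l₄≥1, Σ=l} 2^(l₁-1) ζ(l₁,l₂,l₃,l₄)
    + (1/4) Σ_{j₁,j₂≥3, j₁+j₂=l} (j₁-1)(j₂-1) ζ(j₁)ζ(j₂)`,
with `j₂ = l - j₁`. -/
theorem weighted_sum_depth_four_ii (l : ℕ) (hl : 5 ≤ l) :
    ((l : ℝ) + 1) * ((l : ℝ) ^ 2 - 7 * (l : ℝ) + 18) / 24 * rz l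
      = (∑ c ∈ (Finset.Nat.antidiagonalTuple 4 l).filter
            (fun c => 2 ≤ c 0 ∧ ∀ i, 1 ≤ c i),
          (2 : ℝ) ^ (c 0 - 1) * mzv c)
        + (1 / 4) * (∑ j ∈ Finset.Icc 3 (l - 3),
            ((j : ℝ) - 1) * ((l : ℝ) - (j : ℝ) - 1) * rz j * rz (l - j)) := by
  have h := weightedMzvSum_eq l
  rw [if_pos hl, if_pos hl, sum_antidiagonal_rzDerivCoeff l hl] at h
  obtain ⟨n, rfl⟩ := Nat.exists_eq_add_of_le' (show 3 ≤ l by omega)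
  rw [show n + 3 - 1 = n + 2 by omega, cast_choose_three] at h
  rw [← weightedMzvSum, h]
  push_cast
  ring
end
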